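/- Let p ∈ (0,1) and q, q' ∈ [0,1)^ℤ. (a) If κ_△(p, q_n, q'_n) ≤ 0 for every n ∈ ℤ, then P^△_{p,q,q'}-almost surely there is no infinite open cluster. (b) If there exists δ > 0 such that κ_△(p, q_n, q'_n) ≤ −δ for every n ∈ ℤ, then there exist c, d > 0 such that for every vertex v, P^△_{p,q,q'}(|C_v| ≥ k) ≤ c·e^{−dk} for all k ≥ 0. (c) If there exists δ > 0 such that κ_△(p, q_n, q'_n) ≥ δ for every n ∈ ℤ, then P^△_{p,q,q'} is uniformly supercritical. The same three statements hold for the hexagonal-lattice measure P^⬡_{p,q,q'} with κ_⬡ in place of κ_△. -/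

import Mathlib

open MeasureTheory Set

set_option linter.unusedVariables false

namespace Perc

/-- Points of the plane. -/
abbrev Pt := ℝ × ℝ

/-- A lattice embedded in the plane, with edges indexed by `E`;
each edge is embedded as the segment between the two endpoints given by `ends`. -/
structure LatticeOn (E : Type) where
  ends : E → Pt × Pt

/-- Bond configurations. -/
abbrev Config (E : Type) := E → Bool

/-- `P` is the Bernoulli bond-percolation product measure in which edge `e`
is open with probability `p e`, independently over edges. -/
def IsBernoulliProduct {E : Type} (p : E → ℝ) (P : Measure (Config E)) : Prop :=
  IsProbabilityMeasure P ∧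
    ∀ (s : Finset E) (f : E → Bool),
      P {ω | ∀ e ∈ s, ω e = f e} =
        ∏ e ∈ s, ENNReal.ofReal (if f e then p e else 1 - p e)

/-- The union of the closed segments of the open edges. -/
def openEdgeSet {E : Type} (L : LatticeOn E) (ω : Config E) : Set Pt :=
  ⋃ e ∈ {e : E | ω e = true}, segment ℝ (L.ends e).1 (L.ends e).2

/-- There is an arc, contained in `S` and in the union of the open edges,
with one endpoint in `A` and the other in `B`. -/
def CrossingIn {E : Type} (L : LatticeOn E) (ω : Config E) (S A B : Set Pt) : Prop :=
  ∃ γ : ℝ → Pt, ContinuousOn γ (Icc 0 1) ∧ γ 0 ∈ A ∧ γ 1 ∈ B ∧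
    ∀ t ∈ Icc (0:ℝ) 1, γ t ∈ S ∩ openEdgeSet L ω

/-- Rotation of the plane by angle `θ`. -/
noncomputable def rot (θ : ℝ) (z : Pt) : Pt :=
  (Real.cos θ * z.1 - Real.sin θ * z.2, Real.sin θ * z.1 + Real.cos θ * z.2)

/-- `f` comprises a rotation and a translation. -/
def IsRotTrans (f : Pt → Pt) : Prop := ∃ θ : ℝ, ∃ t : Pt, f = fun z => rot θ z + t

def stdRect (h l : ℝ) : Set Pt := {z | 0 ≤ z.1 ∧ z.1 ≤ h ∧ 0 ≤ z.2 ∧ z.2 ≤ l}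
def leftSide (h l : ℝ) : Set Pt := {z | z.1 = 0 ∧ 0 ≤ z.2 ∧ z.2 ≤ l}
def rightSide (h l : ℝ) : Set Pt := {z | z.1 = h ∧ 0 ≤ z.2 ∧ z.2 ≤ l}
def bottomSide (h l : ℝ) : Set Pt := {z | z.2 = 0 ∧ 0 ≤ z.1 ∧ z.1 ≤ h}
def topSide (h l : ℝ) : Set Pt := {z | z.2 = l ∧ 0 ≤ z.1 ∧ z.1 ≤ h}

/-- The box `f(stdRect h l)` (where `f` is a rotation plus translation) possesses
open crossings in both directions. -/
def HasBoxCrossings {E : Type} (L : LatticeOn E) (ω : Config E) (h l : ℝ) (f : Pt → Pt) : Prop :=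
  CrossingIn L ω (f '' stdRect h l) (f '' leftSide h l) (f '' rightSide h l) ∧
  CrossingIn L ω (f '' stdRect h l) (f '' bottomSide h l) (f '' topSide h l)

/-- The box-crossing property: for every `α > 0` there is `δ > 0` such that every box
of size `αN × N` (any position and orientation) possesses open crossings with
probability at least `δ`, for all large `N`. -/
def BoxCrossingProperty {E : Type} (L : LatticeOn E) (P : Measure (Config E)) : Prop :=
  ∀ α : ℝ, 0 < α → ∃ δ : ℝ, 0 < δ ∧ ∃ N₀ : ℕ, ∀ N : ℕ, N₀ ≤ N →
    ∀ f : Pt → Pt, IsRotTrans f →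
      ENNReal.ofReal δ ≤ P {ω | HasBoxCrossings L ω (α * N) N f}

/-- Horizontal-crossing event of the box `[-m,m] × [0,n]`. -/
def Ch {E : Type} (L : LatticeOn E) (m n : ℝ) (ω : Config E) : Prop :=
  CrossingIn L ω {z | -m ≤ z.1 ∧ z.1 ≤ m ∧ 0 ≤ z.2 ∧ z.2 ≤ n}
    {z | z.1 = -m ∧ 0 ≤ z.2 ∧ z.2 ≤ n} {z | z.1 = m ∧ 0 ≤ z.2 ∧ z.2 ≤ n}

/-- Vertical-crossing event of the box `[-m,m] × [0,n]`. -/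
def Cv {E : Type} (L : LatticeOn E) (m n : ℝ) (ω : Config E) : Prop :=
  CrossingIn L ω {z | -m ≤ z.1 ∧ z.1 ≤ m ∧ 0 ≤ z.2 ∧ z.2 ≤ n}
    {z | z.2 = 0 ∧ -m ≤ z.1 ∧ z.1 ≤ m} {z | z.2 = n ∧ -m ≤ z.1 ∧ z.1 ≤ m}

/-- `u` and `v` are the endpoints of some open edge. -/
def openAdj {E : Type} (L : LatticeOn E) (ω : Config E) (u v : Pt) : Prop :=
  ∃ e, ω e = true ∧ (L.ends e = (u, v) ∨ L.ends e = (v, u))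

/-- `u` and `v` are joined by a path of open edges. -/
def openConn {E : Type} (L : LatticeOn E) (ω : Config E) : Pt → Pt → Prop :=
  Relation.ReflTransGen (openAdj L ω)

/-- The open cluster at `v`. -/
def cluster {E : Type} (L : LatticeOn E) (ω : Config E) (v : Pt) : Set Pt :=
  {u | openConn L ω v u}

/-- The vertex set of the lattice. -/
def vertexSet {E : Type} (L : LatticeOn E) : Set Pt :=
  ⋃ e : E, {(L.ends e).1, (L.ends e).2}

/-- `v` is the endpoint of an infinite open self-avoiding path. -/
def ConnToInfinity {E : Type} (L : LatticeOn E) (ω : Config E) (v : Pt) : Prop :=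
  ∃ γ : ℕ → Pt, γ 0 = v ∧ Function.Injective γ ∧ ∀ n, openAdj L ω (γ n) (γ (n + 1))

/-- Euclidean distance on the plane. -/
noncomputable def edist2 (u v : Pt) : ℝ := Real.sqrt ((u.1 - v.1) ^ 2 + (u.2 - v.2) ^ 2)

/-- `rad (C_v) ≥ r`, where `rad (C_v)` is the supremum of all `x` such that `C_v`
meets the complement of the open Euclidean ball `v + S_x`. -/
def RadiusGE {E : Type} (L : LatticeOn E) (ω : Config E) (v : Pt) (r : ℝ) : Prop :=
  ∀ x : ℝ, x < r → ∃ u ∈ cluster L ω v, x ≤ edist2 v u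

/-- `κ_□`. -/
def kappaS (a b : ℝ) : ℝ := a + b - 1
/-- `κ_△`. -/
def kappaT (a b c : ℝ) : ℝ := a + b + c - a * b * c - 1
/-- `κ_⬡`. -/
def kappaH (a b c : ℝ) : ℝ := -kappaT (1 - a) (1 - b) (1 - c)

/-- Edges of a square-type lattice: `(a, b, true)` is the `horizontal`-class edge
at `(a,b)` and `(a, b, false)` the `vertical`-class edge at `(a,b)`. -/
abbrev SqE := ℤ × ℤ × Bool
/-- Edges of the triangular lattice (also indexing the dual hexagonal edges):
`(a, b, i)` with `i = 0` horizontal, `i = 1` the right edge of an upwards pointing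
triangle, `i = 2` the left edge of an upwards pointing triangle, in row `b`. -/
abbrev TriE := ℤ × ℤ × Fin 3

/-- The unit square lattice, with vertex set `ℤ²`. -/
noncomputable def sqLattice : LatticeOn SqE :=
  ⟨fun e =>
    if e.2.2 then (((e.1 : ℝ), (e.2.1 : ℝ)), ((e.1 : ℝ) + 1, (e.2.1 : ℝ)))
    else (((e.1 : ℝ), (e.2.1 : ℝ)), ((e.1 : ℝ), (e.2.1 : ℝ) + 1))⟩

/-- The dual of the unit square lattice (shifted by `(1/2, 1/2)`), with each dual edge
indexed by the primal edge it crosses. -/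
noncomputable def sqDualLattice : LatticeOn SqE :=
  ⟨fun e =>
    if e.2.2 then
      (((e.1 : ℝ) + 1 / 2, (e.2.1 : ℝ) - 1 / 2), ((e.1 : ℝ) + 1 / 2, (e.2.1 : ℝ) + 1 / 2))
    else
      (((e.1 : ℝ) - 1 / 2, (e.2.1 : ℝ) + 1 / 2), ((e.1 : ℝ) + 1 / 2, (e.2.1 : ℝ) + 1 / 2))⟩

/-- Vertices of the triangular lattice (equilateral triangles of side `√3`,
one family of edges horizontal). -/
noncomputable def tv (a b : ℤ) : Pt :=
  (Real.sqrt 3 * ((a : ℝ) + (b : ℝ) / 2), 3 / 2 * (b : ℝ))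

/-- The triangular lattice. -/
noncomputable def triLattice : LatticeOn TriE :=
  ⟨fun e =>
    if e.2.2 = 0 then (tv e.1 e.2.1, tv (e.1 + 1) e.2.1)
    else if e.2.2 = 1 then (tv (e.1 + 1) e.2.1, tv e.1 (e.2.1 + 1))
    else (tv e.1 e.2.1, tv e.1 (e.2.1 + 1))⟩

/-- Circumcentre of the upwards pointing triangle with base vertex `tv a b`. -/
noncomputable def hup (a b : ℤ) : Pt :=
  (Real.sqrt 3 * ((a : ℝ) + ((b : ℝ) + 1) / 2), 3 / 2 * (b : ℝ) + 1 / 2)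

/-- Circumcentre of the downwards pointing triangle below the edge `tv a b – tv (a+1) b`. -/
noncomputable def hdown (a b : ℤ) : Pt :=
  (Real.sqrt 3 * ((a : ℝ) + ((b : ℝ) + 1) / 2), 3 / 2 * (b : ℝ) - 1 / 2)

/-- The hexagonal lattice, the planar dual of `triLattice`, with vertices at the
circumcentres of the triangles; each hexagonal edge is indexed by the triangular
edge it crosses. -/
noncomputable def hexLattice : LatticeOn TriE :=
  ⟨fun e =>
    if e.2.2 = 0 then (hdown e.1 e.2.1, hup e.1 e.2.1)
    else if e.2.2 = 1 then (hup e.1 e.2.1, hdown e.1 (e.2.1 + 1))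
    else (hup e.1 e.2.1, hdown (e.1 - 1) (e.2.1 + 1))⟩

/-- The square lattice with horizontal edges of length `√3` and vertical edges of
length `1` (as in the mixed lattices). -/
noncomputable def sqStretch : LatticeOn SqE :=
  ⟨fun e =>
    if e.2.2 then
      ((Real.sqrt 3 * (e.1 : ℝ), (e.2.1 : ℝ)), (Real.sqrt 3 * ((e.1 : ℝ) + 1), (e.2.1 : ℝ)))
    else ((Real.sqrt 3 * (e.1 : ℝ), (e.2.1 : ℝ)), (Real.sqrt 3 * (e.1 : ℝ), (e.2.1 : ℝ) + 1))⟩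

/-- Vertices of the square lattice rotated by `π/4`. -/
noncomputable def rv (a b : ℤ) : Pt :=
  (((a : ℝ) - (b : ℝ)) / Real.sqrt 2, ((a : ℝ) + (b : ℝ)) / Real.sqrt 2)

/-- The square lattice rotated by `π/4`: edges `(a,b,true)` are inclined at angle `π/4`
and edges `(a,b,false)` at angle `3π/4`; the row (height) of such an edge is `a + b`. -/
noncomputable def rsqLattice : LatticeOn SqE :=
  ⟨fun e =>
    if e.2.2 then (rv e.1 e.2.1, rv (e.1 + 1) e.2.1)
    else (rv e.1 e.2.1, rv e.1 (e.2.1 + 1))⟩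

/-- Inhomogeneous intensities on the square lattice: `ph` on horizontal edges,
`pv` on vertical ones. -/
def sqInt (ph pv : ℝ) : SqE → ℝ := fun e => if e.2.2 then ph else pv

/-- Inhomogeneous intensities on the triangular (or hexagonal) lattice:
`p0` on class-0 edges, `p1` on class-1, `p2` on class-2. -/
def triInt (p0 p1 p2 : ℝ) : TriE → ℝ := fun e => ![p0, p1, p2] e.2.2

/-- Highly inhomogeneous intensities on the triangular (or hexagonal) lattice:
`p` on horizontal-class edges, `q n` on right edges of upwards pointing triangles at
height `n`, `q' n` on left edges of upwards pointing triangles at height `n`. -/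
def triHI (p : ℝ) (q q' : ℤ → ℝ) : TriE → ℝ := fun e =>
  if e.2.2 = 0 then p else if e.2.2 = 1 then q e.2.1 else q' e.2.1

/-- Highly inhomogeneous intensities on the rotated square lattice: `q n` on edges
inclined at `π/4` at height `n`, `q' n` on edges inclined at `3π/4` at height `n`. -/
def rsqHI (q q' : ℤ → ℝ) : SqE → ℝ := fun e =>
  if e.2.2 then q (e.1 + e.2.1) else q' (e.1 + e.2.1)

set_option linter.unusedSectionVars false

section Expectation

variable {E : Type*}

open Classical in
/-- The indicator of a proposition. -/
noncomputable def ind (P : Prop) : ℝ := if P then 1 else 0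

/-- Intensities in the unit interval. -/
def Unit01 (p : E → ℝ) : Prop := ∀ e, 0 ≤ p e ∧ p e ≤ 1

/-- `f` depends only on the edges in `s`. -/
def DepOn {α : Type*} (f : Set E → α) (s : Set E) : Prop := ∀ t, f (t ∩ s) = f t

theorem ind_true {P : Prop} (h : P) : ind P = 1 := by simp [ind, h]
theorem ind_false {P : Prop} (h : ¬P) : ind P = 0 := by simp [ind, h]

theorem ind_nonneg (P : Prop) : 0 ≤ ind P := by
  by_cases h : P <;> simp [ind, h]

theorem ind_le_one (P : Prop) : ind P ≤ 1 := by
  by_cases h : P <;> simp [ind, h]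

theorem ind_mono {P Q : Prop} (h : P → Q) : ind P ≤ ind Q := by
  by_cases hP : P
  · simp [ind, hP, h hP]
  · simpa [ind, hP] using ind_nonneg Q

theorem ind_and (P Q : Prop) : ind (P ∧ Q) = ind P * ind Q := by
  by_cases hP : P <;> by_cases hQ : Q <;> simp [ind, hP, hQ]

theorem ind_not (P : Prop) : ind (¬P) = 1 - ind P := by
  by_cases hP : P <;> simp [ind, hP]

theorem DepOn.inter_eq {α : Type*} {f : Set E → α} {s : Set E} (h : DepOn f s) {t t' : Set E}
    (ht : t ∩ s = t' ∩ s) : f t = f t' := by rw [← h t, ht, h t']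

theorem DepOn.mono {α : Type*} {f : Set E → α} {s s' : Set E} (h : DepOn f s) (hs : s ⊆ s') :
    DepOn f s' := fun t => h.inter_eq (by rw [Set.inter_assoc, Set.inter_eq_right.2 hs])

theorem DepOn.ind {A : Set E → Prop} {s : Set E} (h : DepOn A s) :
    DepOn (fun t => Perc.ind (A t)) s := fun t => by simp only [h t]

theorem DepOn.and {A B : Set E → Prop} {s : Set E} (hA : DepOn A s) (hB : DepOn B s) :
    DepOn (fun t => A t ∧ B t) s := fun t => by simp only [hA t, hB t]

theorem DepOn.not {A : Set E → Prop} {s : Set E} (h : DepOn A s) :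
    DepOn (fun t => ¬A t) s := fun t => by simp only [h t]

theorem ind_monotone {A : Set E → Prop} (hA : Monotone A) : Monotone fun t => ind (A t) :=
  fun _ _ h => ind_mono (hA h)

variable [DecidableEq E]

/-- The expectation of `f` when the edges of `s` are open independently, `e` with probability
`p e`, and all other edges are closed. -/
noncomputable def Ex (p : E → ℝ) (s : Finset E) (f : Set E → ℝ) : ℝ :=
  ∑ t ∈ s.powerset, (∏ e ∈ t, p e) * (∏ e ∈ s \ t, (1 - p e)) * f ↑t

/-- The probability of the event `A` under the measure of `Ex`. -/
noncomputable def Pr (p : E → ℝ) (s : Finset E) (A : Set E → Prop) : ℝ :=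
  Ex p s fun t => ind (A t)

variable {p p' : E → ℝ} {s s₁ s₂ : Finset E} {f g : Set E → ℝ}

theorem Ex_empty (f : Set E → ℝ) : Ex p ∅ f = f ∅ := by simp [Ex]

theorem Ex_insert {e : E} (he : e ∉ s) (f : Set E → ℝ) :
    Ex p (insert e s) f = p e * Ex p s (fun t => f (insert e t)) + (1 - p e) * Ex p s f := by
  unfold Ex
  rw [Finset.sum_powerset_insert he, add_comm, Finset.mul_sum, Finset.mul_sum]
  congr 1
  · refine Finset.sum_congr rfl fun t ht => ?_
    have ht' : t ⊆ s := Finset.mem_powerset.1 ht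
    have het : e ∉ t := fun h => he (ht' h)
    rw [Finset.prod_insert het, Finset.insert_sdiff_insert,
      Finset.sdiff_insert_of_notMem he, Finset.coe_insert]
    ring
  · refine Finset.sum_congr rfl fun t ht => ?_
    have ht' : t ⊆ s := Finset.mem_powerset.1 ht
    have het : e ∉ t := fun h => he (ht' h)
    rw [Finset.insert_sdiff_of_notMem _ het, Finset.prod_insert (by simp [he])]
    ring

theorem Ex_congr (hp : ∀ e ∈ s, p e = p' e) (h : ∀ t : Set E, t ⊆ s → f t = g t) :
    Ex p s f = Ex p' s g := by
  unfold Ex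
  refine Finset.sum_congr rfl fun t ht => ?_
  have ht' : t ⊆ s := Finset.mem_powerset.1 ht
  rw [h t (by exact_mod_cast ht'), Finset.prod_congr rfl fun e he => hp e (ht' he),
    Finset.prod_congr (s₁ := s \ t) rfl fun e he => by rw [hp e (Finset.mem_sdiff.1 he).1]]

theorem Ex_add (f g : Set E → ℝ) : Ex p s (fun t => f t + g t) = Ex p s f + Ex p s g := by
  simp [Ex, mul_add, Finset.sum_add_distrib]

theorem Ex_sub (f g : Set E → ℝ) : Ex p s (fun t => f t - g t) = Ex p s f - Ex p s g := by
  simp [Ex, mul_sub, Finset.sum_sub_distrib]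

theorem Ex_mul_left (c : ℝ) (f : Set E → ℝ) : Ex p s (fun t => c * f t) = c * Ex p s f := by
  simp only [Ex, Finset.mul_sum]
  exact Finset.sum_congr rfl fun t _ => by ring

theorem Ex_sum {ι : Type*} (I : Finset ι) (F : ι → Set E → ℝ) :
    Ex p s (fun t => ∑ i ∈ I, F i t) = ∑ i ∈ I, Ex p s (F i) := by
  simp only [Ex, Finset.mul_sum]
  exact Finset.sum_comm

theorem Ex_const (c : ℝ) : Ex p s (fun _ => c) = c := by
  induction s using Finset.induction_on with
  | empty => exact Ex_empty _
  | insert e s he ih => rw [Ex_insert he, ih]; ring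

theorem Ex_mono (hp : Unit01 p) (h : ∀ t : Set E, t ⊆ s → f t ≤ g t) : Ex p s f ≤ Ex p s g := by
  refine Finset.sum_le_sum fun t ht => ?_
  have ht' : t ⊆ s := Finset.mem_powerset.1 ht
  refine mul_le_mul_of_nonneg_left (h t (by exact_mod_cast ht')) (mul_nonneg ?_ ?_)
  · exact Finset.prod_nonneg fun e _ => (hp e).1
  · exact Finset.prod_nonneg fun e _ => sub_nonneg.2 (hp e).2

theorem Ex_nonneg (hp : Unit01 p) (h : ∀ t : Set E, t ⊆ s → 0 ≤ f t) : 0 ≤ Ex p s f := by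
  simpa [Ex_const] using Ex_mono (f := fun _ => 0) hp h

theorem Ex_union (h : Disjoint s₁ s₂) (f : Set E → ℝ) :
    Ex p (s₁ ∪ s₂) f = Ex p s₁ fun t₁ => Ex p s₂ fun t₂ => f (t₁ ∪ t₂) := by
  induction s₁ using Finset.induction_on generalizing f with
  | empty => simp [Ex_empty]
  | insert e s he ih =>
    rw [Finset.disjoint_insert_left] at h
    rw [Finset.insert_union, Ex_insert (by simp [he, h.1]), Ex_insert he, ih h.2, ih h.2]
    simp [Set.insert_union]

theorem Ex_mul_of_disjoint (h : Disjoint s₁ s₂) (hf : DepOn f s₁) (hg : DepOn g s₂) :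
    Ex p (s₁ ∪ s₂) (fun t => f t * g t) = Ex p s₁ f * Ex p s₂ g := by
  rw [Ex_union h, mul_comm, ← Ex_mul_left]
  have h' : Disjoint (s₁ : Set E) s₂ := by exact_mod_cast h
  refine Ex_congr (fun _ _ => rfl) fun t₁ ht₁ => ?_
  rw [mul_comm, ← Ex_mul_left]
  refine Ex_congr (fun _ _ => rfl) fun t₂ ht₂ => ?_
  congr 1
  · refine hf.inter_eq ?_
    rw [Set.union_inter_distrib_right, (h'.mono_right ht₂).symm.inter_eq, Set.union_empty]
  · refine hg.inter_eq ?_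
    rw [Set.union_inter_distrib_right, (h'.mono_left ht₁).inter_eq, Set.empty_union]

theorem Ex_of_subset (hs : s₁ ⊆ s) (hf : DepOn f s₁) : Ex p s f = Ex p s₁ f := by
  have := Ex_mul_of_disjoint (p := p) (f := f) (g := fun _ => 1) (s₁ := s₁) (s₂ := s \ s₁)
    Finset.disjoint_sdiff hf (fun _ => rfl)
  simpa [Ex_const, Finset.union_sdiff_of_subset hs] using this

theorem Pr_nonneg (hp : Unit01 p) (A : Set E → Prop) : 0 ≤ Pr p s A :=
  Ex_nonneg hp fun _ _ => ind_nonneg _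

theorem Pr_mono (hp : Unit01 p) {A B : Set E → Prop} (h : ∀ t : Set E, t ⊆ s → A t → B t) :
    Pr p s A ≤ Pr p s B :=
  Ex_mono hp fun t ht => ind_mono (h t ht)

theorem Pr_le_one (hp : Unit01 p) (A : Set E → Prop) : Pr p s A ≤ 1 :=
  (Ex_mono hp fun t _ => ind_le_one (A t)).trans_eq (Ex_const 1)

theorem Pr_not (A : Set E → Prop) : Pr p s (fun t => ¬A t) = 1 - Pr p s A := by
  simp only [Pr, ind_not, Ex_sub, Ex_const]

theorem Pr_and_of_disjoint (h : Disjoint s₁ s₂) {A B : Set E → Prop} (hA : DepOn A s₁)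
    (hB : DepOn B s₂) : Pr p (s₁ ∪ s₂) (fun t => A t ∧ B t) = Pr p s₁ A * Pr p s₂ B := by
  simp only [Pr, ind_and]
  exact Ex_mul_of_disjoint h hA.ind hB.ind

theorem Pr_of_subset (hs : s₁ ⊆ s) {A : Set E → Prop} (hA : DepOn A s₁) : Pr p s A = Pr p s₁ A :=
  Ex_of_subset hs hA.ind

theorem Pr_exists_le (hp : Unit01 p) {ι : Type*} (I : Finset ι) (A : ι → Set E → Prop) :
    Pr p s (fun t => ∃ i ∈ I, A i t) ≤ ∑ i ∈ I, Pr p s (A i) := by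
  unfold Pr
  rw [← Ex_sum]
  refine Ex_mono hp fun t _ => ?_
  by_cases h : ∃ i ∈ I, A i t
  · obtain ⟨i, hi, hA⟩ := h
    calc ind _ ≤ 1 := ind_le_one _
      _ = ind (A i t) := (ind_true hA).symm
      _ ≤ _ := Finset.single_le_sum (f := fun i => ind (A i t)) (fun _ _ => ind_nonneg _) hi
  · rw [ind_false h]
    exact Finset.sum_nonneg fun _ _ => ind_nonneg _

theorem Pr_or_le (hp : Unit01 p) (A B : Set E → Prop) :
    Pr p s (fun t => A t ∨ B t) ≤ Pr p s A + Pr p s B := by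
  unfold Pr
  rw [← Ex_add]
  refine Ex_mono hp fun t _ => ?_
  by_cases hA : A t <;> by_cases hB : B t <;> simp [ind, hA, hB]

/-- The Harris inequality. -/
theorem Ex_mul_ge (hp : Unit01 p) (hf : Monotone f) (hg : Monotone g) :
    Ex p s f * Ex p s g ≤ Ex p s fun t => f t * g t := by
  induction s using Finset.induction_on generalizing f g with
  | empty => simp [Ex_empty]
  | insert e s he ih =>
    rw [Ex_insert he, Ex_insert he, Ex_insert he]
    have hi : Monotone fun t : Set E => insert e t := fun a b h => Set.insert_subset_insert h
    have h1 := ih (hf.comp hi) (hg.comp hi)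
    have h0 := ih hf hg
    simp only [Function.comp_def] at h1
    have hf' : Ex p s f ≤ Ex p s fun t => f (insert e t) :=
      Ex_mono hp fun t _ => hf (Set.subset_insert _ _)
    have hg' : Ex p s g ≤ Ex p s fun t => g (insert e t) :=
      Ex_mono hp fun t _ => hg (Set.subset_insert _ _)
    obtain ⟨hp0, hp1⟩ := hp e
    have h3 := mul_nonneg (mul_nonneg hp0 (sub_nonneg.2 hp1))
      (mul_nonneg (sub_nonneg.2 hf') (sub_nonneg.2 hg'))
    have h4 := mul_le_mul_of_nonneg_left h1 hp0
    have h5 := mul_le_mul_of_nonneg_left h0 (sub_nonneg.2 hp1)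
    nlinarith

theorem Ex_mono_left (hp : Unit01 p) (hp' : Unit01 p') (h : ∀ e ∈ s, p e ≤ p' e)
    (hf : Monotone f) : Ex p s f ≤ Ex p' s f := by
  induction s using Finset.induction_on generalizing f with
  | empty => simp [Ex_empty]
  | insert e s he ih =>
    rw [Ex_insert he, Ex_insert he]
    have hi : Monotone fun t : Set E => insert e t := fun a b h => Set.insert_subset_insert h
    have h' : ∀ e ∈ s, p e ≤ p' e := fun e he => h e (Finset.mem_insert_of_mem he)
    have h1 := ih h' (hf.comp hi)
    have h0 := ih h' hf
    simp only [Function.comp_def] at h1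
    have hf' : Ex p s f ≤ Ex p s fun t => f (insert e t) :=
      Ex_mono hp fun t _ => hf (Set.subset_insert _ _)
    have he' := h e (Finset.mem_insert_self _ _)
    have h3 := mul_nonneg (sub_nonneg.2 he') (sub_nonneg.2 hf')
    have h4 := mul_le_mul_of_nonneg_left h1 (hp' e).1
    have h5 := mul_le_mul_of_nonneg_left h0 (sub_nonneg.2 (hp' e).2)
    nlinarith

theorem Ex_mono_set (hp : Unit01 p) (hs : s₁ ⊆ s) (hf : Monotone f) : Ex p s₁ f ≤ Ex p s f := by
  rw [← Finset.union_sdiff_of_subset hs, Ex_union Finset.disjoint_sdiff]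
  refine Ex_mono hp fun t _ => ?_
  calc f t = Ex p (s \ s₁) fun _ => f t := (Ex_const _).symm
    _ ≤ _ := Ex_mono hp fun t' _ => hf Set.subset_union_left

theorem Pr_and_ge (hp : Unit01 p) {A B : Set E → Prop} (hA : Monotone A) (hB : Monotone B) :
    Pr p s A * Pr p s B ≤ Pr p s fun t => A t ∧ B t := by
  simp only [Pr, ind_and]
  exact Ex_mul_ge hp (ind_monotone hA) (ind_monotone hB)

theorem Pr_not_and_ge (hp : Unit01 p) {A B : Set E → Prop} (hA : Monotone A) (hB : Monotone B) :
    Pr p s (fun t => ¬A t) * Pr p s (fun t => ¬B t) ≤ Pr p s fun t => ¬A t ∧ ¬B t := by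
  have h1 := Pr_and_ge (s := s) hp hA hB
  have h2 : Pr p s (fun t => ¬A t ∧ ¬B t)
      = 1 - Pr p s A - Pr p s B + Pr p s (fun t => A t ∧ B t) := by
    simp only [Pr, ind_and, ind_not]
    conv_rhs => rw [← Ex_const (p := p) (s := s) 1]
    rw [← Ex_sub, ← Ex_sub, ← Ex_add]
    exact Ex_congr (fun _ _ => rfl) fun t _ => by ring
  rw [Pr_not, Pr_not, h2]
  linarith

theorem Ex_map {F : Type*} [DecidableEq F] (ι : F ↪ E) (s : Finset F) (f : Set E → ℝ) :
    Ex p (s.map ι) f = Ex (fun e => p (ι e)) s fun t => f (ι '' t) := by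
  induction s using Finset.induction_on generalizing f with
  | empty => simp [Ex_empty]
  | insert e s he ih =>
    rw [Finset.map_insert, Ex_insert (by simpa using he), Ex_insert he, ih, ih]
    simp [Set.image_insert_eq]

theorem Ex_compl (f : Set E → ℝ) :
    Ex (fun e => 1 - p e) s f = Ex p s fun t => f (↑s \ t) := by
  induction s using Finset.induction_on generalizing f with
  | empty => simp [Ex_empty]
  | insert e s he ih =>
    rw [Ex_insert he, Ex_insert he, ih, ih, add_comm]
    have he' : e ∉ (s : Set E) := by simpa using he
    congr 1
    · rw [sub_sub_cancel]
      congr 1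
      refine Ex_congr (fun _ _ => rfl) fun t ht => ?_
      congr 1
      ext x
      simp only [Finset.coe_insert, Set.mem_sdiff, Set.mem_insert_iff, not_or]
      constructor
      · rintro ⟨h1, h2⟩
        exact ⟨Or.inr h1, fun h => he' (h ▸ h1), h2⟩
      · rintro ⟨h1, h2, h3⟩
        exact ⟨h1.resolve_left h2, h3⟩
    · congr 1
      refine Ex_congr (fun _ _ => rfl) fun t ht => ?_
      congr 1
      ext x
      simp only [Finset.coe_insert, Set.mem_sdiff, Set.mem_insert_iff]
      constructor
      · rintro (rfl | ⟨h1, h2⟩)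
        · exact ⟨Or.inl rfl, fun h => he' (ht h)⟩
        · exact ⟨Or.inr h1, h2⟩
      · rintro ⟨h1 | h1, h2⟩
        · exact Or.inl h1
        · exact Or.inr ⟨h1, h2⟩

/-- The probability that all edges of `a` are open. -/
theorem Pr_subset (a : Finset E) (ha : a ⊆ s) : Pr p s (fun t => ↑a ⊆ t) = ∏ e ∈ a, p e := by
  rw [Pr_of_subset ha fun t => by simp]
  clear ha
  induction a using Finset.induction_on with
  | empty => simp [Pr, Ex_empty, ind]
  | insert e a he ih =>
    rw [Pr, Ex_insert he, Finset.prod_insert he, ← ih, Pr]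
    have h0 : Ex p a (fun t => ind (↑(insert e a) ⊆ t)) = 0 := by
      rw [← Ex_const (p := p) (s := a) 0]
      refine Ex_congr (fun _ _ => rfl) fun t ht => ind_false fun h => he ?_
      have := ht (h (Finset.mem_coe.2 (Finset.mem_insert_self e a)))
      exact_mod_cast this
    rw [h0, mul_zero, add_zero]
    congr 1
    refine Ex_congr (fun _ _ => rfl) fun t ht => ?_
    congr 1
    rw [Finset.coe_insert, Set.insert_subset_insert_iff (by simpa using he)]

/-- The probability that all edges of `a` are closed. -/
theorem Pr_disjoint (a : Finset E) (ha : a ⊆ s) :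
    Pr p s (fun t => Disjoint (↑a) t) = ∏ e ∈ a, (1 - p e) := by
  rw [← Pr_subset (p := fun e => 1 - p e) a ha, Pr, Pr, Ex_compl]
  refine Ex_congr (fun _ _ => rfl) fun t ht => ?_
  congr 1
  rw [Set.subset_sdiff]
  simp [ha]

end Expectation

section Expectation

variable {E : Type*} [DecidableEq E]

/-- Russo's formula. -/
theorem hasDerivAt_Ex {p : ℝ → E → ℝ} {p' : E → ℝ} {x : ℝ}
    (h : ∀ e, HasDerivAt (fun y => p y e) (p' e) x) (s : Finset E) (f : Set E → ℝ) :
    HasDerivAt (fun y => Ex (p y) s f)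
      (∑ e ∈ s, p' e * Ex (p x) s fun t => f (insert e t) - f (t \ {e})) x := by
  induction s using Finset.induction_on generalizing f with
  | empty => simpa [Ex_empty] using hasDerivAt_const x (f ∅)
  | insert e s he ih =>
    simp only [Ex_insert he]
    have h1 := ((h e).mul (ih fun t => f (insert e t))).add (((h e).const_sub 1).mul (ih f))
    refine h1.congr_deriv ?_
    rw [Finset.sum_insert he]
    have h2 : Ex (p x) s (fun t => f (insert e (insert e t)) - f (insert e t \ {e}))
        = Ex (p x) s (fun t => f (insert e t)) - Ex (p x) s f := by
      rw [← Ex_sub]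
      refine Ex_congr (fun _ _ => rfl) fun t ht => ?_
      have : e ∉ t := fun h => he (by exact_mod_cast ht h)
      simp [this]
    have h3 : Ex (p x) s (fun t => f (insert e t) - f (t \ {e}))
        = Ex (p x) s (fun t => f (insert e t)) - Ex (p x) s f := by
      rw [← Ex_sub]
      refine Ex_congr (fun _ _ => rfl) fun t ht => ?_
      have : e ∉ t := fun h => he (by exact_mod_cast ht h)
      simp [this]
    have h4 : ∀ a ∈ s, Ex (p x) s (fun t => f (insert a (insert e t)) - f (insert e t \ {a}))
        = Ex (p x) s (fun t => f (insert e (insert a t)) - f (insert e (t \ {a}))) := by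
      intro a ha
      refine Ex_congr (fun _ _ => rfl) fun t ht => ?_
      rw [Set.insert_comm, Set.insert_sdiff_of_notMem]
      rintro rfl
      exact he ha
    have h5 : ∑ a ∈ s, p' a * (p x e * Ex (p x) s (fun t =>
          f (insert a (insert e t)) - f (insert e t \ {a}))
          + (1 - p x e) * Ex (p x) s fun t => f (insert a t) - f (t \ {a}))
        = p x e * (∑ a ∈ s, p' a * Ex (p x) s fun t =>
          f (insert e (insert a t)) - f (insert e (t \ {a})))
          + (1 - p x e) * ∑ a ∈ s, p' a * Ex (p x) s fun t => f (insert a t) - f (t \ {a}) := by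
      rw [Finset.mul_sum, Finset.mul_sum, ← Finset.sum_add_distrib]
      exact Finset.sum_congr rfl fun a ha => by rw [h4 a ha]; ring
    rw [h5, h2, h3]
    ring

end Expectation

/-- The finite-volume form of a Bernoulli product measure. -/
theorem IsBernoulliProduct.measure_eq {E : Type} [DecidableEq E] {p : E → ℝ}
    {P : Measure (Config E)} (hP : IsBernoulliProduct p P) (hp : Unit01 p) (s : Finset E)
    (A : Set E → Prop) :
    P {ω | A {e | e ∈ s ∧ ω e = true}} = ENNReal.ofReal (Pr p s A) := by
  classical
  let cyl : Finset E → Set (Config E) := fun t => {ω | ∀ e ∈ s, ω e = decide (e ∈ t)}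
  have hmeas : ∀ t, MeasurableSet (cyl t) := by
    intro t
    have : cyl t = ⋂ e ∈ s, (fun ω : Config E => ω e) ⁻¹' {decide (e ∈ t)} := by
      ext ω; simp [cyl]
    rw [this]
    exact s.measurableSet_biInter fun e _ => measurable_pi_apply e (measurableSet_singleton _)
  have hset : {ω : Config E | A {e | e ∈ s ∧ ω e = true}}
      = ⋃ t ∈ s.powerset.filter (fun t : Finset E => A ↑t), cyl t := by
    ext ω
    simp only [mem_ofPred_eq, mem_iUnion, Finset.mem_filter, Finset.mem_powerset, exists_prop, cyl]
    constructor
    · intro h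
      refine ⟨s.filter fun e => ω e = true, ⟨Finset.filter_subset _ _, ?_⟩, fun e he => ?_⟩
      · simpa using h
      · by_cases h' : ω e = true <;> simp [he, h']
    · rintro ⟨t, ⟨hts, ht⟩, h⟩
      have : {e | e ∈ s ∧ ω e = true} = (t : Set E) := by
        ext e
        simp only [mem_ofPred_eq, Finset.mem_coe]
        constructor
        · rintro ⟨h1, h2⟩
          rw [h e h1] at h2
          exact of_decide_eq_true h2
        · intro he
          exact ⟨hts he, by rw [h e (hts he)]; exact decide_eq_true he⟩
      rwa [this]
  have hdisj : Set.PairwiseDisjoint (s.powerset.filter (fun t : Finset E => A ↑t) : Finset (Finset E))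
      cyl := by
    intro t ht t' ht' hne
    refine Set.disjoint_left.2 fun ω h h' => hne ?_
    simp only [Finset.coe_filter, Finset.mem_powerset, mem_ofPred_eq] at ht ht'
    ext e
    constructor
    · intro he
      have h1 := h e (ht.1 he)
      have h2 := h' e (ht.1 he)
      exact of_decide_eq_true (by rw [← h2, h1]; exact decide_eq_true he)
    · intro he
      have h1 := h e (ht'.1 he)
      have h2 := h' e (ht'.1 he)
      exact of_decide_eq_true (by rw [← h1, h2]; exact decide_eq_true he)
  rw [hset, measure_biUnion_finset hdisj fun t _ => hmeas t, Pr, Ex, Finset.sum_filter,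
    ENNReal.ofReal_sum_of_nonneg]
  · refine Finset.sum_congr rfl fun t ht => ?_
    have hts := Finset.mem_powerset.1 ht
    by_cases h : A ↑t
    · rw [if_pos h, ind_true h, mul_one]
      have := hP.2 s fun e => decide (e ∈ t)
      simp only [cyl]
      rw [this, ← Finset.prod_sdiff hts, mul_comm, ENNReal.ofReal_mul
        (Finset.prod_nonneg fun e _ => (hp e).1), ENNReal.ofReal_prod_of_nonneg
        (fun e _ => (hp e).1), ENNReal.ofReal_prod_of_nonneg
        (fun e _ => sub_nonneg.2 (hp e).2)]
      congr 1
      · exact Finset.prod_congr rfl fun e he => by simp [he]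
      · exact Finset.prod_congr rfl fun e he => by simp [(Finset.mem_sdiff.1 he).2]
    · rw [if_neg h, ind_false h, mul_zero, ENNReal.ofReal_zero]
  · intro t _
    exact mul_nonneg (mul_nonneg (Finset.prod_nonneg fun e _ => (hp e).1)
      (Finset.prod_nonneg fun e _ => sub_nonneg.2 (hp e).2)) (ind_nonneg _)

section Indep

variable {E : Type*} [DecidableEq E] {p : E → ℝ} {s₁ s₂ : Finset E} {f g : Set E → ℝ}

theorem Ex_mul_of_compl (h : Disjoint s₁ s₂) (hf : DepOn f (s₂ : Set E)ᶜ)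
    (hg : DepOn g (s₁ : Set E)ᶜ) :
    Ex p (s₁ ∪ s₂) (fun t => f t * g t) = Ex p s₁ f * Ex p s₂ g := by
  have hd : Disjoint (s₁ : Set E) s₂ := by exact_mod_cast h
  rw [Ex_congr (g := fun t => f (t ∩ s₁) * g (t ∩ s₂)) (fun _ _ => rfl) fun t ht => ?_,
    Ex_mul_of_disjoint h (f := fun t => f (t ∩ s₁)) (g := fun t => g (t ∩ s₂))
    (fun t => by simp [inter_assoc]) (fun t => by simp [inter_assoc])]
  · congr 1
    · exact Ex_congr (fun _ _ => rfl) fun t ht => by rw [inter_eq_left.2 ht]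
    · exact Ex_congr (fun _ _ => rfl) fun t ht => by rw [inter_eq_left.2 ht]
  · rw [Finset.coe_union] at ht
    congr 1
    · refine hf.inter_eq ?_
      ext e
      have h1 : e ∈ t → e ∈ (s₁ : Set E) ∪ s₂ := fun h => ht h
      have h2 : e ∈ (s₁ : Set E) → e ∉ (s₂ : Set E) := fun h h' => Set.disjoint_left.1 hd h h'
      simp only [mem_inter_iff, mem_compl_iff, mem_union] at *
      tauto
    · refine hg.inter_eq ?_
      ext e
      have h1 : e ∈ t → e ∈ (s₁ : Set E) ∪ s₂ := fun h => ht h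
      have h2 : e ∈ (s₁ : Set E) → e ∉ (s₂ : Set E) := fun h h' => Set.disjoint_left.1 hd h h'
      simp only [mem_inter_iff, mem_compl_iff, mem_union] at *
      tauto

end Indep

section Graph

variable {V E : Type*}

/-- Adjacency via the open edges `t`, for the graph with edge endpoints `G`. -/
def Adj (G : E → V × V) (t : Set E) (u v : V) : Prop :=
  ∃ e, e ∈ t ∧ (G e = (u, v) ∨ G e = (v, u))

/-- Connection via the open edges `t`. -/
def Conn (G : E → V × V) (t : Set E) : V → V → Prop := Relation.ReflTransGen (Adj G t)

/-- The edges with both endpoints in `S`. -/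
def ins (G : E → V × V) (S : Set V) : Set E := {e | (G e).1 ∈ S ∧ (G e).2 ∈ S}

/-- The vertex `x` is connected to the outside of `S`. -/
def Exits (G : E → V × V) (S : Set V) (x : V) (t : Set E) : Prop := ∃ y, y ∉ S ∧ Conn G t x y

variable {G : E → V × V} {t t' : Set E} {u v w : V} {S S' : Set V}

theorem Adj.symm (h : Adj G t u v) : Adj G t v u := by
  obtain ⟨e, he, h | h⟩ := h
  exacts [⟨e, he, Or.inr h⟩, ⟨e, he, Or.inl h⟩]

theorem Adj.mono (ht : t ⊆ t') (h : Adj G t u v) : Adj G t' u v := by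
  obtain ⟨e, he, h⟩ := h
  exact ⟨e, ht he, h⟩

theorem Adj.conn (h : Adj G t u v) : Conn G t u v := Relation.ReflTransGen.single h

theorem Conn.refl (u : V) : Conn G t u u := Relation.ReflTransGen.refl

theorem Conn.trans (h : Conn G t u v) (h' : Conn G t v w) : Conn G t u w :=
  Relation.ReflTransGen.trans h h'

theorem Conn.symm (h : Conn G t u v) : Conn G t v u := by
  induction h with
  | refl => exact Conn.refl _
  | tail _ h ih => exact (h.symm.conn).trans ih

theorem Conn.mono (ht : t ⊆ t') (h : Conn G t u v) : Conn G t' u v :=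
  Relation.ReflTransGen.mono (fun _ _ h => Adj.mono ht h) _ _ h

theorem adj_of_mem {e : E} (he : e ∈ t) : Adj G t (G e).1 (G e).2 := ⟨e, he, Or.inl rfl⟩

theorem Exits.mono {x : V} (ht : t ⊆ t') (h : Exits G S x t) : Exits G S x t' := by
  obtain ⟨y, hy, h⟩ := h
  exact ⟨y, hy, h.mono ht⟩

theorem exits_monotone (S : Set V) (x : V) : Monotone (Exits G S x) := fun _ _ h h' => h'.mono h

theorem ins_mono (h : S ⊆ S') : ins G S ⊆ ins G S' := fun _ he => ⟨h he.1, h he.2⟩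

theorem Adj.inter_ins (h : Adj G t u v) (hu : u ∈ S) (hv : v ∈ S) : Adj G (t ∩ ins G S) u v := by
  obtain ⟨e, he, h⟩ := h
  refine ⟨e, ⟨he, ?_⟩, h⟩
  rcases h with h | h <;> simp [ins, h, hu, hv]

theorem Adj.mem_of_ins (h : Adj G (t ∩ ins G S) u v) : u ∈ S ∧ v ∈ S := by
  obtain ⟨e, ⟨_, he⟩, h | h⟩ := h <;> simp only [ins, mem_ofPred_eq, h] at he
  exacts [he, he.symm]

theorem Conn.mem_of_ins (h : Conn G (t ∩ ins G S) u v) (hu : u ∈ S) : v ∈ S := by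
  induction h with
  | refl => exact hu
  | tail _ h _ => exact h.mem_of_ins.2

/-- A path from `u ∈ S` either stays in `S` or has a first exit from `S`. -/
theorem Conn.stays_or_leaves (h : Conn G t u v) (hu : u ∈ S) :
    Conn G (t ∩ ins G S) u v ∨
      ∃ a b, Conn G (t ∩ ins G S) u a ∧ b ∉ S ∧ Adj G t a b := by
  induction h with
  | refl => exact Or.inl (Conn.refl _)
  | @tail b c _ hbc ih =>
    rcases ih with ih | ih
    · by_cases hc : c ∈ S
      · exact Or.inl (ih.trans (hbc.inter_ins (ih.mem_of_ins hu) hc).conn)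
      · exact Or.inr ⟨b, c, ih, hc, hbc⟩
    · exact Or.inr ih

/-- If no open edge leaves `S`, then the connections from `S` stay in `S`. -/
theorem Conn.inter_of_closed (h : Conn G t u v) (hu : u ∈ S)
    (hS : ∀ a b, a ∈ S → Adj G t a b → b ∈ S) : Conn G (t ∩ ins G S) u v := by
  rcases h.stays_or_leaves hu with h | ⟨a, b, h1, h2, h3⟩
  · exact h
  · exact absurd (hS a b (h1.mem_of_ins hu) h3) h2

/-- A locally finite graph structure: `inc v` lists the edges incident to `v`. -/
def IsInc (G : E → V × V) (inc : V → Finset E) : Prop :=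
  ∀ v e, e ∈ inc v ↔ (G e).1 = v ∨ (G e).2 = v

variable [DecidableEq V] [DecidableEq E]

open Classical in
/-- The finite set of edges inside `S`. -/
noncomputable def insF (G : E → V × V) (inc : V → Finset E) (S : Finset V) : Finset E :=
  (S.biUnion inc).filter fun e => e ∈ ins G S

open Classical in
/-- The boundary edges of `S` whose inner endpoint is connected to `x` inside `S`. -/
noncomputable def exitEdges (G : E → V × V) (inc : V → Finset E) (S : Finset V) (x : V)
    (t : Set E) : Finset E :=
  (S.biUnion inc).filter fun e => ∃ y z, y ∈ S ∧ z ∉ S ∧ (G e = (y, z) ∨ G e = (z, y)) ∧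
    Conn G (t ∩ ins G S) x y

/-- The expected number of exit edges. -/
noncomputable def Phi (G : E → V × V) (inc : V → Finset E) (p : E → ℝ) (S : Finset V) (x : V) :
    ℝ :=
  Ex p (insF G inc S) fun t => ((exitEdges G inc S x t).card : ℝ)

open Classical in
/-- The vertices of `L` not connected to the outside of `L`. -/
noncomputable def trapped (G : E → V × V) (L : Finset V) (t : Set E) : Finset V :=
  L.filter fun y => ¬Exits G L y t

variable {inc : V → Finset E} {p : E → ℝ}

theorem coe_insF (hinc : IsInc G inc) (S : Finset V) : (insF G inc S : Set E) = ins G S := by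
  ext e
  simp only [insF, Finset.coe_filter, Finset.mem_biUnion, mem_ofPred_eq, and_iff_right_iff_imp]
  intro he
  exact ⟨_, he.1, (hinc _ _).2 (Or.inl rfl)⟩

theorem exitEdges_dep (S : Finset V) (x : V) : DepOn (exitEdges G inc S x) (ins G S) := by
  intro t
  unfold exitEdges
  rw [inter_assoc, inter_self]

theorem exitEdges_mono (S : Finset V) (x : V) : Monotone (exitEdges G inc S x) := by
  intro t t' h e he
  simp only [exitEdges, Finset.mem_filter] at he ⊢
  obtain ⟨h1, y, z, hy, hz, hyz, hc⟩ := he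
  exact ⟨h1, y, z, hy, hz, hyz, hc.mono (inter_subset_inter_left _ h)⟩

theorem mem_trapped {L : Finset V} {y : V} : y ∈ trapped G L t ↔ y ∈ L ∧ ¬Exits G L y t := by
  simp [trapped]

theorem trapped_subset {L : Finset V} : trapped G L t ⊆ L := fun _ h => (mem_trapped.1 h).1

theorem exitEdges_subset {S : Finset V} {x : V} : exitEdges G inc S x t ⊆ S.biUnion inc := by
  classical
  exact Finset.filter_subset _ _

theorem trapped_anti {L : Finset V} (h : t ⊆ t') : trapped G L t' ⊆ trapped G L t := by
  intro y hy
  rw [mem_trapped] at hy ⊢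
  exact ⟨hy.1, fun h' => hy.2 (h'.mono h)⟩

theorem trapped_closed {L : Finset V} {a b : V} (ha : a ∈ trapped G L t) (hab : Adj G t a b) :
    b ∈ trapped G L t := by
  rw [mem_trapped] at *
  refine ⟨?_, ?_⟩
  · by_contra hb
    exact ha.2 ⟨b, hb, hab.conn⟩
  · rintro ⟨y, hy, h⟩
    exact ha.2 ⟨y, hy, hab.conn.trans h⟩

theorem trapped_eq_dep {L S : Finset V} : DepOn (fun t => trapped G L t = S) (ins G S)ᶜ := by
  intro t
  refine propext ⟨fun h => ?_, fun h => ?_⟩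
  · refine Finset.Subset.antisymm (h ▸ trapped_anti inter_subset_left) fun y hy => ?_
    have hyL : S ⊆ L := by rw [← h]; exact trapped_subset
    refine mem_trapped.2 ⟨hyL hy, ?_⟩
    rintro ⟨z, hz, hc⟩
    have := hc.inter_of_closed (S := (S : Set V)) hy fun a b ha hab => by
      by_contra hb
      obtain ⟨e, he, hG⟩ := hab
      have hab' : Adj G (t ∩ (ins G S)ᶜ) a b := by
        refine ⟨e, ⟨he, fun hi => hb ?_⟩, hG⟩
        rcases hG with hG | hG <;> simp only [ins, mem_ofPred_eq, hG] at hi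
        exacts [hi.2, hi.1]
      have ha' : a ∈ trapped G L (t ∩ (ins G S)ᶜ) := by rw [h]; exact ha
      have := trapped_closed ha' hab'
      rw [h] at this
      exact hb this
    exact hz (hyL (this.mem_of_ins hy))
  · refine Finset.Subset.antisymm (fun y hy => ?_) (h ▸ trapped_anti inter_subset_left)
    by_contra hyS
    rw [mem_trapped] at hy
    have h1 : Exits G L y t := by
      by_contra h1
      exact hyS (h ▸ mem_trapped.2 ⟨hy.1, h1⟩)
    obtain ⟨z, hz, hc⟩ := h1
    refine hy.2 ⟨z, hz, ?_⟩
    have := hc.inter_of_closed (S := {v | v ∉ S}) hyS fun a b ha hab hb => by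
      refine ha ?_
      have : b ∈ trapped G L t := by rw [h]; exact hb
      rw [← h]
      exact trapped_closed this hab.symm
    refine this.mono (inter_subset_inter_right _ fun e he hi => he.1 hi.1)

/-- Sprinkled intensities. -/
def sprinkle (p : E → ℝ) (y : ℝ) : E → ℝ := fun e => 1 - (1 - p e) * (1 - y)

theorem sprinkle_unit {p : E → ℝ} (hp : Unit01 p) {y : ℝ} (h0 : 0 ≤ y) (h1 : y ≤ 1) :
    Unit01 (sprinkle p y) := fun e => by
  have := hp e
  unfold sprinkle
  constructor <;> nlinarith

theorem le_sprinkle (hp : Unit01 p) {y : ℝ} (h0 : 0 ≤ y) (e : E) :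
    p e ≤ sprinkle p y e := by
  have := hp e
  unfold sprinkle
  nlinarith

theorem pivotal_count {L : Finset V} {x : V} (t : Set E) :
    ∑ S ∈ L.powerset.filter (x ∈ ·), ind (trapped G L t = S) * ((exitEdges G inc S x t).card : ℝ)
      ≤ ∑ e ∈ L.biUnion inc, ind (e ∉ t) *
        (ind (Exits G L x (insert e t)) - ind (Exits G L x (t \ {e}))) := by
  have hnn : ∀ e, 0 ≤ ind (e ∉ t) *
        (ind (Exits G L x (insert e t)) - ind (Exits G L x (t \ {e}))) := fun e =>
    mul_nonneg (ind_nonneg _) (sub_nonneg.2 (ind_mono fun h => h.mono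
      (sdiff_subset.trans (subset_insert _ _))))
  by_cases hS : x ∈ trapped G L t
  · set S := trapped G L t with hSdef
    have hSL : S ⊆ L := trapped_subset
    rw [Finset.sum_eq_single S]
    · rw [ind_true rfl, one_mul]
      have hsub : exitEdges G inc S x t ⊆ L.biUnion inc :=
        exitEdges_subset.trans (Finset.biUnion_subset_biUnion_of_subset_left _ hSL)
      rw [Finset.card_eq_sum_ones, Nat.cast_sum]
      refine le_trans (Finset.sum_le_sum fun e he => ?_)
        (Finset.sum_le_sum_of_subset_of_nonneg hsub fun e _ _ => hnn e)
      simp only [exitEdges, Finset.mem_filter] at he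
      obtain ⟨-, y, z, hy, hz, hyz, hc⟩ := he
      have het : e ∉ t := fun het => hz (trapped_closed hy ⟨e, het, hyz⟩)
      have hex : Exits G L x (insert e t) := by
        by_cases hzL : z ∈ L
        · have : Exits G L z t := by
            by_contra h
            exact hz (mem_trapped.2 ⟨hzL, h⟩)
          obtain ⟨w, hw, hzw⟩ := this
          refine ⟨w, hw, (hc.mono (inter_subset_left.trans (subset_insert _ _))).trans ?_⟩
          exact (Adj.conn ⟨e, mem_insert _ _, hyz⟩).trans (hzw.mono (subset_insert _ _))
        · refine ⟨z, hzL, (hc.mono (inter_subset_left.trans (subset_insert _ _))).trans ?_⟩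
          exact Adj.conn ⟨e, mem_insert _ _, hyz⟩
      rw [ind_true het, ind_true hex, ind_false fun h => (mem_trapped.1 hS).2 (h.mono sdiff_subset)]
      norm_num
    · intro S' _ hne
      rw [ind_false hne.symm, zero_mul]
    · intro h
      exact absurd (Finset.mem_filter.2 ⟨Finset.mem_powerset.2 hSL, hS⟩) h
  · rw [Finset.sum_eq_zero]
    · exact Finset.sum_nonneg fun e _ => hnn e
    · intro S hS'
      rw [ind_false, zero_mul]
      rintro rfl
      exact hS (Finset.mem_filter.1 hS').2

end Graph

section Graph

variable {V E : Type*} [DecidableEq V] [DecidableEq E]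
variable {G : E → V × V} {t t' : Set E} {u v w : V}
variable {inc : V → Finset E} {p p' : E → ℝ}

theorem insF_subset_of_subset {S L : Finset V} (h : S ⊆ L) : insF G inc S ⊆ L.biUnion inc := by
  classical
  exact (Finset.filter_subset _ _).trans (Finset.biUnion_subset_biUnion_of_subset_left _ h)

theorem Phi_mono (hp : Unit01 p) (hp' : Unit01 p') (h : ∀ e, p e ≤ p' e) (S : Finset V) (x : V) :
    Phi G inc p S x ≤ Phi G inc p' S x :=
  Ex_mono_left hp hp' (fun e _ => h e) fun t t' htt => by
    exact_mod_cast Finset.card_le_card (exitEdges_mono S x htt)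

theorem Ex_trapped_mul {L S : Finset V} (hinc : IsInc G inc) (hS : S ⊆ L) (x : V) :
    Ex p (L.biUnion inc) (fun t => ind (trapped G L t = S) * ((exitEdges G inc S x t).card : ℝ))
      = Pr p (L.biUnion inc) (fun t => trapped G L t = S) * Phi G inc p S x := by
  have hsub := insF_subset_of_subset (G := G) (inc := inc) hS
  have hcoe := coe_insF hinc S
  have hd : DepOn (fun t => ind (trapped G L t = S)) (insF G inc S : Set E)ᶜ := by
    rw [hcoe]; exact trapped_eq_dep.ind
  have hd' : DepOn (fun t => ((exitEdges G inc S x t).card : ℝ))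
      ((L.biUnion inc \ insF G inc S : Finset E) : Set E)ᶜ := by
    refine DepOn.mono (s := ins G S) (fun t => by rw [exitEdges_dep S x t]) ?_
    rw [← hcoe]
    intro e he
    simp only [Finset.coe_sdiff, mem_compl_iff, mem_sdiff, not_and, not_not]
    exact fun _ => he
  have h1 := Ex_mul_of_compl (p := p) (Finset.sdiff_disjoint) hd hd'
  have h2 := Ex_mul_of_compl (p := p) (s₁ := L.biUnion inc \ insF G inc S) (g := fun _ => 1)
    Finset.sdiff_disjoint hd (fun _ => rfl)
  rw [Finset.sdiff_union_of_subset hsub] at h1 h2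
  rw [h1, Phi, Pr]
  simp only [mul_one, Ex_const] at h2
  rw [h2]

theorem deriv_exit_ge {L : Finset V} {x : V} (hinc : IsInc G inc) (hp : Unit01 p)
    {y : ℝ} (hy0 : 0 ≤ y) (hy1 : y ≤ 1) {c : ℝ} (hc : ∀ S ⊆ L, x ∈ S → c ≤ Phi G inc p S x) 
    (hx : x ∈ L) :
    c * (1 - Pr (sprinkle p y) (L.biUnion inc) (Exits G L x)) ≤
      ∑ e ∈ L.biUnion inc, (1 - p e) * Ex (sprinkle p y) (L.biUnion inc) fun t =>
        ind (Exits G L x (insert e t)) - ind (Exits G L x (t \ {e})) := by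
  set T := L.biUnion inc with hT
  set r := sprinkle p y with hr
  have hru : Unit01 r := sprinkle_unit hp hy0 hy1
  have hpr : ∀ e, p e ≤ r e := le_sprinkle hp hy0
  have hfac : ∀ e ∈ T, Ex r T (fun t => ind (e ∉ t) *
      (ind (Exits G L x (insert e t)) - ind (Exits G L x (t \ {e})))) ≤
      (1 - p e) * Ex r T fun t =>
        ind (Exits G L x (insert e t)) - ind (Exits G L x (t \ {e})) := by
    intro e he
    have h1 := Ex_mul_of_compl (p := r) (s₁ := {e}) (s₂ := T \ {e})
      (f := fun t => ind (e ∉ t)) (g := fun t => ind (Exits G L x (insert e t)) -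
        ind (Exits G L x (t \ {e}))) Finset.disjoint_sdiff (fun t => by simp) (fun t => by
          have h1 : insert e (t ∩ ((({e} : Finset E) : Set E))ᶜ) = insert e t := by
            ext a; by_cases h : a = e <;> simp [h]
          have h2 : (t ∩ ((({e} : Finset E) : Set E))ᶜ) \ {e} = t \ {e} := by
            ext a; by_cases h : a = e <;> simp [h]
          simp only [h1, h2])
    have h2 := Ex_mul_of_compl (p := r) (s₁ := {e}) (s₂ := T \ {e})
      (f := fun _ => 1) (g := fun t => ind (Exits G L x (insert e t)) -
        ind (Exits G L x (t \ {e}))) Finset.disjoint_sdiff (fun t => rfl) (fun t => by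
          have h1 : insert e (t ∩ ((({e} : Finset E) : Set E))ᶜ) = insert e t := by
            ext a; by_cases h : a = e <;> simp [h]
          have h2 : (t ∩ ((({e} : Finset E) : Set E))ᶜ) \ {e} = t \ {e} := by
            ext a; by_cases h : a = e <;> simp [h]
          simp only [h1, h2])
    have h3 : Ex r {e} (fun t => ind (e ∉ t)) = 1 - r e := by
      have := Pr_disjoint (p := r) (s := {e}) {e} subset_rfl
      simpa [Pr] using this
    rw [Finset.union_sdiff_of_subset (by simpa using he)] at h1 h2
    simp only [one_mul, Ex_const] at h2
    rw [h1, h3, ← h2]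
    refine mul_le_mul_of_nonneg_right (by linarith [hpr e]) (Ex_nonneg hru fun t _ => ?_)
    exact sub_nonneg.2 (ind_mono fun h => h.mono (sdiff_subset.trans (subset_insert _ _)))
  refine le_trans ?_ (Finset.sum_le_sum hfac)
  rw [← Ex_sum]
  refine le_trans ?_ (Ex_mono hru fun t _ => pivotal_count (G := G) (inc := inc) (x := x) t)
  rw [Ex_sum]
  have h4 : ∀ S ∈ L.powerset.filter (x ∈ ·),
      c * Pr r T (fun t => trapped G L t = S) ≤ Ex r T (fun t => ind (trapped G L t = S) *
        ((exitEdges G inc S x t).card : ℝ)) := by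
    intro S hS
    simp only [Finset.mem_filter, Finset.mem_powerset] at hS
    rw [Ex_trapped_mul hinc hS.1, mul_comm]
    exact mul_le_mul_of_nonneg_left ((hc S hS.1 hS.2).trans (Phi_mono hp hru hpr S x))
      (Pr_nonneg hru _)
  refine le_trans ?_ (Finset.sum_le_sum h4)
  rw [← Finset.mul_sum, ← Pr_not]
  refine le_of_eq (congrArg _ ?_)
  unfold Pr
  rw [← Ex_sum]
  refine Ex_congr (fun _ _ => rfl) fun t _ => ?_
  by_cases h : Exits G L x t
  · rw [ind_false (not_not.2 h), Finset.sum_eq_zero]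
    intro S hS
    refine ind_false ?_
    rintro rfl
    exact (mem_trapped.1 (Finset.mem_filter.1 hS).2).2 h
  · rw [ind_true h, Finset.sum_eq_single (trapped G L t)]
    · rw [ind_true rfl]
    · intro S _ hne
      exact ind_false hne.symm
    · intro h'
      refine absurd (Finset.mem_filter.2 ⟨Finset.mem_powerset.2 trapped_subset, ?_⟩) h'
      exact mem_trapped.2 ⟨hx, h⟩

/-- If the sprinkled exit probability is not large, some set has few expected exits. -/
theorem exists_Phi_lt {L : Finset V} {x : V} (hinc : IsInc G inc) (hp : Unit01 p) (hx : x ∈ L)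
    {y₀ : ℝ} (h0 : 0 < y₀) (h1 : y₀ < 1)
    (h : Pr (sprinkle p y₀) (L.biUnion inc) (Exits G L x) < 1 - Real.exp (-(y₀ / 4))) :
    ∃ S ⊆ L, x ∈ S ∧ Phi G inc p S x < 1 / 4 := by
  by_contra! hcon
  set T := L.biUnion inc
  let f : ℝ → ℝ := fun y => Pr (sprinkle p y) T (Exits G L x)
  have hder : ∀ y, HasDerivAt f (∑ e ∈ T, (1 - p e) * Ex (sprinkle p y) T fun t =>
      ind (Exits G L x (insert e t)) - ind (Exits G L x (t \ {e}))) y := fun y =>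
    hasDerivAt_Ex (p := sprinkle p) (p' := fun e => 1 - p e) (fun e => by
      have := (((hasDerivAt_id y).const_sub 1).const_mul (1 - p e)).const_sub 1
      refine this.congr_deriv ?_
      ring) T _
  let g : ℝ → ℝ := fun y => (1 - f y) * Real.exp (y / 4)
  have hg : ∀ y, HasDerivAt g (-(∑ e ∈ T, (1 - p e) * Ex (sprinkle p y) T fun t =>
      ind (Exits G L x (insert e t)) - ind (Exits G L x (t \ {e}))) * Real.exp (y / 4)
      + (1 - f y) * (Real.exp (y / 4) * (1 / 4))) y := fun y =>
    ((hder y).const_sub 1).mul (((hasDerivAt_id y).div_const 4).exp)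
  have hanti : AntitoneOn g (Icc 0 y₀) := by
    refine antitoneOn_of_deriv_nonpos (convex_Icc _ _)
      (fun y _ => (hg y).continuousAt.continuousWithinAt)
      (fun y _ => (hg y).differentiableAt.differentiableWithinAt) fun y hy => ?_
    rw [interior_Icc] at hy
    rw [(hg y).deriv]
    have := deriv_exit_ge (y := y) hinc hp hy.1.le (hy.2.trans h1).le hcon hx
    have h3 := mul_le_mul_of_nonneg_right this (Real.exp_pos (y / 4)).le
    simp only [f]
    linarith
  have h2 := hanti (left_mem_Icc.2 h0.le) (right_mem_Icc.2 h0.le) h0.le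
  have hf0 : 0 ≤ f 0 := Pr_nonneg (sprinkle_unit hp le_rfl zero_le_one) _
  simp only [g, zero_div, Real.exp_zero, mul_one] at h2
  have h3 : 1 - f y₀ > Real.exp (-(y₀ / 4)) := by
    simp only [f]; linarith
  have h4 := mul_lt_mul_of_pos_right h3 (Real.exp_pos (y₀ / 4))
  rw [← Real.exp_add, neg_add_cancel, Real.exp_zero] at h4
  linarith

end Graph

section Volume

variable {V E : Type*} [DecidableEq V] [DecidableEq E]
variable {G : E → V × V} {t t' : Set E} {u v w : V}
variable {inc : V → Finset E} {p p' : E → ℝ}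

open Classical in
/-- The vertices of `D` connected inside `D` to `X`. -/
noncomputable def clF (G : E → V × V) (D X : Finset V) (t : Set E) : Finset V :=
  D.filter fun y => ∃ x ∈ X, x ∈ D ∧ Conn G (t ∩ ins G D) x y

open Classical in
/-- The vertices of `D` outside `S` that are adjacent to `A`. -/
noncomputable def farEnds (G : E → V × V) (D S A : Finset V) (t : Set E) : Finset V :=
  D.filter fun z => z ∉ S ∧ ∃ a ∈ A, Adj G t a z

theorem mem_clF {D X : Finset V} {y : V} :
    y ∈ clF G D X t ↔ y ∈ D ∧ ∃ x ∈ X, x ∈ D ∧ Conn G (t ∩ ins G D) x y := by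
  simp [clF]

theorem mem_farEnds {D S A : Finset V} {z : V} :
    z ∈ farEnds G D S A t ↔ z ∈ D ∧ z ∉ S ∧ ∃ a ∈ A, Adj G t a z := by
  simp [farEnds]

theorem clF_mono {D X : Finset V} (h : t ⊆ t') : clF G D X t ⊆ clF G D X t' := by
  intro y hy
  rw [mem_clF] at *
  obtain ⟨h1, x, hx, hxD, hc⟩ := hy
  exact ⟨h1, x, hx, hxD, hc.mono (inter_subset_inter_left _ h)⟩

theorem clF_dep (D X : Finset V) : DepOn (clF G D X) (ins G D) := by
  intro t
  unfold clF
  rw [inter_assoc, inter_self]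

theorem clF_closed {D X : Finset V} {a b : V} (ha : a ∈ clF G D X t)
    (h : Adj G (t ∩ ins G D) a b) : b ∈ clF G D X t := by
  rw [mem_clF] at *
  obtain ⟨h1, x, hx, hxD, hc⟩ := ha
  exact ⟨h.mem_of_ins.2, x, hx, hxD, hc.trans h.conn⟩

theorem clF_subset_of_closed {D X A : Finset V} (hX : ∀ x ∈ X, x ∈ D → x ∈ A)
    (h : ∀ a b, a ∈ A → Adj G (t ∩ ins G D) a b → b ∈ A) : clF G D X t ⊆ A := by
  intro y hy
  rw [mem_clF] at hy
  obtain ⟨-, x, hx, hxD, hc⟩ := hy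
  exact (hc.inter_of_closed (S := (A : Set V)) (hX x hx hxD) h).mem_of_ins (hX x hx hxD)

/-- Edges incident to a vertex outside of `S` are not inside `S`. -/
theorem Adj.inter_compl_ins {S : Set V} {a b : V} (h : Adj G t a b) (ha : a ∉ S) :
    Adj G (t ∩ (ins G S)ᶜ) a b := by
  obtain ⟨e, he, hG⟩ := h
  refine ⟨e, ⟨he, fun hi => ha ?_⟩, hG⟩
  rcases hG with hG | hG <;> simp only [ins, mem_ofPred_eq, hG] at hi
  exacts [hi.1, hi.2]

theorem explored_dep {D S A Z : Finset V} {x : V} (hx : x ∈ A) :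
    DepOn (fun t => (clF G (S ∩ D) {x} t, farEnds G D S (clF G (S ∩ D) {x} t) t) = (A, Z))
      (ins G ((D \ A : Finset V) : Set V))ᶜ := by
  intro t
  set t' := t ∩ (ins G ((D \ A : Finset V) : Set V))ᶜ
  have ht' : t' ⊆ t := inter_subset_left
  have hadj : ∀ a b, a ∈ A → Adj G t a b → Adj G t' a b := fun a b ha h =>
    h.inter_compl_ins (by simp [ha])
  have hadj' : ∀ a b, a ∈ A → Adj G (t ∩ ins G ((S ∩ D : Finset V) : Set V)) a b →
      Adj G (t' ∩ ins G ((S ∩ D : Finset V) : Set V)) a b := fun a b ha h =>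
    (hadj a b ha (h.mono inter_subset_left)).inter_ins h.mem_of_ins.1 h.mem_of_ins.2
  have hcl : clF G (S ∩ D) {x} t' = A ↔ clF G (S ∩ D) {x} t = A := by
    constructor
    · intro h
      refine Finset.Subset.antisymm (clF_subset_of_closed (by simpa using fun _ _ => hx) ?_)
        (h ▸ clF_mono ht')
      intro a b ha hab
      have ha' : a ∈ clF G (S ∩ D) {x} t' := by rwa [h]
      have := clF_closed ha' (hadj' a b ha hab)
      rwa [h] at this
    · intro h
      refine Finset.Subset.antisymm (h ▸ clF_mono ht') ?_
      have hsub : clF G (S ∩ D) {x} t ⊆ clF G (S ∩ D) {x} t' ∩ A := by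
        refine clF_subset_of_closed ?_ ?_
        · intro y hy hyD
          rw [Finset.mem_singleton] at hy
          subst hy
          exact Finset.mem_inter.2 ⟨mem_clF.2 ⟨hyD, y, by simp, hyD, Conn.refl _⟩, hx⟩
        · intro a b ha hab
          rw [Finset.mem_inter] at ha ⊢
          refine ⟨clF_closed ha.1 (hadj' a b ha.2 hab), ?_⟩
          have ha' : a ∈ clF G (S ∩ D) {x} t := by rw [h]; exact ha.2
          rw [← h]
          exact clF_closed ha' hab
      rw [h] at hsub
      exact fun a ha => (Finset.mem_inter.1 (hsub ha)).1
  have hfar : farEnds G D S A t' = farEnds G D S A t := by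
    ext z
    rw [mem_farEnds, mem_farEnds]
    constructor
    · rintro ⟨h1, h2, a, ha, hab⟩
      exact ⟨h1, h2, a, ha, hab.mono ht'⟩
    · rintro ⟨h1, h2, a, ha, hab⟩
      exact ⟨h1, h2, a, ha, hadj a z ha hab⟩
  simp only [Prod.mk.injEq]
  refine propext ⟨fun ⟨h1, h2⟩ => ?_, fun ⟨h1, h2⟩ => ?_⟩
  · have h3 := hcl.1 h1
    rw [h1, hfar] at h2
    exact ⟨h3, by rw [h3, h2]⟩
  · have h3 := hcl.2 h1
    rw [h1] at h2
    exact ⟨h3, by rw [h3, hfar, h2]⟩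

theorem clF_subset_union {D S X : Finset V} {x : V} (hx : x ∈ D) (hxS : x ∈ S) (t : Set E) :
    clF G D X t ⊆ clF G (S ∩ D) {x} t ∪ clF G (D \ clF G (S ∩ D) {x} t)
      (X.erase x ∪ farEnds G D S (clF G (S ∩ D) {x} t) t) t := by
  set A := clF G (S ∩ D) {x} t with hA
  have hxA : x ∈ A := mem_clF.2 ⟨by simp [hx, hxS], x, by simp, by simp [hx, hxS], Conn.refl _⟩
  have hAS : ∀ a ∈ A, a ∈ D ∧ a ∈ S := fun a ha => by
    have := (mem_clF.1 ha).1
    simp at this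
    exact this.symm
  refine clF_subset_of_closed ?_ ?_
  · intro y hy hyD
    rw [Finset.mem_union]
    by_cases hyA : y ∈ A
    · exact Or.inl hyA
    · refine Or.inr (mem_clF.2 ⟨by simp [hyD, hyA], y, ?_, by simp [hyD, hyA], Conn.refl _⟩)
      simp only [Finset.mem_union, Finset.mem_erase]
      refine Or.inl ⟨?_, hy⟩
      rintro rfl
      exact hyA hxA
  · intro a b ha hab
    have hbD : b ∈ D := hab.mem_of_ins.2
    rw [Finset.mem_union] at ha ⊢
    by_cases hbA : b ∈ A
    · exact Or.inl hbA
    right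
    rcases ha with ha | ha
    · refine mem_clF.2 ⟨by simp [hbD, hbA], b, ?_, by simp [hbD, hbA], Conn.refl _⟩
      rw [Finset.mem_union]
      refine Or.inr (mem_farEnds.2 ⟨hbD, fun hbS => hbA ?_, a, ha, hab.mono inter_subset_left⟩)
      refine clF_closed ha ((hab.mono inter_subset_left).inter_ins ?_ ?_)
      · simpa using (hAS a ha).symm
      · simp [hbS, hbD]
    · refine clF_closed ha ((hab.mono inter_subset_left).inter_ins (mem_clF.1 ha).1 ?_)
      simp [hbD, hbA]

theorem farEnds_card_le {D S : Finset V} (hinc : IsInc G inc) (x : V) (t : Set E) :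
    (farEnds G D S (clF G (S ∩ D) {x} t) t).card ≤ (exitEdges G inc S x t).card := by
  classical
  refine (Finset.card_le_card (t := (exitEdges G inc S x t).image
    fun e => if (G e).1 ∈ S then (G e).2 else (G e).1) fun z hz => ?_).trans
    Finset.card_image_le
  obtain ⟨-, hzS, a, ha, e, he, hG⟩ := mem_farEnds.1 hz
  obtain ⟨haD, x', hx', -, hc⟩ := mem_clF.1 ha
  rw [Finset.mem_singleton] at hx'
  subst hx'
  have haS : a ∈ S := (Finset.mem_inter.1 haD).1
  refine Finset.mem_image.2 ⟨e, ?_, ?_⟩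
  · simp only [exitEdges, Finset.mem_filter, Finset.mem_biUnion]
    refine ⟨⟨a, haS, (hinc _ _).2 ?_⟩, a, z, haS, hzS, hG, hc.mono ?_⟩
    · rcases hG with hG | hG <;> simp [hG]
    · exact inter_subset_inter_right _ (ins_mono (by simp))
  · rcases hG with hG | hG <;> simp [hG, haS, hzS]

theorem Ex_fiber {s : Finset E} {β : Type*} [DecidableEq β] (R : Set E → β) (B : Finset β)
    (hR : ∀ t, R t ∈ B) (h : β → Set E → ℝ) :
    Ex p s (fun t => h (R t) t) = ∑ b ∈ B, Ex p s fun t => ind (R t = b) * h b t := by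
  rw [← Ex_sum]
  refine Ex_congr (fun _ _ => rfl) fun t _ => ?_
  rw [Finset.sum_eq_single (R t)]
  · rw [ind_true rfl, one_mul]
  · intro b _ hb
    rw [ind_false hb.symm, zero_mul]
  · intro h
    exact absurd (hR t) h

theorem pow_le_chord {u : ℝ} (hu : 1 ≤ u) {n N : ℕ} (h : n ≤ N) :
    u ^ n ≤ 1 + n * ((u - 1) * u ^ N) := by
  induction n with
  | zero => simp
  | succ n ih =>
    have h1 := ih (by omega)
    have h2 : u ^ n ≤ u ^ N := pow_le_pow_right₀ hu (by omega)
    have h3 := mul_le_mul_of_nonneg_left h2 (sub_nonneg.2 hu)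
    rw [pow_succ]
    push_cast
    linarith

/-- Exponential moments of cluster volumes in finite regions. -/
theorem Ex_pow_clF_le (hinc : IsInc G inc) (hp : Unit01 p) {K Δ : ℕ} (S : V → Finset V)
    (hS : ∀ x, x ∈ S x) (hK : ∀ x, (S x).card ≤ K) (hΔ : ∀ v, (inc v).card ≤ Δ)
    (hPhi : ∀ x, Phi G inc p (S x) x ≤ 1 / 4) {u w : ℝ} (hu : 1 ≤ u) (hw : 1 ≤ w)
    (huw : w ^ K * (1 + (u - 1) * u ^ (K * Δ) / 4) ≤ u) (D : Finset V) (X : Finset V) :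
    Ex p (insF G inc D) (fun t => w ^ (clF G D X t).card) ≤ u ^ X.card := by
  induction hn : D.card using Nat.strong_induction_on generalizing D X with
  | _ n ih =>
  by_cases hXD : ∃ x ∈ X, x ∈ D
  swap
  · rw [Ex_congr (g := fun _ => 1) (fun _ _ => rfl) fun t _ => ?_, Ex_const]
    · exact one_le_pow₀ hu
    · have : clF G D X t = ∅ := by
        refine Finset.eq_empty_of_forall_notMem fun y hy => hXD ?_
        obtain ⟨-, x, hx, hxD, -⟩ := mem_clF.1 hy
        exact ⟨x, hx, hxD⟩
      simp [this]
  obtain ⟨x, hxX, hxD⟩ := hXD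
  set T := insF G inc D with hT
  let A : Set E → Finset V := clF G (S x ∩ D) {x}
  let Z : Set E → Finset V := fun t => farEnds G D (S x) (A t) t
  have hxA : ∀ t, x ∈ A t := fun t =>
    mem_clF.2 ⟨by simp [hxD, hS], x, by simp, by simp [hxD, hS], Conn.refl _⟩
  let R : Set E → Finset V × Finset V := fun t => (A t, Z t)
  let B : Finset (Finset V × Finset V) := (D.powerset.filter (x ∈ ·)) ×ˢ D.powerset
  have hRB : ∀ t, R t ∈ B := by
    intro t
    simp only [B, R, Finset.mem_product, Finset.mem_filter, Finset.mem_powerset]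
    exact ⟨⟨fun y hy => (Finset.mem_inter.1 (mem_clF.1 hy).1).2, hxA t⟩,
      fun y hy => (mem_farEnds.1 hy).1⟩
  have step1 : Ex p T (fun t => w ^ (clF G D X t).card) ≤ Ex p T fun t =>
      w ^ (R t).1.card * w ^ (clF G (D \ (R t).1) (X.erase x ∪ (R t).2) t).card := by
    refine Ex_mono hp fun t _ => ?_
    rw [← pow_add]
    refine pow_le_pow_right₀ hw ?_
    exact (Finset.card_le_card (clF_subset_union hxD (hS x) t)).trans (Finset.card_union_le _ _)
  have step2 : Ex p T (fun t =>
      w ^ (R t).1.card * w ^ (clF G (D \ (R t).1) (X.erase x ∪ (R t).2) t).card) ≤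
      Ex p T fun t => w ^ (R t).1.card * u ^ (X.card - 1 + (R t).2.card) := by
    rw [Ex_fiber R B hRB fun b t => w ^ b.1.card * w ^ (clF G (D \ b.1) (X.erase x ∪ b.2) t).card,
      Ex_fiber R B hRB fun b t => w ^ b.1.card * u ^ (X.card - 1 + b.2.card)]
    refine Finset.sum_le_sum fun b hb => ?_
    obtain ⟨A₀, Z₀⟩ := b
    simp only [B, Finset.mem_product, Finset.mem_filter, Finset.mem_powerset] at hb
    obtain ⟨⟨hAD, hxA₀⟩, -⟩ := hb
    have hsub : insF G inc (D \ A₀) ⊆ T := by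
      rw [← Finset.coe_subset, hT, coe_insF hinc, coe_insF hinc]
      exact ins_mono (by simp)
    have hd1 : DepOn (fun t => ind (R t = (A₀, Z₀)) * w ^ A₀.card)
        (insF G inc (D \ A₀) : Set E)ᶜ := by
      rw [coe_insF hinc]
      have := (explored_dep (G := G) (D := D) (S := S x) (Z := Z₀) hxA₀).ind
      intro t
      exact congrArg (· * w ^ A₀.card) (this t)
    have hd2 : DepOn (fun t => w ^ (clF G (D \ A₀) (X.erase x ∪ Z₀) t).card)
        ((T \ insF G inc (D \ A₀) : Finset E) : Set E)ᶜ := by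
      refine DepOn.mono (s := ins G ((D \ A₀ : Finset V) : Set V))
        (fun t => by rw [clF_dep (D \ A₀) _ t]) ?_
      rw [← coe_insF hinc]
      intro e he
      simp only [Finset.coe_sdiff, mem_compl_iff, mem_sdiff, not_and, not_not]
      exact fun _ => he
    have h1 := Ex_mul_of_compl (p := p) Finset.sdiff_disjoint hd1 hd2
    have h2 := Ex_mul_of_compl (p := p) (s₁ := T \ insF G inc (D \ A₀))
      (g := fun _ => u ^ (X.card - 1 + Z₀.card)) Finset.sdiff_disjoint hd1 (fun _ => rfl)
    rw [Finset.sdiff_union_of_subset hsub] at h1 h2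
    simp only [← mul_assoc]
    rw [h1, h2, Ex_const]
    refine mul_le_mul_of_nonneg_left ?_ (Ex_nonneg hp fun t _ =>
      mul_nonneg (ind_nonneg _) (pow_nonneg (by linarith) _))
    refine (ih _ ?_ (D \ A₀) _ rfl).trans (pow_le_pow_right₀ hu ?_)
    · rw [← hn]
      exact Finset.card_lt_card (Finset.sdiff_ssubset hAD ⟨x, hxA₀⟩)
    · exact (Finset.card_union_le _ _).trans (by rw [Finset.card_erase_of_mem hxX])
  have hexc : ∀ t, (exitEdges G inc (S x) x t).card ≤ K * Δ := fun t =>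
    (Finset.card_le_card exitEdges_subset).trans <| Finset.card_biUnion_le.trans <|
      (Finset.sum_le_card_nsmul _ _ Δ fun v _ => hΔ v).trans <| by
        rw [smul_eq_mul]; exact Nat.mul_le_mul_right _ (hK x)
  have step3 : Ex p T (fun t => w ^ (R t).1.card * u ^ (X.card - 1 + (R t).2.card)) ≤
      Ex p T fun t => w ^ K * u ^ (X.card - 1) * (1 +
        (u - 1) * u ^ (K * Δ) * ((exitEdges G inc (S x) x t).card : ℝ)) := by
    refine Ex_mono hp fun t _ => ?_
    have h1 : w ^ (R t).1.card ≤ w ^ K := pow_le_pow_right₀ hw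
      ((Finset.card_le_card fun y hy => (Finset.mem_inter.1 (mem_clF.1 hy).1).1).trans (hK x))
    have h2 : u ^ (R t).2.card ≤ 1 + (u - 1) * u ^ (K * Δ) *
        ((exitEdges G inc (S x) x t).card : ℝ) := by
      refine (pow_le_pow_right₀ hu (farEnds_card_le hinc x t)).trans ?_
      refine (pow_le_chord hu (hexc t)).trans (le_of_eq (by ring))
    rw [pow_add, ← mul_assoc]
    refine mul_le_mul ?_ h2 (by positivity) (by positivity)
    exact mul_le_mul_of_nonneg_right h1 (by positivity)
  refine (step1.trans (step2.trans step3)).trans ?_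
  rw [Ex_mul_left, Ex_add, Ex_const, Ex_mul_left]
  have hPhi' : Ex p T (fun t => ((exitEdges G inc (S x) x t).card : ℝ)) ≤ 1 / 4 := by
    refine le_trans ?_ (hPhi x)
    refine (Ex_mono_set hp (Finset.subset_union_left (s₂ := insF G inc (S x)))
      fun t t' h => by
        exact_mod_cast Finset.card_le_card (exitEdges_mono (G := G) (inc := inc) (S := S x) (x := x) h)).trans_eq ?_
    refine Ex_of_subset Finset.subset_union_right ?_
    rw [coe_insF hinc]
    exact fun t => congrArg (fun F : Finset E => (F.card : ℝ)) (exitEdges_dep (G := G) (inc := inc) (S := S x) (x := x) t)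
  have hX : 0 < X.card := Finset.card_pos.2 ⟨x, hxX⟩
  have hu0 : 0 ≤ (u - 1) * u ^ (K * Δ) := mul_nonneg (by linarith) (by positivity)
  calc w ^ K * u ^ (X.card - 1) * (1 + (u - 1) * u ^ (K * Δ) *
        Ex p T fun t => ((exitEdges G inc (S x) x t).card : ℝ))
      ≤ w ^ K * u ^ (X.card - 1) * (1 + (u - 1) * u ^ (K * Δ) * (1 / 4)) := by gcongr
    _ = u ^ (X.card - 1) * (w ^ K * (1 + (u - 1) * u ^ (K * Δ) / 4)) := by ring
    _ ≤ u ^ (X.card - 1) * u := by gcongr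
    _ = u ^ X.card := by rw [← pow_succ, Nat.sub_add_cancel hX]

theorem exists_weights (K N : ℕ) : ∃ u w : ℝ, 1 ≤ u ∧ 1 < w ∧
    w ^ K * (1 + (u - 1) * u ^ N / 4) ≤ u := by
  have h1 : Filter.Tendsto (fun u : ℝ => u ^ N) (nhdsWithin 1 (Ioi 1)) (nhds (1 ^ N)) :=
    ((continuous_pow N).tendsto 1).mono_left nhdsWithin_le_nhds
  rw [one_pow] at h1
  obtain ⟨u, hu1, hu2⟩ := ((h1.eventually (gt_mem_nhds (by norm_num : (1:ℝ) < 2))).and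
    self_mem_nhdsWithin).exists
  have hu : 1 < u := hu2
  set c := 1 + (u - 1) * u ^ N / 4 with hc
  have hc1 : 0 < c := by positivity [sub_pos.2 hu]
  have hcu : c < u := by nlinarith
  have h2 : Filter.Tendsto (fun w : ℝ => w ^ K * c) (nhdsWithin 1 (Ioi 1)) (nhds (1 ^ K * c)) :=
    (((continuous_pow K).mul continuous_const).tendsto 1).mono_left nhdsWithin_le_nhds
  rw [one_pow, one_mul] at h2
  obtain ⟨w, hw1, hw2⟩ := ((h2.eventually (gt_mem_nhds hcu)).and self_mem_nhdsWithin).exists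
  exact ⟨u, w, hu.le, hw2, hw1.le⟩

end Volume

section Sharp

variable {V E : Type*} [DecidableEq V] [DecidableEq E]
variable {G : E → V × V} {t t' : Set E} {u v w : V}
variable {inc : V → Finset E} {p p' : E → ℝ}

/-- Small exit probabilities at sprinkled parameters imply exponential decay of cluster sizes. -/
theorem exists_exp_tail (hinc : IsInc G inc) (hp : Unit01 p) {Δ : ℕ}
    (hΔ : ∀ v, (inc v).card ≤ Δ) {y₀ : ℝ} (h0 : 0 < y₀) (h1 : y₀ < 1)
    (hK : ∀ c : ℝ, 0 < c → ∃ K : ℕ, ∀ x, ∃ L : Finset V, x ∈ L ∧ L.card ≤ K ∧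
      Pr (sprinkle p y₀) (L.biUnion inc) (Exits G L x) ≤ c) :
    ∃ C : ℝ, 0 < C ∧ ∃ d : ℝ, 0 < d ∧ ∀ (x : V) (D : Finset V) (k : ℕ),
      Pr p (insF G inc D) (fun t => k ≤ (clF G D {x} t).card) ≤ C * Real.exp (-d * k) := by
  have hc : 0 < 1 - Real.exp (-(y₀ / 4)) := by
    rw [sub_pos, Real.exp_lt_one_iff]; linarith
  obtain ⟨K, hK⟩ := hK _ (half_pos hc)
  have hS : ∀ x, ∃ S : Finset V, x ∈ S ∧ S.card ≤ K ∧ Phi G inc p S x ≤ 1 / 4 := fun x => by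
    obtain ⟨L, hx, hL, h⟩ := hK x
    obtain ⟨S, hSL, hxS, hPhi⟩ := exists_Phi_lt hinc hp hx h0 h1 (h.trans_lt (half_lt_self hc))
    exact ⟨S, hxS, (Finset.card_le_card hSL).trans hL, hPhi.le⟩
  choose S hxS hSK hPhi using hS
  obtain ⟨u, w, hu, hw, huw⟩ := exists_weights K (K * Δ)
  have hu0 : 0 < u := by linarith
  have hw0 : 0 < w := by linarith
  refine ⟨u, hu0, Real.log w, Real.log_pos hw, fun x D k => ?_⟩
  have hexp : Real.exp (-Real.log w * k) = (w ^ k)⁻¹ := by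
    rw [neg_mul, Real.exp_neg, mul_comm, Real.exp_nat_mul, Real.exp_log hw0]
  have hmk : w ^ k * Pr p (insF G inc D) (fun t => k ≤ (clF G D {x} t).card) ≤
      Ex p (insF G inc D) (fun t => w ^ (clF G D {x} t).card) := by
    unfold Pr
    rw [← Ex_mul_left]
    refine Ex_mono hp fun t _ => ?_
    by_cases h : k ≤ (clF G D {x} t).card
    · rw [ind_true h, mul_one]
      exact pow_le_pow_right₀ hw.le h
    · rw [ind_false h, mul_zero]
      positivity
  have h := Ex_pow_clF_le hinc hp S hxS hSK hΔ hPhi hu hw.le huw D {x}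
  rw [Finset.card_singleton, pow_one] at h
  rw [hexp, ← div_eq_mul_inv, le_div_iff₀ (by positivity), mul_comm]
  exact hmk.trans h

end Sharp

section Measure

variable {V E : Type} [DecidableEq V] [DecidableEq E]
variable {G : E → V × V} {t : Set E}
variable {inc : V → Finset E} {p : E → ℝ}

/-- The configuration as a set of edges. -/
def openSet (ω : Config E) : Set E := {e | ω e = true}

theorem IsBernoulliProduct.measure_dep {P : Measure (Config E)} (hP : IsBernoulliProduct p P)
    (hp : Unit01 p) (s : Finset E) {A : Set E → Prop} (hA : DepOn A s) :
    P {ω | A (openSet ω)} = ENNReal.ofReal (Pr p s A) := by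
  rw [← hP.measure_eq hp s A]
  congr 1
  ext ω
  simp only [mem_ofPred_eq]
  rw [← hA]
  have : openSet ω ∩ s = {e | e ∈ s ∧ ω e = true} := by
    ext e; simp [openSet, and_comm]
  rw [this]

theorem exits_depOn_of_mem (hinc : IsInc G inc) (L : Finset V) (x : V) (hx : x ∈ L) :
    DepOn (Exits G L x) (L.biUnion inc : Finset E) := by
  intro t
  refine propext ⟨fun h => h.mono inter_subset_left, fun ⟨y, hy, h⟩ => ?_⟩
  rcases h.stays_or_leaves (S := (L : Set V)) hx with h | ⟨a, b, h1, h2, e, he, hG⟩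
  · exact absurd (h.mem_of_ins hx) hy
  · have ha : a ∈ L := h1.mem_of_ins hx
    refine ⟨b, h2, (h1.mono ?_).trans (Adj.conn ⟨e, ⟨he, ?_⟩, hG⟩)⟩
    · refine inter_subset_inter_right _ fun e he => ?_
      rw [Finset.mem_coe, Finset.mem_biUnion]
      exact ⟨(G e).1, he.1, (hinc _ _).2 (Or.inl rfl)⟩
    · rw [Finset.mem_coe, Finset.mem_biUnion]
      refine ⟨a, ha, (hinc _ _).2 ?_⟩
      rcases hG with hG | hG <;> simp [hG]

/-- If the exit probabilities can be made arbitrarily small, clusters are almost surely finite. -/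
theorem measure_infinite_eq_zero (hinc : IsInc G inc) (hp : Unit01 p)
    {P : Measure (Config E)} (hP : IsBernoulliProduct p P) (x : V)
    (h : ∀ c : ℝ, 0 < c → ∃ L : Finset V, x ∈ L ∧ Pr p (L.biUnion inc) (Exits G L x) ≤ c) :
    P {ω | {y | Conn G (openSet ω) x y}.Infinite} = 0 := by
  refine nonpos_iff_eq_zero.1 (ENNReal.le_of_forall_pos_le_add fun c hc _ => ?_)
  obtain ⟨L, hx, hL⟩ := h c hc
  rw [zero_add]
  calc P {ω | {y | Conn G (openSet ω) x y}.Infinite} ≤ P {ω | Exits G L x (openSet ω)} := by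
        refine measure_mono fun ω hω => ?_
        obtain ⟨y, hy, hyL⟩ := (show Set.Infinite _ from hω).exists_notMem_finset L
        exact ⟨y, hyL, hy⟩
    _ ≤ c := by
        rw [hP.measure_dep hp _ (exits_depOn_of_mem hinc L x hx)]
        exact ENNReal.ofReal_le_of_le_toReal hL

/-- The law of cluster sizes is controlled by that in finite regions. -/
theorem measure_encard_le [Countable V] (hinc : IsInc G inc) (hp : Unit01 p)
    {P : Measure (Config E)} (hP : IsBernoulliProduct p P) (x : V) (k : ℕ) {r : ℝ}
    (h : ∀ D, Pr p (insF G inc D) (fun t => k ≤ (clF G D {x} t).card) ≤ r) :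
    P {ω | (k : ℕ∞) ≤ {y | Conn G (openSet ω) x y}.encard} ≤ ENNReal.ofReal r := by
  have hmono : ∀ {D D' : Finset V}, D ⊆ D' → ∀ t, clF G D {x} t ⊆ clF G D' {x} t := by
    intro D D' hDD t y hy
    rw [mem_clF] at *
    obtain ⟨h1, z, hz, hzD, hc⟩ := hy
    exact ⟨hDD h1, z, hz, hDD hzD, hc.mono (inter_subset_inter_right _ (ins_mono hDD))⟩
  have hsub : {ω : Config E | (k : ℕ∞) ≤ {y | Conn G (openSet ω) x y}.encard} ⊆
      ⋃ D : Finset V, {ω | k ≤ (clF G D {x} (openSet ω)).card} := by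
    intro ω hω
    obtain ⟨s, hs, hk⟩ := Set.exists_subset_encard_eq (show _ ≤ _ from hω)
    have hfin : s.Finite := Set.finite_of_encard_eq_coe hk
    have hpath : ∀ y, Conn G (openSet ω) x y →
        ∃ D : Finset V, y ∈ D ∧ x ∈ D ∧ Conn G (openSet ω ∩ ins G D) x y := by
      intro y hy
      induction hy with
      | refl => exact ⟨{x}, by simp, by simp, Conn.refl _⟩
      | @tail b c _ hbc ih =>
        obtain ⟨D, hb, hx, hc⟩ := ih
        refine ⟨insert c D, by simp, by simp [hx], (hc.mono (inter_subset_inter_right _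
          (ins_mono (by simp)))).trans (hbc.inter_ins ?_ ?_).conn⟩ <;> simp [hb]
    have hpath' : ∀ y : V, ∃ D : Finset V, Conn G (openSet ω) x y →
        y ∈ D ∧ x ∈ D ∧ Conn G (openSet ω ∩ ins G D) x y := fun y => by
      by_cases hy : Conn G (openSet ω) x y
      · obtain ⟨D, hD⟩ := hpath y hy
        exact ⟨D, fun _ => hD⟩
      · exact ⟨∅, fun h => absurd h hy⟩
    choose D hD using hpath'
    refine mem_iUnion.2 ⟨hfin.toFinset.biUnion D, ?_⟩
    have hcard : hfin.toFinset.card = k := by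
      rw [hfin.encard_eq_coe_toFinset_card] at hk
      exact_mod_cast hk
    show k ≤ _
    rw [← hcard]
    refine Finset.card_le_card fun y hy => ?_
    have hys : y ∈ s := hfin.mem_toFinset.1 hy
    obtain ⟨h1, h2, h3⟩ := hD y (hs hys)
    refine hmono (Finset.subset_biUnion_of_mem D hy) _ (mem_clF.2 ⟨h1, x, by simp, h2, h3⟩)
  refine (measure_mono hsub).trans ?_
  rw [Directed.measure_iUnion]
  · refine iSup_le fun D => ?_
    have hdep : DepOn (fun t => k ≤ (clF G D {x} t).card) (insF G inc D : Finset E) := by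
      rw [coe_insF hinc]
      intro t
      simp only [clF_dep D {x} t]
    have := hP.measure_dep hp _ hdep
    rw [this]
    exact ENNReal.ofReal_le_ofReal (h D)
  · intro D D'
    refine ⟨D ∪ D', fun ω hω => ?_, fun ω hω => ?_⟩
    · exact (show k ≤ _ from hω).trans
        (Finset.card_le_card (hmono Finset.subset_union_left _))
    · exact (show k ≤ _ from hω).trans
        (Finset.card_le_card (hmono Finset.subset_union_right _))

end Measure

section Partition

variable {V : Type*} {σ τ : Setoid V} {a b c o u v w : V}

/-- The equivalence relation identifying `a` and `b` only. -/
def glue (a b : V) : Setoid V where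
  r u v := u = v ∨ (u = a ∨ u = b) ∧ (v = a ∨ v = b)
  iseqv := by
    refine ⟨fun _ => Or.inl rfl, fun {x y} h => ?_, fun {x y z} h h' => ?_⟩
    · rcases h with h | h
      exacts [Or.inl h.symm, Or.inr h.symm]
    · rcases h with rfl | h
      · exact h'
      · rcases h' with rfl | h'
        exacts [Or.inr h, Or.inr ⟨h.1, h'.2⟩]

theorem glue_apply : glue a b u v ↔ u = v ∨ (u = a ∨ u = b) ∧ (v = a ∨ v = b) := Iff.rfl

theorem glue_comm (a b : V) : glue a b = glue b a := by
  ext u v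
  rw [glue_apply, glue_apply]
  tauto

theorem glue_le : glue a b ≤ σ ↔ σ a b := by
  rw [Setoid.le_def]
  constructor
  · exact fun h => h (Or.inr ⟨Or.inl rfl, Or.inr rfl⟩)
  · rintro h u v (rfl | ⟨rfl | rfl, rfl | rfl⟩)
    exacts [σ.refl _, σ.refl _, h, σ.symm h, σ.refl _]

theorem sup_glue_apply : (σ ⊔ glue a b) u v ↔ σ u v ∨ σ u a ∧ σ b v ∨ σ u b ∧ σ a v := by
  let ρ : Setoid V :=
    { r := fun u v => σ u v ∨ σ u a ∧ σ b v ∨ σ u b ∧ σ a v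
      iseqv := by
        refine ⟨fun _ => Or.inl (σ.refl _), fun {x y} h => ?_, fun {x y z} h h' => ?_⟩
        · rcases h with h | ⟨h, h'⟩ | ⟨h, h'⟩
          exacts [Or.inl (σ.symm h), Or.inr (Or.inr ⟨σ.symm h', σ.symm h⟩),
            Or.inr (Or.inl ⟨σ.symm h', σ.symm h⟩)]
        · have T := fun {x y z} => @Setoid.trans' V σ x y z
          have S := fun {x y} => @Setoid.symm' V σ x y
          rcases h with h | ⟨h1, h2⟩ | ⟨h1, h2⟩ <;> rcases h' with h' | ⟨h3, h4⟩ | ⟨h3, h4⟩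
          · exact Or.inl (T h h')
          · exact Or.inr (Or.inl ⟨T h h3, h4⟩)
          · exact Or.inr (Or.inr ⟨T h h3, h4⟩)
          · exact Or.inr (Or.inl ⟨h1, T h2 h'⟩)
          · exact Or.inr (Or.inl ⟨h1, h4⟩)
          · exact Or.inl (T h1 h4)
          · exact Or.inr (Or.inr ⟨h1, T h2 h'⟩)
          · exact Or.inl (T h1 h4)
          · exact Or.inr (Or.inr ⟨h1, h4⟩) }
  have h1 : σ ⊔ glue a b = ρ := by
    refine le_antisymm (sup_le (fun u v h => Or.inl h) ?_) fun u v h => ?_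
    · exact glue_le.2 (Or.inr (Or.inl ⟨σ.refl _, σ.refl _⟩))
    · have h1 : ∀ {x y}, σ x y → (σ ⊔ glue a b) x y := fun h => (le_sup_left : σ ≤ _) h
      have h2 : (σ ⊔ glue a b) a b := glue_le.1 le_sup_right
      rcases h with h | ⟨h, h'⟩ | ⟨h, h'⟩
      · exact h1 h
      · exact Setoid.trans' _ (h1 h) (Setoid.trans' _ h2 (h1 h'))
      · exact Setoid.trans' _ (h1 h) (Setoid.trans' _ (Setoid.symm' _ h2) (h1 h'))
  rw [h1]
  exact Iff.rfl

/-- `σ` and `τ` agree away from `O`. -/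
def AgreeOff (O : Set V) (σ τ : Setoid V) : Prop := ∀ u v, u ∉ O → v ∉ O → (σ u v ↔ τ u v)

theorem AgreeOff.sup_glue {O : Set V} (h : AgreeOff O σ τ) (ha : a ∉ O) (hb : b ∉ O) :
    AgreeOff O (σ ⊔ glue a b) (τ ⊔ glue a b) := by
  intro u v hu hv
  refine sup_glue_apply.trans (Iff.trans ?_ sup_glue_apply.symm)
  rw [h u v hu hv, h u a hu ha, h b v hb hv, h u b hu hb, h a v ha hv]

/-- `f` does not depend on the elements of `O`. -/
def Insens (O : Set V) (f : Setoid V → ℝ) : Prop := ∀ σ τ, AgreeOff O σ τ → f σ = f τ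

theorem Insens.mono {O O' : Set V} {f : Setoid V → ℝ} (h : Insens O f) (hO : O' ⊆ O) :
    Insens O' f := fun σ τ hst =>
  h σ τ fun u v hu hv => hst u v (fun h' => hu (hO h')) fun h' => hv (hO h')

/-- Averaging over the state of an edge. -/
def glueStep (e : V × V × ℝ) (f : Setoid V → ℝ) : Setoid V → ℝ := fun σ =>
  e.2.2 * f (σ ⊔ glue e.1 e.2.1) + (1 - e.2.2) * f σ

instance : LeftCommutative (glueStep (V := V)) := ⟨fun e e' f => by
  funext σ
  simp only [glueStep]
  rw [sup_right_comm]
  ring⟩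

/-- Averaging over the states of a multiset of edges. -/
def avg (m : Multiset (V × V × ℝ)) (f : Setoid V → ℝ) : Setoid V → ℝ := m.foldr glueStep f

variable {f g : Setoid V → ℝ} {m m' R : Multiset (V × V × ℝ)}

@[simp] theorem avg_zero : avg 0 f = f := Multiset.foldr_zero _ _

@[simp] theorem avg_cons (e : V × V × ℝ) : avg (e ::ₘ m) f = glueStep e (avg m f) :=
  Multiset.foldr_cons _ _ _ _

theorem avg_add : avg (m + m') f = avg m (avg m' f) := Multiset.foldr_add _ _ _ _

theorem Insens.step {O : Set V} (hf : Insens O f) {e : V × V × ℝ} (h1 : e.1 ∉ O) (h2 : e.2.1 ∉ O) :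
    Insens O (glueStep e f) := by
  intro σ τ h
  simp only [glueStep]
  rw [hf _ _ h, hf _ _ (h.sup_glue h1 h2)]

/-- No edge of `m` has an endpoint in `O`. -/
def Avoids (m : Multiset (V × V × ℝ)) (O : Set V) : Prop := ∀ e ∈ m, e.1 ∉ O ∧ e.2.1 ∉ O

theorem Avoids.add {O : Set V} (h : Avoids m O) (h' : Avoids m' O) : Avoids (m + m') O := by
  intro e he
  rcases Multiset.mem_add.1 he with he | he
  exacts [h e he, h' e he]

theorem Avoids.mono {O O' : Set V} (h : Avoids m O) (hO : O' ⊆ O) : Avoids m O' :=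
  fun e he => ⟨fun h' => (h e he).1 (hO h'), fun h' => (h e he).2 (hO h')⟩

theorem Avoids.insens {O : Set V} (h : Avoids m O) (hf : Insens O f) : Insens O (avg m f) := by
  induction m using Multiset.induction_on with
  | empty => simpa using hf
  | cons e m ih =>
    rw [avg_cons]
    exact (ih fun e' he' => h e' (Multiset.mem_cons_of_mem he')).step
      (h e (Multiset.mem_cons_self _ _)).1 (h e (Multiset.mem_cons_self _ _)).2

/-- Star–triangle transformation. -/
theorem avg_star (ha : a ≠ o) (hb : b ≠ o) (hc : c ≠ o) (hR : Avoids R {o}) (hf : Insens {o} f)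
    {x y z : ℝ} (hk : kappaT x y z = 0) :
    avg ({(o, a, 1 - x), (o, b, 1 - y), (o, c, 1 - z)} + R) f ⊥ =
      avg ({(b, c, x), (a, c, y), (a, b, z)} + R) f ⊥ := by
  rw [avg_add, avg_add]
  have hg : Insens {o} (avg R f) := hR.insens hf
  generalize avg R f = g at hg
  have e0 : ∀ d, d ≠ o → g (⊥ ⊔ glue o d) = g ⊥ := fun d hd => by
    refine hg _ _ fun u v hu hv => ?_
    simp only [mem_singleton_iff] at hu hv
    simp only [sup_glue_apply, Setoid.bot_def]
    tauto
  have e2 : ∀ d e, d ≠ o → e ≠ o → g (⊥ ⊔ glue o d ⊔ glue o e) = g (⊥ ⊔ glue d e) :=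
    fun d e hd he => by
    refine hg _ _ fun u v hu hv => ?_
    simp only [mem_singleton_iff] at hu hv
    simp only [sup_glue_apply, Setoid.bot_def]
    constructor <;> (intro h; grind)
  have e3 : g (⊥ ⊔ glue o a ⊔ glue o b ⊔ glue o c) = g (⊥ ⊔ glue b c ⊔ glue a b) := by
    refine hg _ _ fun u v hu hv => ?_
    simp only [mem_singleton_iff] at hu hv
    simp only [sup_glue_apply, Setoid.bot_def]
    constructor <;> (intro h; grind)
  have f1 : (⊥ ⊔ glue b c ⊔ glue a c : Setoid V) = ⊥ ⊔ glue b c ⊔ glue a b := by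
    ext u v
    simp only [sup_glue_apply, Setoid.bot_def]
    constructor <;> (intro h; grind)
  have f2 : (⊥ ⊔ glue a c ⊔ glue a b : Setoid V) = ⊥ ⊔ glue b c ⊔ glue a b := by
    ext u v
    simp only [sup_glue_apply, Setoid.bot_def]
    constructor <;> (intro h; grind)
  have f3 : (⊥ ⊔ glue b c ⊔ glue a b ⊔ glue a b : Setoid V) = ⊥ ⊔ glue b c ⊔ glue a b := by
    rw [sup_assoc _ (glue a b), sup_idem]
  simp only [Multiset.insert_eq_cons, ← Multiset.cons_zero, avg_cons, avg_zero, glueStep, e3,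
    e2 a b ha hb, e2 a c ha hc, e2 b c hb hc, e0 a ha, e0 b hb, e0 c hc, f1, f2, f3]
  unfold kappaT at hk
  linear_combination (g ⊥ - g (⊥ ⊔ glue b c ⊔ glue a b)) * hk

end Partition

section Partition

variable {V : Type*} {σ τ : Setoid V} {a b c o u v w : V}
variable {f g : Setoid V → ℝ} {m m' R : Multiset (V × V × ℝ)}

/-- Contracting an edge of probability one. -/
theorem avg_contract (ha : a ≠ o) (hb : b ≠ o) (hu : u ≠ o) (hR : Avoids R {o})
    (hf : Insens {o} f) (x y : ℝ) :
    avg ({(o, u, 1), (o, a, x), (o, b, y)} + R) f ⊥ = avg ({(u, a, x), (u, b, y)} + R) f ⊥ := by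
  rw [avg_add, avg_add]
  have hg : Insens {o} (avg R f) := hR.insens hf
  generalize avg R f = g at hg
  have e0 : g (⊥ ⊔ glue o u) = g ⊥ := by
    refine hg _ _ fun u v hu hv => ?_
    simp only [mem_singleton_iff] at hu hv
    simp only [sup_glue_apply, Setoid.bot_def]
    tauto
  have e1 : ∀ d, d ≠ o → g (⊥ ⊔ glue o u ⊔ glue o d) = g (⊥ ⊔ glue u d) := fun d hd => by
    refine hg _ _ fun u v hu hv => ?_
    simp only [mem_singleton_iff] at hu hv
    simp only [sup_glue_apply, Setoid.bot_def]
    constructor <;> (intro h; grind)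
  have e2 : g (⊥ ⊔ glue o u ⊔ glue o a ⊔ glue o b) = g (⊥ ⊔ glue u a ⊔ glue u b) := by
    refine hg _ _ fun u v hu hv => ?_
    simp only [mem_singleton_iff] at hu hv
    simp only [sup_glue_apply, Setoid.bot_def]
    constructor <;> (intro h; grind)
  simp only [Multiset.insert_eq_cons, ← Multiset.cons_zero, avg_cons, avg_zero, glueStep, e2,
    e1 a ha, e1 b hb, e0]
  ring

theorem avg_drop (u v : V) : avg ((u, v, 0) ::ₘ m) f = avg m f := by
  funext σ
  simp [glueStep]

theorem avg_drop_sum {ι : Type*} (s : Finset ι) (u v : ι → V) :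
    avg (m + ∑ i ∈ s, {(u i, v i, 0)}) f = avg m f := by
  rw [add_comm]
  classical
  induction s using Finset.induction_on with
  | empty => simp
  | insert i s hi ih =>
    rw [Finset.sum_insert hi, add_assoc, Multiset.singleton_add, avg_drop, ih]

theorem avg_move (h : (a, b, 1) ∈ m) (x : ℝ) (w : V) :
    avg ((a, w, x) ::ₘ m) f = avg ((b, w, x) ::ₘ m) f := by
  obtain ⟨m, rfl⟩ := Multiset.exists_cons_of_mem h
  rw [Multiset.cons_swap, Multiset.cons_swap (b, w, x), avg_cons, avg_cons]
  funext σ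
  simp only [glueStep, avg_cons]
  have h1 : σ ⊔ glue a b ⊔ glue a w = σ ⊔ glue a b ⊔ glue b w := by
    have key : ∀ x y : V, σ ⊔ glue a b ⊔ glue x w ≤ σ ⊔ glue a b ⊔ glue y w ↔
        (σ ⊔ glue a b ⊔ glue y w) x w := fun x y => by
      rw [sup_le_iff, glue_le]
      exact and_iff_right le_sup_left
    have hab : ∀ y : V, (σ ⊔ glue a b ⊔ glue y w) a b := fun y =>
      glue_le.1 (le_sup_right.trans le_sup_left)
    have hw : ∀ y : V, (σ ⊔ glue a b ⊔ glue y w) y w := fun y => glue_le.1 le_sup_right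
    exact le_antisymm ((key a b).2 (Setoid.trans' _ (hab b) (hw b)))
      ((key b a).2 (Setoid.trans' _ (Setoid.symm' _ (hab a)) (hw a)))
  rw [h1]
  ring

theorem glueStep_symm (a b : V) (x : ℝ) : glueStep (a, b, x) f = glueStep (b, a, x) f := by
  funext σ
  simp only [glueStep, glue_comm a b]

theorem avg_symm (x : ℝ) : avg ((a, b, x) ::ₘ m) f = avg ((b, a, x) ::ₘ m) f := by
  rw [avg_cons, avg_cons, glueStep_symm]

/-- Edges of probability one may be used to move both ends of a family of edges. -/
theorem avg_move_sum {ι : Type*} (s : Finset ι) (u u' v v' : ι → V) (x : ι → ℝ)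
    (h : ∀ i ∈ s, (u i, u' i, 1) ∈ m ∧ (v i, v' i, 1) ∈ m) :
    avg (m + ∑ i ∈ s, {(u i, v i, x i)}) f = avg (m + ∑ i ∈ s, {(u' i, v' i, x i)}) f := by
  classical
  induction s using Finset.induction_on with
  | empty => simp
  | insert i s hi ih =>
    have h1 : ∀ (e : V × V × ℝ) (M : Multiset (V × V × ℝ)), m + ({e} + M) = e ::ₘ (m + M) := by
      intro e M
      rw [add_left_comm, Multiset.singleton_add]
    rw [Finset.sum_insert hi, Finset.sum_insert hi, h1, h1,
      avg_move (b := u' i) (by simp [(h i (by simp)).1]), avg_symm,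
      avg_move (b := v' i) (by simp [(h i (by simp)).2]), avg_symm, avg_cons,
      ih fun j hj => h j (by simp [hj]), ← avg_cons]

theorem avoids_sum {ι : Type*} {s : Finset ι} {M : ι → Multiset (V × V × ℝ)} {O : Set V}
    (h : ∀ i ∈ s, Avoids (M i) O) : Avoids (∑ i ∈ s, M i) O := by
  intro e he
  obtain ⟨i, hi, he⟩ := Multiset.mem_sum.1 he
  exact h i hi e he

/-- Performing a family of local replacements with distinct centres `o i`. -/
theorem avg_replace {ι : Type*} (s : Finset ι) (o : ι → V) (S D : ι → Multiset (V × V × ℝ))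
    (hSD : ∀ i ∈ s, ∀ R, Avoids R {o i} → Insens {o i} f →
      avg (S i + R) f ⊥ = avg (D i + R) f ⊥)
    (hS : ∀ i ∈ s, ∀ j ∈ s, i ≠ j → Avoids (S i) {o j})
    (hD : ∀ i ∈ s, ∀ j ∈ s, Avoids (D i) {o j})
    (hR : ∀ i ∈ s, Avoids R {o i}) (hf : ∀ i ∈ s, Insens {o i} f) :
    avg (∑ i ∈ s, S i + R) f ⊥ = avg (∑ i ∈ s, D i + R) f ⊥ := by
  classical
  induction s using Finset.induction_on generalizing R with
  | empty => rfl
  | insert i s hi ih =>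
    rw [Finset.sum_insert hi, Finset.sum_insert hi, add_assoc, hSD i (by simp) _ ?_ (hf i (by simp)),
      add_left_comm, ih (fun j hj => hSD j (by simp [hj]))
        (fun j hj k hk => hS j (by simp [hj]) k (by simp [hk]))
        (fun j hj k hk => hD j (by simp [hj]) k (by simp [hk])) ?_
        (fun j hj => hf j (by simp [hj]))]
    · rw [add_left_comm, add_assoc]
    · exact fun j hj => (hD i (by simp) j (by simp [hj])).add (hR j (by simp [hj]))
    · refine (avoids_sum fun j hj => hS j (by simp [hj]) i (by simp) ?_).add (hR i (by simp))
      rintro rfl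
      exact hi hj

/-- The partition of the vertices into open clusters. -/
def clusters {E : Type*} (G : E → V × V) (t : Set E) : Setoid V where
  r := Conn G t
  iseqv := ⟨Conn.refl, Conn.symm, Conn.trans⟩

theorem clusters_le {E : Type*} {G : E → V × V} {t : Set E} :
    clusters G t ≤ σ ↔ ∀ e ∈ t, σ (G e).1 (G e).2 := by
  rw [Setoid.le_def]
  constructor
  · exact fun h e he => h (adj_of_mem he).conn
  · intro h u v huv
    change Conn G t u v at huv
    induction huv with
    | refl => exact σ.refl _
    | tail _ h' ih =>
      obtain ⟨e, he, hG | hG⟩ := h'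
      · have := h e he
        rw [hG] at this
        exact σ.trans ih this
      · have := h e he
        rw [hG] at this
        exact σ.trans ih (σ.symm this)

/-- Averaging over the states of the edges, as an expectation. -/
theorem avg_eq_Ex {E : Type*} [DecidableEq E] (G : E → V × V) (p : E → ℝ) (s : Finset E)
    (f : Setoid V → ℝ) (σ : Setoid V) :
    avg (∑ e ∈ s, {((G e).1, (G e).2, p e)}) f σ = Ex p s fun t => f (σ ⊔ clusters G t) := by
  induction s using Finset.induction_on generalizing σ with
  | empty =>
    rw [Finset.sum_empty, avg_zero, Ex_empty]
    have : clusters G (∅ : Set E) = ⊥ := le_bot_iff.1 (clusters_le.2 (by simp))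
    rw [this, sup_bot_eq]
  | insert e s he ih =>
    have h1 : ∀ t : Set E, σ ⊔ clusters G (insert e t) =
        σ ⊔ glue (G e).1 (G e).2 ⊔ clusters G t := fun t => by
      refine le_antisymm (sup_le (le_sup_left.trans le_sup_left) (clusters_le.2 ?_))
        (sup_le (sup_le le_sup_left ?_) (le_sup_of_le_right (clusters_le.2 ?_)))
      · intro e' he'
        rcases Set.mem_insert_iff.1 he' with rfl | he'
        · exact glue_le.1 (le_sup_right.trans le_sup_left)
        · exact (le_sup_right : clusters G t ≤ _) (adj_of_mem he').conn
      · exact glue_le.2 ((le_sup_right : clusters G (insert e t) ≤ _)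
          (adj_of_mem (Set.mem_insert _ _)).conn)
      · exact fun e' he' => (adj_of_mem (Set.mem_insert_of_mem _ he')).conn
    rw [Finset.sum_insert he, Multiset.singleton_add, avg_cons, Ex_insert he]
    simp only [glueStep, ih, h1]

end Partition

section Zero

variable {E : Type*} [DecidableEq E] {p : E → ℝ} {s : Finset E}

/-- Only configurations of positive probability matter. -/
theorem Pr_mono_of_pos (hp : Unit01 p) {A B : Set E → Prop}
    (h : ∀ t : Set E, t ⊆ s → (∀ e ∈ s, p e = 1 → e ∈ t) → (∀ e ∈ t, p e ≠ 0) → A t → B t) :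
    Pr p s A ≤ Pr p s B := by
  unfold Pr Ex
  refine Finset.sum_le_sum fun t ht => ?_
  have hts := Finset.mem_powerset.1 ht
  by_cases h1 : ∀ e ∈ s, p e = 1 → e ∈ t
  · by_cases h0 : ∀ e ∈ t, p e ≠ 0
    · refine mul_le_mul_of_nonneg_left (ind_mono (h t (by exact_mod_cast hts)
        (by exact_mod_cast h1) (by exact_mod_cast h0))) ?_
      exact mul_nonneg (Finset.prod_nonneg fun e _ => (hp e).1)
        (Finset.prod_nonneg fun e _ => sub_nonneg.2 (hp e).2)
    · push Not at h0
      obtain ⟨e, he, h0⟩ := h0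
      rw [Finset.prod_eq_zero he h0]
      simp
  · push Not at h1
    obtain ⟨e, he, h1, h2⟩ := h1
    rw [Finset.prod_eq_zero (s := s \ t) (Finset.mem_sdiff.2 ⟨he, h2⟩) (by rw [h1, sub_self])]
    simp

/-- Transporting a probability along an injective map. -/
theorem Pr_preimage {F : Type*} [DecidableEq F] (j : E → F) (p' : F → ℝ) {s' : Finset F}
    (hj : Set.InjOn j s) (hjs : ∀ e ∈ s, j e ∈ s') (hpj : ∀ e ∈ s, p' (j e) = p e)
    {A : Set E → Prop} (hA : DepOn A s) :
    Pr p' s' (fun t => A (j ⁻¹' t)) = Pr p s A := by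
  let ι : {e // e ∈ s} ↪ F := ⟨fun e => j e, fun e e' h => Subtype.ext (hj e.2 e'.2 h)⟩
  let κ : {e // e ∈ s} ↪ E := Function.Embedding.subtype _
  have h1 : (Finset.univ : Finset {e // e ∈ s}).map ι ⊆ s' := by
    intro e he
    obtain ⟨x, -, rfl⟩ := Finset.mem_map.1 he
    exact hjs x x.2
  have h2 : (Finset.univ : Finset {e // e ∈ s}).map κ = s := by
    ext e
    simp [κ]
  have hdep : DepOn (fun t => A (j ⁻¹' t)) ((Finset.univ : Finset {e // e ∈ s}).map ι : Finset F) := by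
    intro t
    refine hA.inter_eq ?_
    ext e
    simp only [mem_inter_iff, mem_preimage, Finset.mem_coe, Finset.mem_map]
    constructor
    · exact fun h => ⟨h.1.1, h.2⟩
    · exact fun h => ⟨⟨h.1, ⟨e, h.2⟩, Finset.mem_univ _, rfl⟩, h.2⟩
  have h3 : Pr p s A = Pr p (Finset.univ.map κ) A := congrArg (fun s => Pr p s A) h2.symm
  rw [Pr_of_subset h1 hdep, h3]
  unfold Pr
  rw [Ex_map, Ex_map]
  refine Ex_congr (fun e _ => hpj e e.2) fun t _ => ?_
  congr 1
  refine hA.inter_eq ?_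
  ext e
  simp only [mem_inter_iff, mem_preimage, Finset.mem_coe, mem_image]
  constructor
  · rintro ⟨⟨x, hx, hxe⟩, he⟩
    exact ⟨⟨x, hx, hj x.2 he hxe⟩, he⟩
  · rintro ⟨⟨x, hx, rfl⟩, he⟩
    exact ⟨⟨x, hx, rfl⟩, he⟩

end Zero

section Cylinder

variable {K : ℕ} [NeZero K]

/-- Vertices of the cylinder of circumference `K`. -/
abbrev Cyl (K : ℕ) := ℤ × ZMod K

/-- The edges from level `t` to level `u` with horizontal displacement `d`. -/
def rung (K : ℕ) [NeZero K] (t u : ℤ) (d : ZMod K) (x : ℝ) : Multiset (Cyl K × Cyl K × ℝ) :=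
  ∑ a : ZMod K, {((t, a), (u, a + d), x)}

/-- The vertices at level `t`. -/
def level (K : ℕ) (t : ℤ) : Set (Cyl K) := {v | v.1 = t}

theorem avoids_rung {t u s : ℤ} (d : ZMod K) (x : ℝ) (ht : t ≠ s) (hu : u ≠ s) :
    Avoids (rung K t u d x) (level K s) := by
  refine avoids_sum fun a _ e he => ?_
  obtain rfl := Multiset.mem_singleton.1 he
  exact ⟨ht, hu⟩

theorem avg_rung_symm (t u : ℤ) (d : ZMod K) (x : ℝ) :
    avg (rung K t u d x) = avg (rung K u t (-d) x) := by
  have h1 : rung K u t (-d) x = ∑ a : ZMod K, {((u, a + d), (t, a), x)} := by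
    refine (Equiv.sum_comp (Equiv.addRight d) _).symm.trans ?_
    simp
  rw [h1]
  unfold rung
  funext f
  generalize (Finset.univ : Finset (ZMod K)) = s
  classical
  induction s using Finset.induction_on with
  | empty => simp
  | insert a s ha ih =>
    rw [Finset.sum_insert ha, Finset.sum_insert ha, Multiset.singleton_add,
      Multiset.singleton_add, avg_symm, avg_cons, ih, ← avg_cons]

theorem avg_rung_zero (t u : ℤ) (d : ZMod K) (f : Setoid (Cyl K) → ℝ) :
    avg (rung K t u d 0) f = f := by
  have := avg_drop_sum (m := 0) (f := f) Finset.univ (fun a : ZMod K => (t, a)) fun a => (u, a + d)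
  rwa [zero_add, avg_zero] at this

theorem avg_comm {V : Type*} (m m' : Multiset (V × V × ℝ)) (f : Setoid V → ℝ) :
    avg m (avg m' f) = avg m' (avg m f) := by
  rw [← avg_add, add_comm, avg_add]

theorem avg_rung_move (o u : ℤ) (d : ZMod K) (x : ℝ) (f : Setoid (Cyl K) → ℝ) :
    avg (rung K o u 0 1) (avg (rung K o o d x) f) =
      avg (rung K o u 0 1) (avg (rung K u u d x) f) := by
  rw [avg_comm, avg_comm (rung K o u 0 1), avg_comm, avg_comm (rung K u u d x), ← avg_add,
    ← avg_add]
  refine avg_move_sum Finset.univ _ _ _ _ (fun _ => x) fun a _ => ⟨?_, ?_⟩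
  · exact Multiset.mem_sum.2 ⟨a, Finset.mem_univ _, by simp⟩
  · exact Multiset.mem_sum.2 ⟨a + d, Finset.mem_univ _, by simp⟩

theorem insens_singleton {f : Setoid (Cyl K) → ℝ} {t : ℤ} (h : Insens (level K t) f) (a : ZMod K) :
    Insens {(t, a)} f := h.mono fun v hv => by
  rw [mem_singleton_iff.1 hv]
  rfl

theorem avoids_singleton {R : Multiset (Cyl K × Cyl K × ℝ)} {t : ℤ} (h : Avoids R (level K t))
    (a : ZMod K) : Avoids R {(t, a)} := h.mono fun v hv => by
  rw [mem_singleton_iff.1 hv]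
  rfl

theorem rung_shift (t u : ℤ) (d e : ZMod K) (x : ℝ) :
    rung K t u (e - d) x = ∑ a : ZMod K, {((t, a + d), (u, a + e), x)} := by
  refine (Equiv.sum_comp (Equiv.addRight d) _).symm.trans ?_
  refine Finset.sum_congr rfl fun a _ => ?_
  rw [Equiv.coe_addRight, add_assoc, add_sub_cancel]

variable {R : Multiset (Cyl K × Cyl K × ℝ)} {f : Setoid (Cyl K) → ℝ}

theorem avg_rung_contract {o u v w : ℤ} (hu : u ≠ o) (hv : v ≠ o) (hw : w ≠ o)
    (hR : Avoids R (level K o)) (hf : Insens (level K o) f) (d d₁ d₂ : ZMod K) (x y : ℝ) :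
    avg (rung K o u d 1 + rung K o v d₁ x + rung K o w d₂ y + R) f ⊥ =
      avg (rung K u v (d₁ - d) x + rung K u w (d₂ - d) y + R) f ⊥ := by
  have h1 : rung K o u d 1 + rung K o v d₁ x + rung K o w d₂ y =
      ∑ a : ZMod K, {((o, a), (u, a + d), 1), ((o, a), (v, a + d₁), x), ((o, a), (w, a + d₂), y)} := by
    unfold rung
    rw [← Finset.sum_add_distrib, ← Finset.sum_add_distrib]
    rfl
  have h2 : rung K u v (d₁ - d) x + rung K u w (d₂ - d) y =
      ∑ a : ZMod K, {((u, a + d), (v, a + d₁), x), ((u, a + d), (w, a + d₂), y)} := by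
    rw [rung_shift, rung_shift, ← Finset.sum_add_distrib]
    rfl
  rw [h1, h2]
  refine avg_replace Finset.univ (fun a => (o, a)) _ _ (fun a _ R hR hf => ?_) (fun a _ b _ hab => ?_)
    (fun a _ b _ => ?_) (fun a _ => avoids_singleton hR a) fun a _ => insens_singleton hf a
  · exact avg_contract (by simp [hv]) (by simp [hw]) (by simp [hu]) hR hf x y
  · intro e he
    simp only [Multiset.insert_eq_cons, Multiset.mem_cons, Multiset.mem_singleton] at he
    rcases he with rfl | rfl | rfl <;> simp [hab, hu, hv, hw]
  · intro e he
    simp only [Multiset.insert_eq_cons, Multiset.mem_cons, Multiset.mem_singleton] at he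
    rcases he with rfl | rfl <;> simp [hu, hv, hw]

theorem avg_rung_star {o u v w : ℤ} (hu : u ≠ o) (hv : v ≠ o) (hw : w ≠ o)
    (hR : Avoids R (level K o)) (hf : Insens (level K o) f) (d d₁ d₂ : ZMod K) {x y z : ℝ}
    (hk : kappaT x y z = 0) :
    avg (rung K o u d (1 - x) + rung K o v d₁ (1 - y) + rung K o w d₂ (1 - z) + R) f ⊥ =
      avg (rung K v w (d₂ - d₁) x + rung K u w (d₂ - d) y + rung K u v (d₁ - d) z + R) f ⊥ := by
  have h1 : rung K o u d (1 - x) + rung K o v d₁ (1 - y) + rung K o w d₂ (1 - z) =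
      ∑ a : ZMod K, {((o, a), (u, a + d), 1 - x), ((o, a), (v, a + d₁), 1 - y),
        ((o, a), (w, a + d₂), 1 - z)} := by
    unfold rung
    rw [← Finset.sum_add_distrib, ← Finset.sum_add_distrib]
    rfl
  have h2 : rung K v w (d₂ - d₁) x + rung K u w (d₂ - d) y + rung K u v (d₁ - d) z =
      ∑ a : ZMod K, {((v, a + d₁), (w, a + d₂), x), ((u, a + d), (w, a + d₂), y),
        ((u, a + d), (v, a + d₁), z)} := by
    rw [rung_shift, rung_shift, rung_shift, ← Finset.sum_add_distrib, ← Finset.sum_add_distrib]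
    rfl
  rw [h1, h2]
  refine avg_replace Finset.univ (fun a => (o, a)) _ _ (fun a _ R hR hf => ?_) (fun a _ b _ hab => ?_)
    (fun a _ b _ => ?_) (fun a _ => avoids_singleton hR a) fun a _ => insens_singleton hf a
  · exact avg_star (by simp [hu]) (by simp [hv]) (by simp [hw]) hR hf hk
  · intro e he
    simp only [Multiset.insert_eq_cons, Multiset.mem_cons, Multiset.mem_singleton] at he
    rcases he with rfl | rfl | rfl <;> simp [hab, hu, hv, hw]
  · intro e he
    simp only [Multiset.insert_eq_cons, Multiset.mem_cons, Multiset.mem_singleton] at he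
    rcases he with rfl | rfl | rfl <;> simp [hu, hv, hw]

/-- A layer of edges: those with probability `up` go straight up, those with probability `side`
go along the level or (if `diag`) diagonally up. -/
structure Letter where
  diag : Bool
  up : ℝ
  side : ℝ

/-- The edges of a layer starting at level `t`. -/
def layer (K : ℕ) [NeZero K] (t : ℤ) (c : Letter) : Multiset (Cyl K × Cyl K × ℝ) :=
  rung K t (t + 1) 0 c.up + if c.diag then rung K t (t + 1) (-1) c.side else rung K t t 1 c.side

/-- The layers of horizontal and vertical edges of the square lattice. -/
def sqLetter (p : ℝ) (s : Bool) : Letter := if s then ⟨false, 1, p⟩ else ⟨false, 1 - p, 0⟩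

/-- The layer of slanted edges of the triangular lattice. -/
def slantLetter (b : ℝ × ℝ) : Letter := ⟨true, b.2, b.1⟩

theorem avoids_layer {t s : ℤ} (c : Letter) (ht : t ≠ s) (hu : t + 1 ≠ s) :
    Avoids (layer K t c) (level K s) := by
  unfold layer
  split_ifs
  · exact (avoids_rung _ _ ht hu).add (avoids_rung _ _ ht hu)
  · exact (avoids_rung _ _ ht hu).add (avoids_rung _ _ ht ht)

theorem avg_slant_horizontal {p l r : ℝ} (hk : kappaT p l r = 0) (t : ℤ)
    (hR : Avoids R (level K (t + 1))) (hf : Insens (level K (t + 1)) f) :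
    avg (layer K t (slantLetter (l, r)) + layer K (t + 1) (sqLetter p true) + R) f ⊥ =
      avg (layer K t (sqLetter p false) + layer K (t + 1) (slantLetter (1 - r, 1 - l)) + R) f ⊥ := by
  have key : avg (rung K (t + 1) (t + 1 + 1) 0 1 + rung K (t + 1) t 0 r + rung K (t + 1) t 1 l +
        (rung K (t + 1 + 1) (t + 1 + 1) 1 p + R)) f ⊥ =
      avg (rung K (t + 1) t 0 (1 - p) + rung K (t + 1) (t + 1 + 1) 0 (1 - l) +
        rung K (t + 1) (t + 1 + 1) (-1) (1 - r) + R) f ⊥ := by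
    rw [avg_rung_contract (by simp) (by simp) (by simp) ((avoids_rung _ _ (by simp) (by simp)).add hR)
      hf, avg_rung_star (by simp) (by simp) (by simp) hR hf _ _ _ hk]
    simp only [avg_add]
    rw [avg_rung_symm t _ _ l, avg_rung_symm t _ _ r,
      avg_rung_symm (t + 1 + 1) (t + 1 + 1) (-1 - 0) p]
    simp only [sub_zero, neg_zero, neg_neg]
    rw [avg_comm (rung K (t + 1 + 1) (t + 1 + 1) 1 p) (rung K (t + 1 + 1) t 1 l),
      avg_comm (rung K (t + 1 + 1) (t + 1 + 1) 1 p) (rung K (t + 1 + 1) t 0 r),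
      avg_comm (rung K (t + 1 + 1) t 1 l) (rung K (t + 1 + 1) t 0 r)]
  unfold layer sqLetter slantLetter
  simp only [if_true, if_false, Bool.false_eq_true, avg_add] at key ⊢
  rw [avg_rung_zero, avg_rung_move]
  rw [avg_rung_symm t (t + 1) (-1), avg_rung_symm t (t + 1) 0, avg_rung_symm t (t + 1) 0]
  simp only [neg_zero, neg_neg]
  rw [← key, avg_comm (rung K (t + 1) t 1 l), avg_comm (rung K (t + 1) t 0 r)]

theorem avg_slant_vertical {p l r : ℝ} (hk : kappaT p (1 - r) (1 - l) = 0) (t : ℤ)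
    (hR : Avoids R (level K (t + 1))) (hf : Insens (level K (t + 1)) f) :
    avg (layer K t (slantLetter (l, r)) + layer K (t + 1) (sqLetter p false) + R) f ⊥ =
      avg (layer K t (sqLetter p true) + layer K (t + 1) (slantLetter (1 - r, 1 - l)) + R) f ⊥ := by
  have hk' : kappaT (1 - r) (1 - l) p = 0 := by
    rw [← hk]
    unfold kappaT
    ring
  have key : avg (rung K (t + 1) t 0 (1 - (1 - r)) + rung K (t + 1) t 1 (1 - (1 - l)) +
        rung K (t + 1) (t + 1 + 1) 0 (1 - p) + R) f ⊥ =
      avg (rung K (t + 1) t 0 1 + rung K (t + 1) (t + 1 + 1) 0 (1 - l) +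
        rung K (t + 1) (t + 1 + 1) (-1) (1 - r) + (rung K t t 1 p + R)) f ⊥ := by
    rw [avg_rung_contract (by simp) (by simp) (by simp) ((avoids_rung _ _ (by simp) (by simp)).add hR)
      hf, avg_rung_star (by simp) (by simp) (by simp) hR hf _ _ _ hk']
    simp only [avg_add]
    simp only [sub_zero, zero_sub]
    rw [avg_comm]
  unfold layer sqLetter slantLetter
  simp only [if_true, if_false, Bool.false_eq_true, avg_add, sub_sub_cancel] at key ⊢
  rw [avg_rung_zero, avg_rung_symm t (t + 1) (-1), avg_rung_symm t (t + 1) 0,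
    avg_rung_symm t (t + 1) 0]
  simp only [neg_zero, neg_neg]
  rw [key, avg_comm (rung K t t 1 p) (rung K (t + 1) (t + 1 + 1) 0 (1 - l)),
    avg_comm (rung K t t 1 p) (rung K (t + 1) (t + 1 + 1) (-1) (1 - r))]

end Cylinder

section Words

variable {K : ℕ} [NeZero K]

/-- The edges of successive layers, starting at level `t`. -/
def word (K : ℕ) [NeZero K] : ℤ → List Letter → Multiset (Cyl K × Cyl K × ℝ)
  | _, [] => 0
  | t, c :: w => layer K t c + word K (t + 1) w

theorem word_append (t : ℤ) (w w' : List Letter) :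
    word K t (w ++ w') = word K t w + word K (t + w.length) w' := by
  induction w generalizing t with
  | nil => simp [word]
  | cons c w ih =>
    simp only [word, List.cons_append, ih, List.length_cons, Nat.cast_add, Nat.cast_one, add_assoc]
    rw [add_comm (1 : ℤ)]

theorem avoids_word {t s : ℤ} {w : List Letter} (h : s < t ∨ t + w.length < s) :
    Avoids (word K t w) (level K s) := by
  induction w generalizing t with
  | nil => intro e he; simp [word] at he
  | cons c w ih =>
    simp only [List.length_cons, Nat.cast_add, Nat.cast_one] at h
    exact (avoids_layer c (by omega) (by omega)).add (ih (by omega))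

/-- Two words have the same law if exchanging them leaves the connectivity outside the
interior levels unchanged. -/
def SameLaw (K : ℕ) [NeZero K] (w w' : List Letter) : Prop :=
  w.length = w'.length ∧ ∀ (t : ℤ) (R : Multiset (Cyl K × Cyl K × ℝ)) (f : Setoid (Cyl K) → ℝ),
    (∀ s, t < s → s < t + w.length → Avoids R (level K s) ∧ Insens (level K s) f) →
    avg (word K t w + R) f ⊥ = avg (word K t w' + R) f ⊥

namespace SameLaw

variable {w w' w'' : List Letter}

theorem refl (w : List Letter) : SameLaw K w w := ⟨rfl, fun _ _ _ _ => rfl⟩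

theorem trans (h : SameLaw K w w') (h' : SameLaw K w' w'') : SameLaw K w w'' :=
  ⟨h.1.trans h'.1, fun t R f hR => (h.2 t R f hR).trans (h'.2 t R f (h.1 ▸ hR))⟩

theorem symm (h : SameLaw K w w') : SameLaw K w' w :=
  ⟨h.1.symm, fun t R f hR => (h.2 t R f (h.1 ▸ hR)).symm⟩

theorem cons (c : Letter) (h : SameLaw K w w') : SameLaw K (c :: w) (c :: w') := by
  refine ⟨by simp [h.1], fun t R f hR => ?_⟩
  have := h.2 (t + 1) (layer K t c + R) f fun s hs hs' => by
    have := hR s (by omega) (by simp; omega)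
    exact ⟨(avoids_layer c (by omega) (by omega)).add this.1, this.2⟩
  rw [word, word, add_comm (layer K t c), add_comm (layer K t c), add_assoc, add_assoc, this]

theorem append_right (v : List Letter) (h : SameLaw K w w') : SameLaw K (w ++ v) (w' ++ v) := by
  refine ⟨by simp [h.1], fun t R f hR => ?_⟩
  rw [word_append, word_append, add_assoc, add_assoc, ← h.1]
  refine h.2 _ _ _ fun s hs hs' => ?_
  have := hR s hs (by simp; omega)
  exact ⟨(avoids_word (by omega)).add this.1, this.2⟩

theorem append_left (v : List Letter) (h : SameLaw K w w') : SameLaw K (v ++ w) (v ++ w') := by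
  induction v with
  | nil => exact h
  | cons c v ih => exact ih.cons c

end SameLaw

/-- The slanted layer `b` may be exchanged with the square layer `sqLetter p s`. -/
def Fits (p : ℝ) (s : Bool) (b : ℝ × ℝ) : Prop :=
  (b.1 ∈ Icc (0 : ℝ) 1 ∧ b.2 ∈ Icc (0 : ℝ) 1) ∧
    if s then kappaT p b.1 b.2 = 0 else kappaT p (1 - b.2) (1 - b.1) = 0

theorem Fits.flip {p : ℝ} {s : Bool} {b : ℝ × ℝ} (h : Fits p s b) :
    Fits p (!s) (1 - b.2, 1 - b.1) := by
  obtain ⟨⟨⟨h1, h2⟩, h3, h4⟩, h⟩ := h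
  refine ⟨⟨⟨?_, ?_⟩, ?_, ?_⟩, ?_⟩
  · simp; linarith
  · simp; linarith
  · simp; linarith
  · simp; linarith
  · cases s <;> simpa using h

theorem sameLaw_swap {p : ℝ} {s : Bool} {b : ℝ × ℝ} (h : Fits p s b) :
    SameLaw K [slantLetter b, sqLetter p s] [sqLetter p (!s), slantLetter (1 - b.2, 1 - b.1)] := by
  refine ⟨rfl, fun t R f hR => ?_⟩
  obtain ⟨hR', hf⟩ := hR (t + 1) (by simp) (by simp)
  have hk := h.2
  simp only [word, add_zero]
  cases s
  · exact avg_slant_vertical (by simpa using hk) t hR' hf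
  · exact avg_slant_horizontal (by simpa using hk) t hR' hf

theorem sameLaw_swap_back {p : ℝ} {s : Bool} {b : ℝ × ℝ} (h : Fits p s b) :
    SameLaw K [sqLetter p s, slantLetter b] [slantLetter (1 - b.2, 1 - b.1), sqLetter p (!s)] := by
  have := (sameLaw_swap (K := K) h.flip).symm
  simpa using this

/-- Alternating square layers, the first one being `s`. -/
def altFirst (p : ℝ) : Bool → ℕ → List Letter
  | _, 0 => []
  | s, n + 1 => sqLetter p s :: altFirst p (!s) n

/-- Alternating square layers, the last one being `s`. -/
def altLast (p : ℝ) : Bool → ℕ → List Letter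
  | _, 0 => []
  | s, n + 1 => altLast p (!s) n ++ [sqLetter p s]

variable {p : ℝ}

theorem altFirst_length (s : Bool) (n : ℕ) : (altFirst p s n).length = n := by
  induction n generalizing s with
  | zero => rfl
  | succ n ih => simp [altFirst, ih]

theorem altLast_length (s : Bool) (n : ℕ) : (altLast p s n).length = n := by
  induction n generalizing s with
  | zero => rfl
  | succ n ih => simp [altLast, ih]

theorem sameLaw_push (s : Bool) (n : ℕ) {b : ℝ × ℝ} (h : Fits p s b) :
    ∃ s' b', Fits p s' b' ∧
      SameLaw K (slantLetter b :: altFirst p s n) (altFirst p (!s) n ++ [slantLetter b']) := by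
  induction n generalizing s b with
  | zero => exact ⟨s, b, h, .refl _⟩
  | succ n ih =>
    obtain ⟨s', b', h', hS⟩ := ih (!s) h.flip
    exact ⟨s', b', h', ((sameLaw_swap h).append_right (altFirst p (!s) n)).trans (hS.cons _)⟩

theorem sameLaw_push_back (s : Bool) (n : ℕ) {b : ℝ × ℝ} (h : Fits p s b) :
    ∃ s' b', Fits p s' b' ∧
      SameLaw K (altLast p s n ++ [slantLetter b]) (slantLetter b' :: altLast p (!s) n) := by
  induction n generalizing s b with
  | zero => exact ⟨s, b, h, .refl _⟩
  | succ n ih =>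
    obtain ⟨s', b', h', hS⟩ := ih (!s) h.flip
    refine ⟨s', b', h', ?_⟩
    have := ((sameLaw_swap_back h).append_left (altLast p (!s) n)).trans
      (by simpa using hS.append_right [sqLetter p (!s)])
    simpa [altLast] using this

/-- The layers of the triangular lattice from row `b` to row `b + n`. -/
def triWord (p : ℝ) (β : ℤ → ℝ × ℝ) : ℤ → ℕ → List Letter
  | _, 0 => []
  | b, n + 1 => sqLetter p true :: slantLetter (β b) :: triWord p β (b + 1) n

theorem triWord_length (β : ℤ → ℝ × ℝ) (b : ℤ) (n : ℕ) : (triWord p β b n).length = 2 * n := by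
  induction n generalizing b with
  | zero => rfl
  | succ n ih => simp [triWord, ih]; ring

theorem triWord_succ (β : ℤ → ℝ × ℝ) (b : ℤ) (n : ℕ) :
    triWord p β b (n + 1) = triWord p β b n ++ [sqLetter p true, slantLetter (β (b + n))] := by
  induction n generalizing b with
  | zero => simp [triWord]
  | succ n ih =>
    rw [triWord, ih, triWord]
    simp only [List.cons_append, Nat.cast_add, Nat.cast_one]
    rw [add_assoc b, add_comm (1 : ℤ)]

theorem sameLaw_triWord {β : ℤ → ℝ × ℝ} (hβ : ∀ b, Fits p true (β b)) (b : ℤ) (n : ℕ) :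
    ∃ B : List (ℝ × ℝ), B.length = n ∧ (∀ x ∈ B, ∃ s, Fits p s x) ∧
      SameLaw K (triWord p β b n) (altFirst p true n ++ B.map slantLetter) := by
  induction n generalizing b with
  | zero => exact ⟨[], rfl, by simp, .refl _⟩
  | succ n ih =>
    obtain ⟨B, hB, hf, hS⟩ := ih (b + 1)
    obtain ⟨s', b', h', hS'⟩ := sameLaw_push (K := K) true n (hβ b)
    refine ⟨b' :: B, by simp [hB], ?_, ?_⟩
    · intro x hx
      rcases List.mem_cons.1 hx with rfl | hx
      · exact ⟨s', h'⟩
      · exact hf x hx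
    · refine ((hS.cons (slantLetter (β b))).cons (sqLetter p true)).trans ?_
      have := (hS'.append_right (B.map slantLetter)).cons (sqLetter p true)
      simpa [altFirst] using this

theorem sameLaw_triWord_back {β : ℤ → ℝ × ℝ} (hβ : ∀ b, Fits p true (β b)) (b : ℤ) (n : ℕ) :
    ∃ B : List (ℝ × ℝ), B.length = n ∧ (∀ x ∈ B, ∃ s, Fits p s x) ∧
      SameLaw K (triWord p β b n) (B.map slantLetter ++ altLast p false n) := by
  induction n with
  | zero => exact ⟨[], rfl, by simp, .refl _⟩
  | succ n ih =>
    obtain ⟨B, hB, hf, hS⟩ := ih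
    obtain ⟨s', b', h', hS'⟩ := sameLaw_push_back (K := K) false n (hβ (b + n)).flip
    refine ⟨B ++ [b'], by simp [hB], ?_, ?_⟩
    · intro x hx
      rcases List.mem_append.1 hx with hx | hx
      · exact hf x hx
      · rw [List.mem_singleton.1 hx]
        exact ⟨s', h'⟩
    · rw [triWord_succ]
      refine (hS.append_right _).trans ?_
      have h1 := (sameLaw_swap_back (K := K) (hβ (b + n))).append_left
        (B.map slantLetter ++ altLast p false n)
      have h2 := (hS'.append_right [sqLetter p false]).append_left (B.map slantLetter)
      refine h1.trans ?_
      simpa [altLast] using h2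

end Words

section Cylinder

variable {K : ℕ} [NeZero K] {p : ℝ}

theorem word_eq_sum {t : ℤ} {w : List Letter} {c : ℤ → Letter}
    (h : ∀ (i : ℕ) (hi : i < w.length), w[i] = c (t + i)) :
    word K t w = ∑ s ∈ Finset.Ico t (t + w.length), layer K s (c s) := by
  induction w generalizing t with
  | nil => simp [word]
  | cons a w ih =>
    have h0 := h 0 (by simp)
    have h1 := @ih (t + 1) fun i hi => by
      have := h (i + 1) (by simpa using hi)
      simp only [List.getElem_cons_succ] at this
      rw [this]
      congr 1
      push_cast
      ring
    simp only [List.getElem_cons_zero, Nat.cast_zero, add_zero] at h0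
    have h2 : Finset.Ico t (t + ((a :: w).length : ℕ)) =
        insert t (Finset.Ico (t + 1) (t + 1 + (w.length : ℕ))) := by
      ext s
      simp only [Finset.mem_Ico, Finset.mem_insert, List.length_cons]
      push_cast
      omega
    rw [word, h1, h2, Finset.sum_insert (by simp), h0]

/-- The layers of the triangular lattice. -/
noncomputable def triLetter (p : ℝ) (β : ℤ → ℝ × ℝ) (s : ℤ) : Letter :=
  if s % 2 = 0 then sqLetter p true else slantLetter (β (s / 2))

theorem triWord_getElem (β : ℤ → ℝ × ℝ) (b : ℤ) (n i : ℕ) (hi : i < (triWord p β b n).length) :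
    (triWord p β b n)[i] = triLetter p β (2 * b + i) := by
  induction n generalizing b i with
  | zero => simp [triWord] at hi
  | succ n ih =>
    match i with
    | 0 => simp [triWord, triLetter]
    | 1 =>
      simp only [triWord, triLetter, List.getElem_cons_succ, List.getElem_cons_zero, Nat.cast_one]
      rw [if_neg (by omega), show (2 * b + 1) / 2 = b by omega]
    | i + 2 =>
      simp only [triWord, List.getElem_cons_succ]
      rw [ih]
      congr 1
      push_cast
      ring

theorem altFirst_getElem (s : Bool) (n i : ℕ) (hi : i < (altFirst p s n).length) :
    (altFirst p s n)[i] = sqLetter p (if i % 2 = 0 then s else !s) := by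
  induction n generalizing s i with
  | zero => simp [altFirst] at hi
  | succ n ih =>
    cases i with
    | zero => simp [altFirst]
    | succ i =>
      simp only [altFirst, List.getElem_cons_succ]
      rw [ih]
      congr 1
      rcases Nat.mod_two_eq_zero_or_one i with h | h
      · rw [if_pos h, if_neg (by omega)]
      · rw [if_neg (by omega), if_pos (by omega), Bool.not_not]

theorem altLast_getElem (s : Bool) (n i : ℕ) (hi : i < (altLast p s n).length) :
    (altLast p s n)[i] = sqLetter p (if (n - i) % 2 = 1 then s else !s) := by
  induction n generalizing s with
  | zero => simp [altLast] at hi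
  | succ n ih =>
    have hi' : i < n + 1 := by simpa [altLast_length] using hi
    simp only [altLast]
    rcases Nat.lt_succ_iff_lt_or_eq.1 hi' with h | rfl
    · rw [List.getElem_append_left (by simpa [altLast_length] using h), ih]
      congr 1
      rcases Nat.mod_two_eq_zero_or_one (n - i) with h | h
      · rw [if_neg (by omega), if_pos (by omega), Bool.not_not]
      · rw [if_pos h, if_neg (by omega)]
    · rw [List.getElem_append_right (by simp [altLast_length])]
      simp [altLast_length]

theorem sum_Ico_eq_add {M : Type*} [AddCommMonoid M] (g : ℤ → M) {a b c : ℤ} (h : a ≤ b)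
    (h' : b ≤ c) :
    ∑ s ∈ Finset.Ico a c, g s = ∑ s ∈ Finset.Ico a b, g s + ∑ s ∈ Finset.Ico b c, g s := by
  rw [← Finset.sum_union (Finset.Ico_disjoint_Ico_consecutive a b c),
    Finset.Ico_union_Ico_eq_Ico h h']

/-- The layers of a cylinder of the triangular lattice may be rearranged so that those near level
zero form a square lattice. -/
theorem exists_square_layers {β : ℤ → ℝ × ℝ} (hp : p ∈ Icc (0 : ℝ) 1)
    (hβ : ∀ b, Fits p true (β b)) (n : ℕ) :
    ∃ c : ℤ → Letter, (∀ s : ℤ, -(n : ℤ) ≤ s → s < n → c s = sqLetter p (decide (s % 2 = 0))) ∧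
      (∀ s, (c s).up ∈ Icc (0 : ℝ) 1 ∧ (c s).side ∈ Icc (0 : ℝ) 1) ∧
      ∀ f : Setoid (Cyl K) → ℝ,
        (∀ s : ℤ, s ≠ 0 → -(2 * n) < s → s < 2 * n → Insens (level K s) f) →
        avg (∑ s ∈ Finset.Ico (-(2 * n) : ℤ) (2 * n), layer K s (triLetter p β s)) f ⊥ =
          avg (∑ s ∈ Finset.Ico (-(2 * n) : ℤ) (2 * n), layer K s (c s)) f ⊥ := by
  obtain ⟨B, hB, hBf, hS⟩ := sameLaw_triWord (K := K) hβ 0 n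
  obtain ⟨B', hB', hBf', hS'⟩ := sameLaw_triWord_back (K := K) hβ (-n) n
  set wu := altFirst p true n ++ B.map slantLetter with hwu
  set wl := B'.map slantLetter ++ altLast p false n with hwl
  have hlu : wu.length = 2 * n := by simp [hwu, altFirst_length, hB]; ring
  have hll : wl.length = 2 * n := by simp [hwl, altLast_length, hB']; ring
  have hsq : ∀ s, (sqLetter p s).up ∈ Icc (0 : ℝ) 1 ∧ (sqLetter p s).side ∈ Icc (0 : ℝ) 1 := by
    intro s
    obtain ⟨h1, h2⟩ := hp
    cases s
    · simpa [sqLetter] using ⟨h2, h1⟩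
    · simpa [sqLetter] using ⟨h1, h2⟩
  refine ⟨fun s => if s < 0 then wl.getD (s + 2 * n).toNat (sqLetter p true)
    else wu.getD s.toNat (sqLetter p true), ?_, ?_, ?_⟩
  · intro s hs hs'
    dsimp only
    split_ifs with h
    · rw [List.getD_eq_getElem _ _ (by omega)]
      simp only [hwl]
      rw [List.getElem_append_right (by simp [hB']; omega), altLast_getElem]
      congr 1
      simp only [List.length_map, hB']
      by_cases h2 : s % 2 = 0
      · rw [if_neg (by omega)]; simp [h2]
      · rw [if_pos (by omega)]; simp [h2]
    · rw [List.getD_eq_getElem _ _ (by omega)]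
      simp only [hwu]
      rw [List.getElem_append_left (by simp [altFirst_length]; omega), altFirst_getElem]
      congr 1
      by_cases h2 : s % 2 = 0
      · rw [if_pos (by omega)]; simp [h2]
      · rw [if_neg (by omega)]; simp [h2]
  · have hmem : ∀ (w : List Letter) (i : ℕ),
        (∀ x ∈ w, x.up ∈ Icc (0 : ℝ) 1 ∧ x.side ∈ Icc (0 : ℝ) 1) →
        (w.getD i (sqLetter p true)).up ∈ Icc (0 : ℝ) 1 ∧
          (w.getD i (sqLetter p true)).side ∈ Icc (0 : ℝ) 1 := by
      intro w i hw
      by_cases h : i < w.length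
      · rw [List.getD_eq_getElem _ _ h]
        exact hw _ (List.getElem_mem h)
      · rw [List.getD_eq_default _ _ (by omega)]
        exact hsq true
    have hslant : ∀ b, (∃ s, Fits p s b) →
        (slantLetter b).up ∈ Icc (0 : ℝ) 1 ∧ (slantLetter b).side ∈ Icc (0 : ℝ) 1 :=
      fun b ⟨s, h⟩ => ⟨h.1.2, h.1.1⟩
    have hF : ∀ s k, ∀ x ∈ altFirst p s k, x.up ∈ Icc (0 : ℝ) 1 ∧ x.side ∈ Icc (0 : ℝ) 1 := by
      intro s k x hx
      obtain ⟨i, hi, rfl⟩ := List.mem_iff_getElem.1 hx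
      rw [altFirst_getElem]
      exact hsq _
    have hL : ∀ s k, ∀ x ∈ altLast p s k, x.up ∈ Icc (0 : ℝ) 1 ∧ x.side ∈ Icc (0 : ℝ) 1 := by
      intro s k x hx
      obtain ⟨i, hi, rfl⟩ := List.mem_iff_getElem.1 hx
      rw [altLast_getElem]
      exact hsq _
    intro s
    dsimp only
    split_ifs with h
    · refine hmem _ _ fun x hx => ?_
      rcases List.mem_append.1 hx with hx | hx
      · obtain ⟨b, hb, rfl⟩ := List.mem_map.1 hx
        exact hslant b (hBf' b hb)
      · exact hL _ _ x hx
    · refine hmem _ _ fun x hx => ?_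
      rcases List.mem_append.1 hx with hx | hx
      · exact hF _ _ x hx
      · obtain ⟨b, hb, rfl⟩ := List.mem_map.1 hx
        exact hslant b (hBf b hb)
  · intro f hf
    have e1 : word K (-(2 * n)) (triWord p β (-n) n) =
        ∑ s ∈ Finset.Ico (-(2 * n) : ℤ) 0, layer K s (triLetter p β s) := by
      rw [word_eq_sum (c := triLetter p β), triWord_length]
      · congr 2; push_cast; ring
      · intro i hi
        rw [triWord_getElem]
        congr 1; ring
    have e2 : word K 0 (triWord p β 0 n) =
        ∑ s ∈ Finset.Ico (0 : ℤ) (2 * n), layer K s (triLetter p β s) := by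
      rw [word_eq_sum (c := triLetter p β), triWord_length]
      · congr 2; push_cast; ring
      · intro i hi
        rw [triWord_getElem]
        congr 1
    have e3 : word K (-(2 * n)) wl = ∑ s ∈ Finset.Ico (-(2 * n) : ℤ) 0, layer K s
        (if s < 0 then wl.getD (s + 2 * n).toNat (sqLetter p true)
          else wu.getD s.toNat (sqLetter p true)) := by
      rw [word_eq_sum (c := fun s => if s < 0 then wl.getD (s + 2 * n).toNat (sqLetter p true)
          else wu.getD s.toNat (sqLetter p true)), hll]
      · congr 2; push_cast; ring
      · intro i hi
        rw [if_pos (by omega), show (-(2 * n : ℤ) + i + 2 * n).toNat = i by omega,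
          List.getD_eq_getElem _ _ hi]
    have e4 : word K 0 wu = ∑ s ∈ Finset.Ico (0 : ℤ) (2 * n), layer K s
        (if s < 0 then wl.getD (s + 2 * n).toNat (sqLetter p true)
          else wu.getD s.toNat (sqLetter p true)) := by
      rw [word_eq_sum (c := fun s => if s < 0 then wl.getD (s + 2 * n).toNat (sqLetter p true)
          else wu.getD s.toNat (sqLetter p true)), hlu]
      · congr 2; push_cast; ring
      · intro i hi
        rw [if_neg (by omega), show ((0 : ℤ) + i).toNat = i by omega, List.getD_eq_getElem _ _ hi]
    rw [sum_Ico_eq_add _ (b := 0) (by omega) (by omega),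
      sum_Ico_eq_add (fun s => layer K s (ite _ _ _)) (b := 0) (by omega) (by omega),
      ← e1, ← e2, ← e3, ← e4]
    have l1 := triWord_length (p := p) β (-n) n
    have l2 := triWord_length (p := p) β 0 n
    rw [hS'.2 (-(2 * n)) (word K 0 (triWord p β 0 n)) f, add_comm,
      hS.2 0 (word K (-(2 * n)) wl) f, add_comm]
    · intro s hs hs'
      rw [l2] at hs'
      exact ⟨avoids_word (Or.inr (by rw [hll]; push_cast; omega)), hf s (by omega) (by omega)
        (by push_cast at hs'; omega)⟩
    · intro s hs hs'
      rw [l1] at hs'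
      push_cast at hs'
      exact ⟨avoids_word (Or.inl (by omega)), hf s (by omega) (by omega) (by omega)⟩

end Cylinder

section Graphs

/-- The square lattice as a graph on `ℤ × ℤ`. -/
def sqG (e : SqE) : (ℤ × ℤ) × (ℤ × ℤ) :=
  ((e.1, e.2.1), if e.2.2 then (e.1 + 1, e.2.1) else (e.1, e.2.1 + 1))

def sqInc (v : ℤ × ℤ) : Finset SqE :=
  {(v.1, v.2, true), (v.1 - 1, v.2, true), (v.1, v.2, false), (v.1, v.2 - 1, false)}

theorem isInc_sq : IsInc sqG sqInc := by
  rintro ⟨x, y⟩ ⟨a, b, i⟩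
  cases i <;> simp [sqG, sqInc] <;> omega

/-- The box of radius `R` about the origin. -/
noncomputable def box (R : ℕ) : Finset (ℤ × ℤ) := Finset.Icc (-R : ℤ) R ×ˢ Finset.Icc (-R : ℤ) R

theorem mem_box {R : ℕ} {v : ℤ × ℤ} :
    v ∈ box R ↔ -(R : ℤ) ≤ v.1 ∧ v.1 ≤ R ∧ -(R : ℤ) ≤ v.2 ∧ v.2 ≤ R := by
  simp [box, and_assoc]

theorem zero_mem_box (R : ℕ) : ((0, 0) : ℤ × ℤ) ∈ box R := mem_box.2 (by simp)

/-- The triangular lattice as a graph on `ℤ × ℤ`. -/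
def triG (e : TriE) : (ℤ × ℤ) × (ℤ × ℤ) :=
  if e.2.2 = 0 then ((e.1, e.2.1), (e.1 + 1, e.2.1))
  else if e.2.2 = 1 then ((e.1 + 1, e.2.1), (e.1, e.2.1 + 1))
  else ((e.1, e.2.1), (e.1, e.2.1 + 1))

def triInc (v : ℤ × ℤ) : Finset TriE :=
  {(v.1, v.2, 0), (v.1 - 1, v.2, 0), (v.1 - 1, v.2, 1), (v.1, v.2 - 1, 1), (v.1, v.2, 2),
    (v.1, v.2 - 1, 2)}

theorem isInc_tri : IsInc triG triInc := by
  rintro ⟨x, y⟩ ⟨a, b, i⟩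
  fin_cases i <;> simp [triG, triInc] <;> omega

end Graphs

section Cylinder

variable {K : ℕ} [NeZero K] {p : ℝ}

/-- The ends of the edges of the layers `c`. -/
def cylG (c : ℤ → Letter) (e : ℤ × ZMod K × Bool) : Cyl K × Cyl K :=
  ((e.1, e.2.1), if e.2.2 then (if (c e.1).diag then (e.1 + 1, e.2.1 + -1) else (e.1, e.2.1 + 1))
    else (e.1 + 1, e.2.1 + 0))

/-- The intensities of the edges of the layers `c`. -/
def cylP (c : ℤ → Letter) (e : ℤ × ZMod K × Bool) : ℝ := if e.2.2 then (c e.1).side else (c e.1).up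

/-- The edges of the layers in `S`. -/
def cylE (K : ℕ) [NeZero K] (S : Finset ℤ) : Finset (ℤ × ZMod K × Bool) :=
  S ×ˢ (Finset.univ ×ˢ Finset.univ)

theorem mem_cylE {S : Finset ℤ} {e : ℤ × ZMod K × Bool} : e ∈ cylE K S ↔ e.1 ∈ S := by
  simp [cylE]

theorem sum_layers (c : ℤ → Letter) (S : Finset ℤ) :
    ∑ s ∈ S, layer K s (c s) =
      ∑ e ∈ cylE K S, {((cylG c e).1, (cylG c e).2, cylP c e)} := by
  unfold cylE
  rw [Finset.sum_product]
  refine Finset.sum_congr rfl fun s _ => ?_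
  rw [Finset.sum_product]
  simp only [Fintype.sum_bool, cylG, cylP, if_true, Bool.false_eq_true, if_false]
  rw [Finset.sum_add_distrib, add_comm, layer]
  congr 1
  split_ifs <;> rfl

theorem avg_layers (c : ℤ → Letter) (S : Finset ℤ) (f : Setoid (Cyl K) → ℝ) :
    avg (∑ s ∈ S, layer K s (c s)) f ⊥ =
      Ex (cylP c) (cylE K S) fun t => f (clusters (cylG c) t) := by
  rw [sum_layers, avg_eq_Ex]
  simp only [bot_sup_eq]

theorem tri_cyl_conn {q q' : ℤ → ℝ} {x : ℤ × ℤ} {c : ℤ → Letter} {n : ℕ}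
    (hc : c = triLetter p fun b => (q (b + x.2), q' (b + x.2)))
    {s : Finset TriE} (hs : ∀ e ∈ s, x.2 - n ≤ e.2.1 ∧ e.2.1 < x.2 + n)
    {j : TriE → ℤ × ZMod K × Bool} (hj : j = fun e => if e.2.2 = 0 then
      (2 * (e.2.1 - x.2), ((e.1 - x.1 : ℤ) : ZMod K), true) else if e.2.2 = 1 then
      (2 * (e.2.1 - x.2) + 1, ((e.1 + 1 - x.1 : ℤ) : ZMod K), true) else
      (2 * (e.2.1 - x.2) + 1, ((e.1 - x.1 : ℤ) : ZMod K), false))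
    {t : Set (ℤ × ZMod K × Bool)}
    (h1 : ∀ e ∈ cylE K (Finset.Ico (-(2 * n) : ℤ) (2 * n)), cylP c e = 1 → e ∈ t)
    {u v : ℤ × ℤ} (h : Conn triG (j ⁻¹' t ∩ s) u v) :
    Conn (cylG c) t (2 * (u.2 - x.2), ((u.1 - x.1 : ℤ) : ZMod K))
      (2 * (v.2 - x.2), ((v.1 - x.1 : ℤ) : ZMod K)) := by
  refine Relation.ReflTransGen.lift' (fun v : ℤ × ℤ =>
    ((2 * (v.2 - x.2), ((v.1 - x.1 : ℤ) : ZMod K)) : Cyl K)) ?_ _ _ h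
  have key : ∀ e ∈ j ⁻¹' t ∩ s, Conn (cylG c) t
      (2 * ((triG e).1.2 - x.2), (((triG e).1.1 - x.1 : ℤ) : ZMod K))
      (2 * ((triG e).2.2 - x.2), (((triG e).2.1 - x.1 : ℤ) : ZMod K)) := by
    rintro ⟨a, b, i⟩ ⟨he, hes⟩
    have hb := hs _ hes
    simp only [mem_preimage, hj] at he
    dsimp only at hb
    have up : ∀ d : ZMod K, Conn (cylG c) t (2 * (b - x.2), d) (2 * (b - x.2) + 1, d) := by
      intro d
      refine Adj.conn ⟨(2 * (b - x.2), d, false), h1 _ ?_ ?_, Or.inl ?_⟩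
      · rw [mem_cylE, Finset.mem_Ico]; dsimp only; omega
      · simp [cylP, hc, triLetter, sqLetter]
      · simp [cylG]
    have e1 : (2 * (b - x.2) + 1) % 2 = 1 := by omega
    fin_cases i
    · simp only [Fin.zero_eta, if_true] at he
      refine Adj.conn ⟨_, he, Or.inl ?_⟩
      simp [cylG, triG, hc, triLetter, sqLetter]
      ring
    · simp only [Fin.mk_one, one_ne_zero, if_false, if_true] at he
      refine (up _).trans (Adj.conn ⟨_, he, Or.inl ?_⟩)
      simp only [cylG, triG, hc, triLetter, slantLetter, e1]
      simp
      constructor <;> ring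
    · have e2 : (2 : Fin 3) ≠ 0 ∧ (2 : Fin 3) ≠ 1 := by decide
      simp only [Fin.reduceFinMk, e2.1, e2.2, if_false] at he
      refine (up _).trans (Adj.conn ⟨_, he, Or.inl ?_⟩)
      simp [cylG, triG]
      ring
  rintro u v ⟨e, he, hG | hG⟩
  · have := key e he
    rwa [hG] at this
  · have := key e he
    rw [hG] at this
    exact this.symm

/-- The edge of the cylinder corresponding to an edge of the square lattice. -/
def sqToCyl (K : ℕ) (e : SqE) : ℤ × ZMod K × Bool :=
  if e.2.2 then (2 * e.2.1, (e.1 : ZMod K), true) else (2 * e.2.1 + 1, (e.1 : ZMod K), false)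

theorem cyl_sq_exits {c : ℤ → Letter} {n R : ℕ} (hn : 2 * R + 4 ≤ n)
    (hc : ∀ s : ℤ, -(n : ℤ) ≤ s → s < n → c s = sqLetter p (decide (s % 2 = 0)))
    {t : Set (ℤ × ZMod K × Bool)} (h0 : ∀ e ∈ t, cylP c e ≠ 0) {v : Cyl K}
    (hv : v.1 = 2 * n ∨ v.1 = -(2 * n)) (h : Conn (cylG c) t (0, 0) v) :
    Exits sqG (box R) (0, 0) (sqToCyl K ⁻¹' t) := by
  by_contra hex
  have hC : ∀ y, Conn sqG (sqToCyl K ⁻¹' t) (0, 0) y → y ∈ box R := by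
    intro y hy
    by_contra hyb
    exact hex ⟨y, hyb, hy⟩
  have hinv : ∀ w, Conn (cylG c) t (0, 0) w →
      ∃ y, Conn sqG (sqToCyl K ⁻¹' t) (0, 0) y ∧ (w.1 = 2 * y.2 ∨ w.1 = 2 * y.2 + 1) ∧
        w.2 = (y.1 : ZMod K) := by
    intro w hw
    induction hw with
    | refl => exact ⟨(0, 0), Conn.refl _, by simp, by simp⟩
    | @tail w w' _ hadj ih =>
      obtain ⟨⟨x, y⟩, hy, hw1, hw2⟩ := ih
      obtain ⟨⟨s, a, i⟩, he, hG⟩ := hadj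
      have hb := mem_box.1 (hC _ hy)
      obtain ⟨s', a'⟩ := w
      obtain ⟨s'', a''⟩ := w'
      dsimp only at hb hw1 hw2
      have hs : -(n : ℤ) ≤ s ∧ s < n := by
        cases i
        · simp only [cylG, Prod.mk.injEq, Bool.false_eq_true, if_false] at hG
          omega
        · simp only [cylG, Prod.mk.injEq, if_true] at hG
          split_ifs at hG <;> simp only [Prod.mk.injEq] at hG <;> omega
      have hp0 := h0 _ he
      cases i
      · simp only [cylG, Prod.mk.injEq, Bool.false_eq_true, if_false, add_zero] at hG
        by_cases hs2 : s % 2 = 0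
        · refine ⟨(x, y), hy, ?_, ?_⟩
          · dsimp only; omega
          · rw [← hw2]
            rcases hG with hG | hG
            · exact hG.2.2.symm.trans hG.1.2
            · exact hG.1.2.symm.trans hG.2.2
        · rcases hG with ⟨⟨r1, r2⟩, r3, r4⟩ | ⟨⟨r1, r2⟩, r3, r4⟩
          · refine ⟨(x, y + 1), hy.trans (Adj.conn ⟨(x, y, false), ?_, Or.inl (by simp [sqG])⟩),
              ?_, ?_⟩
            · simp only [mem_preimage, sqToCyl, Bool.false_eq_true, if_false]
              rw [← hw2, ← r2, show 2 * y + 1 = s by omega]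
              exact he
            · dsimp only; omega
            · dsimp only; rw [← hw2, ← r2, r4]
          · refine ⟨(x, y - 1), hy.trans (Adj.conn ⟨(x, y - 1, false), ?_,
              Or.inr (by simp [sqG])⟩), ?_, ?_⟩
            · simp only [mem_preimage, sqToCyl, Bool.false_eq_true, if_false]
              rw [← hw2, ← r4, show 2 * (y - 1) + 1 = s by omega]
              exact he
            · dsimp only; omega
            · dsimp only; rw [← hw2, ← r2, r4]
      · simp only [cylP, if_true] at hp0
        rw [hc s hs.1 hs.2] at hp0
        have hs2 : s % 2 = 0 := by
          by_contra hs2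
          simp [hs2, sqLetter] at hp0
        simp only [cylG, if_true, hc s hs.1 hs.2, hs2, sqLetter, decide_true,
          Bool.false_eq_true, if_false, Prod.mk.injEq] at hG
        rcases hG with ⟨⟨r1, r2⟩, r3, r4⟩ | ⟨⟨r1, r2⟩, r3, r4⟩
        · refine ⟨(x + 1, y), hy.trans (Adj.conn ⟨(x, y, true), ?_, Or.inl (by simp [sqG])⟩),
              ?_, ?_⟩
          · simp only [mem_preimage, sqToCyl, if_true]
            rw [← hw2, ← r2, show 2 * y = s by omega]
            exact he
          · dsimp only; omega
          · dsimp only; rw [← r4, r2, hw2]; push_cast; rfl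
        · refine ⟨(x - 1, y), hy.trans (Adj.conn ⟨(x - 1, y, true), ?_,
              Or.inr (by simp [sqG])⟩), ?_, ?_⟩
          · simp only [mem_preimage, sqToCyl, if_true]
            push_cast
            rw [← hw2, ← r4, show 2 * y = s by omega, add_sub_cancel_right]
            exact he
          · dsimp only; omega
          · dsimp only; push_cast; rw [← hw2, ← r4, ← r2, add_sub_cancel_right]
  obtain ⟨y, hy, hy1, -⟩ := hinv v h
  have := mem_box.1 (hC y hy)
  omega

end Cylinder

theorem intCast_zmod_inj {K : ℕ} {a b : ℤ} (h : (a : ZMod K) = b) (h1 : a - b < K) (h2 : b - a < K) :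
    a = b := by
  have h3 := (ZMod.intCast_eq_intCast_iff_dvd_sub a b K).1 h
  have h4 := Int.eq_zero_of_abs_lt_dvd h3 (by rw [abs_lt]; omega)
  omega

theorem insens_level_ends {K n : ℕ} [NeZero K] {s : ℤ} (h0 : s ≠ 0) (h1 : -(2 * n : ℤ) < s)
    (h2 : s < 2 * n) : Insens (level K s) fun σ : Setoid (Cyl K) =>
      ind (∃ v : Cyl K, (v.1 = 2 * n ∨ v.1 = -(2 * n)) ∧ σ (0, 0) v) := by
  intro σ τ hst
  refine congrArg ind ?_
  refine propext (exists_congr fun v => and_congr_right fun hv => hst _ _ ?_ ?_)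
  · exact fun h => h0 (Eq.symm h)
  · intro h
    have : v.1 = s := h
    omega

theorem cylP_unit {K : ℕ} {c : ℤ → Letter}
    (hc : ∀ s, (c s).up ∈ Icc (0 : ℝ) 1 ∧ (c s).side ∈ Icc (0 : ℝ) 1) :
    Unit01 (cylP (K := K) c) := by
  intro e
  unfold cylP
  split_ifs
  · exact (hc _).2
  · exact (hc _).1

theorem triHI_unit {p : ℝ} {q q' : ℤ → ℝ} (hp : p ∈ Icc (0 : ℝ) 1) (hq : ∀ n, q n ∈ Icc (0 : ℝ) 1)
    (hq' : ∀ n, q' n ∈ Icc (0 : ℝ) 1) : Unit01 (triHI p q q') := by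
  intro e
  unfold triHI
  split_ifs
  · exact hp
  · exact hq _
  · exact hq' _

theorem sqInt_unit {p : ℝ} (hp : p ∈ Icc (0 : ℝ) 1) : Unit01 (sqInt p (1 - p)) := by
  intro e
  unfold sqInt
  have := hp.1
  have := hp.2
  split_ifs <;> constructor <;> linarith

/-- The probability of reaching far rows is bounded by that of leaving a box of the square lattice. -/
theorem tri_rows_le {p : ℝ} (hp : p ∈ Icc (0 : ℝ) 1) {q q' : ℤ → ℝ}
    (hβ : ∀ b, Fits p true (q b, q' b)) {R n M : ℕ} (hn : 2 * R + 4 ≤ n) (x : ℤ × ℤ)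
    {s : Finset TriE} (hs : ∀ e ∈ s, x.1 - M ≤ e.1 ∧ e.1 ≤ x.1 + M ∧
      x.2 - n ≤ e.2.1 ∧ e.2.1 < x.2 + n) :
    Pr (triHI p q q') s (fun t => ∃ y, (y.2 = x.2 + n ∨ y.2 = x.2 - n) ∧ Conn triG (t ∩ s) x y) ≤
      Pr (sqInt p (1 - p)) ((box R).biUnion sqInc) (Exits sqG (box R) (0, 0)) := by
  set K : ℕ := 2 * M + 2 * R + 10 with hK
  have : NeZero K := ⟨by omega⟩
  set c : ℤ → Letter := triLetter p fun b => (q (b + x.2), q' (b + x.2)) with hc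
  set j : TriE → ℤ × ZMod K × Bool := fun e => if e.2.2 = 0 then
      (2 * (e.2.1 - x.2), ((e.1 - x.1 : ℤ) : ZMod K), true) else if e.2.2 = 1 then
      (2 * (e.2.1 - x.2) + 1, ((e.1 + 1 - x.1 : ℤ) : ZMod K), true) else
      (2 * (e.2.1 - x.2) + 1, ((e.1 - x.1 : ℤ) : ZMod K), false) with hj
  set S := Finset.Ico (-(2 * n) : ℤ) (2 * n) with hS
  set A : Setoid (Cyl K) → Prop :=
    fun σ => ∃ v : Cyl K, (v.1 = 2 * n ∨ v.1 = -(2 * n)) ∧ σ (0, 0) v with hA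
  have hcu : ∀ s, (c s).up ∈ Icc (0 : ℝ) 1 ∧ (c s).side ∈ Icc (0 : ℝ) 1 := by
    intro s
    rw [hc]
    unfold triLetter
    split_ifs
    · simpa [sqLetter] using hp
    · exact ⟨(hβ _).1.2, (hβ _).1.1⟩
  have hjs : ∀ e ∈ s, j e ∈ cylE K S := by
    rintro ⟨a, b, i⟩ he
    have := hs _ he
    dsimp only at this
    rw [mem_cylE, hS, Finset.mem_Ico, hj]
    dsimp only
    split_ifs <;> dsimp only <;> omega
  have hpj : ∀ e ∈ s, cylP c (j e) = triHI p q q' e := by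
    rintro ⟨a, b, i⟩ he
    have e1 : (2 * (b - x.2) + 1) % 2 = 1 := by omega
    have e2 : (2 * (b - x.2) + 1) / 2 + x.2 = b := by omega
    fin_cases i <;> simp [hj, cylP, hc, triLetter, sqLetter, slantLetter, triHI, e1, e2]
  have hji : Set.InjOn j s := by
    rintro ⟨a, b, i⟩ he ⟨a', b', i'⟩ he' hee
    have h1 := hs _ he
    have h2 := hs _ he'
    dsimp only at h1 h2
    fin_cases i <;> fin_cases i' <;> simp [hj, -Int.cast_sub, -Int.cast_add] at hee <;>
      first
      | (exfalso; omega)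
      | (obtain ⟨h3, h4⟩ := hee
         have h5 := intCast_zmod_inj h4 (by omega) (by omega)
         simp
         omega)
  have hdep : DepOn (fun t => ∃ y : ℤ × ℤ, (y.2 = x.2 + n ∨ y.2 = x.2 - n) ∧
      Conn triG (t ∩ s) x y) (s : Set TriE) := by
    intro t
    simp only [Set.inter_assoc, Set.inter_self]
  obtain ⟨c', hc', hcu', hcc⟩ := exists_square_layers (K := K)
    (β := fun b => (q (b + x.2), q' (b + x.2))) hp (fun b => hβ _) n
  calc _ = Pr (cylP c) (cylE K S) (fun t => ∃ y : ℤ × ℤ, (y.2 = x.2 + n ∨ y.2 = x.2 - n) ∧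
        Conn triG (j ⁻¹' t ∩ s) x y) := (Pr_preimage j (cylP c) hji hjs hpj hdep).symm
    _ ≤ Pr (cylP c) (cylE K S) (fun t => A (clusters (cylG c) t)) := by
        refine Pr_mono_of_pos (cylP_unit hcu) ?_
        rintro t - h1 - ⟨y, hy, hconn⟩
        have := tri_cyl_conn (n := n) hc (fun e he => (hs e he).2.2) hj (t := t) h1 hconn
        simp only [sub_self, mul_zero, Int.cast_zero] at this
        refine ⟨_, ?_, this⟩
        dsimp only
        omega
    _ = avg (∑ s ∈ S, layer K s (c s)) (fun σ => ind (A σ)) ⊥ := (avg_layers c S fun σ => ind (A σ)).symm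
    _ = avg (∑ s ∈ S, layer K s (c' s)) (fun σ => ind (A σ)) ⊥ :=
        hcc _ fun s h0 h1 h2 => insens_level_ends h0 h1 h2
    _ = Pr (cylP c') (cylE K S) (fun t => A (clusters (cylG c') t)) := avg_layers c' S fun σ => ind (A σ)
    _ ≤ Pr (cylP c') (cylE K S) (fun t => Exits sqG (box R) (0, 0) (sqToCyl K ⁻¹' t)) := by
        refine Pr_mono_of_pos (cylP_unit hcu') ?_
        rintro t - - h0 ⟨v, hv, hconn⟩
        exact cyl_sq_exits hn hc' h0 hv hconn
    _ = _ := by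
        have hb : ∀ e ∈ (box R).biUnion sqInc, -(R : ℤ) - 1 ≤ e.1 ∧ e.1 ≤ R ∧
            -(R : ℤ) - 1 ≤ e.2.1 ∧ e.2.1 ≤ R := by
          rintro ⟨a, b, i⟩ he
          obtain ⟨v, hv, he⟩ := Finset.mem_biUnion.1 he
          have hv := mem_box.1 hv
          simp only [sqInc, Finset.mem_insert, Finset.mem_singleton, Prod.mk.injEq] at he
          dsimp only
          omega
        refine Pr_preimage (sqToCyl K) (cylP c') ?_ ?_ ?_ (exits_depOn_of_mem isInc_sq _ _ (zero_mem_box R))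
        · rintro ⟨a, b, i⟩ he ⟨a', b', i'⟩ he' hee
          have h1 := hb _ he
          have h2 := hb _ he'
          dsimp only at h1 h2
          cases i <;> cases i' <;> simp [sqToCyl] at hee <;>
            (obtain ⟨h3, h4⟩ := hee
             have h5 := intCast_zmod_inj h4 (by omega) (by omega)
             simp
             omega)
        · rintro ⟨a, b, i⟩ he
          have h1 := hb _ he
          dsimp only at h1
          rw [mem_cylE, hS, Finset.mem_Ico]
          cases i <;> simp [sqToCyl] <;> omega
        · rintro ⟨a, b, i⟩ he
          have h1 := hb _ he
          dsimp only at h1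
          cases i
          · have := hc' (2 * b + 1) (by omega) (by omega)
            simp [sqToCyl, cylP, this, sqLetter, sqInt]
          · have := hc' (2 * b) (by omega) (by omega)
            simp [sqToCyl, cylP, this, sqLetter, sqInt]

theorem Pr_forall_meets_le {E : Type*} [DecidableEq E] {p : E → ℝ} (hp : Unit01 p) {s : Finset E}
    {ι : Type*} [DecidableEq ι] {c : ℝ} (a : ι → Finset E) (I : Finset ι) (ha : ∀ i ∈ I, a i ⊆ s)
    (hd : ∀ i ∈ I, ∀ j ∈ I, i ≠ j → Disjoint (a i) (a j)) (hc : ∀ i ∈ I, c ≤ ∏ e ∈ a i, (1 - p e)) :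
    Pr p s (fun t => ∀ i ∈ I, ¬Disjoint (a i : Set E) t) ≤ (1 - c) ^ I.card := by
  have dep1 : ∀ i, DepOn (fun t => ¬Disjoint (a i : Set E) t) (a i : Set E) := by
    intro i t
    simp only [Set.disjoint_iff_inter_eq_empty]
    rw [Set.inter_comm t, ← Set.inter_assoc, Set.inter_self]
  have dep : ∀ J : Finset ι, DepOn (fun t => ∀ i ∈ J, ¬Disjoint (a i : Set E) t)
      (J.biUnion a : Finset E) := by
    intro J t
    refine propext (forall₂_congr fun i hi => ?_)
    have h := (dep1 i).mono (s' := ((J.biUnion a : Finset E) : Set E))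
      (by exact_mod_cast Finset.subset_biUnion_of_mem a hi) t
    exact iff_of_eq h
  rw [Pr_of_subset (Finset.biUnion_subset.2 ha) (dep I)]
  clear ha
  induction I using Finset.induction_on with
  | empty => simpa using Pr_le_one hp _
  | insert i I hi ih =>
    have h1 := ih (fun i hi j hj => hd i (Finset.mem_insert_of_mem hi) j (Finset.mem_insert_of_mem hj))
      fun j hj => hc j (Finset.mem_insert_of_mem hj)
    have hdis : Disjoint (a i) (I.biUnion a) := by
      rw [Finset.disjoint_biUnion_right]
      exact fun j hj => hd i (Finset.mem_insert_self _ _) j (Finset.mem_insert_of_mem hj)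
        fun h => hi (h ▸ hj)
    simp only [Finset.forall_mem_insert, Finset.biUnion_insert]
    rw [Pr_and_of_disjoint hdis (dep1 i) (dep I), Finset.card_insert_of_notMem hi, pow_succ, mul_comm]
    have h2 : Pr p (a i) (fun t => ¬Disjoint (a i : Set E) t) ≤ 1 - c := by
      rw [Pr_not, Pr_disjoint _ subset_rfl]
      linarith [hc i (Finset.mem_insert_self _ _)]
    have h3 := Pr_nonneg (s := a i) hp fun t => ¬Disjoint (a i : Set E) t
    exact mul_le_mul h1 h2 h3 (pow_nonneg (h3.trans h2) _)

/-- The box of half-width `M` and half-height `n - 1` about `x`. -/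
noncomputable def rect (x : ℤ × ℤ) (M n : ℕ) : Finset (ℤ × ℤ) :=
  Finset.Icc (x.1 - M) (x.1 + M) ×ˢ Finset.Ioo (x.2 - n) (x.2 + n)

theorem mem_rect {x v : ℤ × ℤ} {M n : ℕ} : v ∈ rect x M n ↔
    x.1 - M ≤ v.1 ∧ v.1 ≤ x.1 + M ∧ x.2 - n < v.2 ∧ v.2 < x.2 + n := by
  simp [rect, and_assoc]

theorem card_rect (x : ℤ × ℤ) (M n : ℕ) : (rect x M n).card ≤ (2 * M + 1) * (2 * n) := by
  rw [rect, Finset.card_product]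
  refine Nat.mul_le_mul ?_ ?_
  · rw [Int.card_Icc]; omega
  · rw [Int.card_Ioo]; omega

/-- The edges between the columns `j` and `j + 1`. -/
def colCut (s : Finset TriE) (j : ℤ) : Finset TriE := s.filter fun e => e.2.2 ≠ 2 ∧ e.1 = j

theorem mem_colCut {s : Finset TriE} {j : ℤ} {e : TriE} :
    e ∈ colCut s j ↔ e ∈ s ∧ e.2.2 ≠ 2 ∧ e.1 = j := by
  simp [colCut]

theorem colCut_disjoint (s : Finset TriE) {i j : ℤ} (h : i ≠ j) :
    Disjoint (colCut s i) (colCut s j) := by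
  rw [Finset.disjoint_left]
  intro e he he'
  exact h ((mem_colCut.1 he).2.2.symm.trans (mem_colCut.1 he').2.2)

theorem tri_exit_small {p : ℝ} (hp : p ∈ Ioo (0 : ℝ) 1)
    (hθ : ∀ ε > 0, ∃ R : ℕ,
      Pr (sqInt p (1 - p)) ((box R).biUnion sqInc) (Exits sqG (box R) (0, 0)) ≤ ε)
    {ε : ℝ} (hε : 0 < ε) : ∃ K : ℕ, ∀ q q' : ℤ → ℝ, (∀ n, q n ∈ Icc (0 : ℝ) 1) →
      (∀ n, q' n ∈ Icc (0 : ℝ) 1) → (∀ n, kappaT p (q n) (q' n) ≤ 0) → ∀ x : ℤ × ℤ,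
      ∃ L : Finset (ℤ × ℤ), x ∈ L ∧ L.card ≤ K ∧
        Pr (triHI p q q') (L.biUnion triInc) (Exits triG L x) ≤ ε := by
  obtain ⟨hp0, hp1⟩ := hp
  have hp' : p ∈ Icc (0 : ℝ) 1 := ⟨hp0.le, hp1.le⟩
  obtain ⟨R, hR⟩ := hθ (ε / 3) (by linarith)
  set n := 2 * R + 4 with hn
  set m := min p (1 - p) with hm
  have hm0 : 0 < m := lt_min hp0 (by linarith)
  have hm1 : m ≤ 1 := (min_le_left _ _).trans hp1.le
  have hc0 : 0 < m ^ (2 * (2 * n)) := pow_pos hm0 _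
  have hc1 : m ^ (2 * (2 * n)) ≤ 1 := pow_le_one₀ hm0.le hm1
  obtain ⟨M, hM⟩ := exists_pow_lt_of_lt_one (show 0 < ε / 3 by linarith)
    (show 1 - m ^ (2 * (2 * n)) < 1 by linarith)
  refine ⟨(2 * M + 1) * (2 * n), fun q q' hq hq' hκ x => ⟨rect x M n, mem_rect.2 (by omega),
    card_rect x M n, ?_⟩⟩
  have hqp : ∀ b, q b ≤ 1 - p := by
    intro b
    have h1 := hκ b
    have h2 := hq b
    have h3 := hq' b
    simp only [kappaT] at h1
    have h4 : 0 ≤ q' b * (1 - p * q b) :=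
      mul_nonneg h3.1 (by nlinarith [mul_le_mul hp1.le h2.2 h2.1 zero_le_one])
    nlinarith
  have hden : ∀ b, 0 < 1 - p * q b := by
    intro b
    nlinarith [hq b |>.1, hq b |>.2, mul_le_mul hp1.le (hq b).2 (hq b).1 zero_le_one, hqp b]
  set r : ℤ → ℝ := fun b => (1 - p - q b) / (1 - p * q b) with hr
  have hr0 : ∀ b, 0 ≤ r b := fun b => div_nonneg (by linarith [hqp b]) (hden b).le
  have hr1 : ∀ b, r b ≤ 1 := by
    intro b
    rw [hr, div_le_one (hden b)]
    nlinarith [(hq b).1, (hq b).2, hqp b]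
  have hqr : ∀ b, q' b ≤ r b := by
    intro b
    rw [hr, le_div_iff₀ (hden b)]
    have := hκ b
    simp only [kappaT] at this
    linarith
  have hfits : ∀ b, Fits p true (q b, r b) := by
    intro b
    refine ⟨⟨hq b, hr0 b, hr1 b⟩, ?_⟩
    simp only [if_true, kappaT]
    have := div_mul_cancel₀ (1 - p - q b) (hden b).ne'
    change r b * (1 - p * q b) = _ at this
    linarith
  have hu := triHI_unit hp' hq hq'
  have hu' := triHI_unit hp' hq fun b => ⟨hr0 b, hr1 b⟩
  set W := (rect x M n).biUnion triInc with hW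
  have hWe : ∀ e ∈ W, x.1 - (M + 1 : ℕ) ≤ e.1 ∧ e.1 ≤ x.1 + (M + 1 : ℕ) ∧
      x.2 - n ≤ e.2.1 ∧ e.2.1 < x.2 + n := by
    rintro ⟨a, b, i⟩ he
    obtain ⟨v, hv, he⟩ := Finset.mem_biUnion.1 he
    have hv := mem_rect.1 hv
    simp only [triInc, Finset.mem_insert, Finset.mem_singleton, Prod.mk.injEq] at he
    dsimp only
    omega
  have hcut : ∀ j, m ^ (2 * (2 * n)) ≤ ∏ e ∈ colCut W j, (1 - triHI p q r e) := by
    intro j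
    have h1 : ∀ e ∈ colCut W j, m ≤ 1 - triHI p q r e := by
      rintro ⟨a, b, i⟩ he
      have h2 := (mem_colCut.1 he).2.1
      fin_cases i
      · have := min_le_right p (1 - p)
        simpa only [triHI, Fin.zero_eta, if_true] using this
      · simp [triHI]
        exact (min_le_left p (1 - p)).trans (by linarith [hqp b])
      · simp at h2
    calc _ ≤ m ^ (colCut W j).card := by
          refine pow_le_pow_of_le_one hm0.le hm1 ?_
          have hsub : colCut W j ⊆ (Finset.Ico (x.2 - n) (x.2 + n) ×ˢ ({0, 1} : Finset (Fin 3))).map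
              ⟨fun y => (j, y.1, y.2), fun y z h => by simpa [Prod.ext_iff] using h⟩ := by
            rintro ⟨a, b, i⟩ he
            obtain ⟨h1, h2, h3⟩ := mem_colCut.1 he
            have h4 := hWe _ h1
            dsimp only at h2 h3 h4
            simp only [Finset.mem_map, Finset.mem_product, Finset.mem_Ico]
            refine ⟨(b, i), ⟨h4.2.2, ?_⟩, by simp [h3]⟩
            fin_cases i <;> simp at h2 ⊢
          refine (Finset.card_le_card hsub).trans ?_
          rw [Finset.card_map, Finset.card_product, Int.card_Ico,
            show (({0, 1} : Finset (Fin 3)).card = 2) by decide]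
          omega
      _ ≤ _ := by
          rw [← Finset.prod_const]
          exact Finset.prod_le_prod (fun _ _ => hm0.le) h1
  have hmono : Pr (triHI p q q') W (Exits triG (rect x M n) x) ≤
      Pr (triHI p q r) W (Exits triG (rect x M n) x) := by
    refine Ex_mono_left hu hu' ?_ (ind_monotone (exits_monotone _ _))
    rintro ⟨a, b, i⟩ -
    fin_cases i <;> simp [triHI, hqr]
  refine hmono.trans ?_
  set rows : Set TriE → Prop := fun t => ∃ y : ℤ × ℤ, (y.2 = x.2 + n ∨ y.2 = x.2 - n) ∧
    Conn triG (t ∩ W) x y with hrows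
  set right : Set TriE → Prop := fun t => ∀ i ∈ Finset.range M,
    ¬Disjoint (colCut W (x.1 + i) : Set TriE) t with hright
  set left : Set TriE → Prop := fun t => ∀ i ∈ Finset.range M,
    ¬Disjoint (colCut W (x.1 - 1 - i) : Set TriE) t with hleft
  have hsub : ∀ t : Set TriE, t ⊆ W → Exits triG (rect x M n) x t → rows t ∨ right t ∨ left t := by
    rintro t htW ⟨y, hy, hconn⟩
    by_contra hno
    simp only [not_or, hrows, hright, hleft] at hno
    obtain ⟨h1, h2, h3⟩ := hno
    push Not at h1 h2 h3
    obtain ⟨i, hi, h2⟩ := h2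
    obtain ⟨j, hj, h3⟩ := h3
    rw [Finset.mem_range] at hi hj
    rw [Set.disjoint_left] at h2 h3
    rw [Set.inter_eq_left.2 htW] at h1
    have hinv : ∀ z, Conn triG t x z → x.1 - 1 - j < z.1 ∧ z.1 ≤ x.1 + i ∧
        x.2 - n < z.2 ∧ z.2 < x.2 + n := by
      intro z hz
      induction hz with
      | refl => omega
      | @tail z z' hz hadj ih =>
        have hz' : z'.2 ≠ x.2 + n ∧ z'.2 ≠ x.2 - n :=
          ⟨fun h => h1 z' (Or.inl h) (hz.trans (Adj.conn hadj)),
            fun h => h1 z' (Or.inr h) (hz.trans (Adj.conn hadj))⟩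
        obtain ⟨⟨a, b, k⟩, he, hG⟩ := hadj
        have hr : k ≠ 2 → a ≠ x.1 + i := fun hk ha =>
          h2 (by exact_mod_cast mem_colCut.2 ⟨htW he, hk, ha⟩) he
        have hl : k ≠ 2 → a ≠ x.1 - 1 - j := fun hk ha =>
          h3 (by exact_mod_cast mem_colCut.2 ⟨htW he, hk, ha⟩) he
        obtain ⟨z1, z2⟩ := z
        obtain ⟨z1', z2'⟩ := z'
        dsimp only at ih hz' ⊢
        fin_cases k
        · simp [triG] at hG hr hl
          omega
        · simp [triG] at hG hr hl
          omega
        · simp [triG] at hG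
          omega
    have := hinv y hconn
    rw [Finset.mem_coe, mem_rect] at hy
    omega
  calc _ ≤ Pr (triHI p q r) W (fun t => rows t ∨ right t ∨ left t) := Pr_mono hu' hsub
    _ ≤ Pr (triHI p q r) W rows + (Pr (triHI p q r) W right + Pr (triHI p q r) W left) :=
        (Pr_or_le hu' _ _).trans (add_le_add_right (Pr_or_le hu' _ _) _)
    _ ≤ ε / 3 + (ε / 3 + ε / 3) := by
        refine add_le_add ((tri_rows_le hp' hfits le_rfl x hWe).trans hR) (add_le_add ?_ ?_)
        · refine le_trans ?_ hM.le
          refine (Pr_forall_meets_le hu' (c := m ^ (2 * (2 * n))) (fun i : ℕ => colCut W (x.1 + i))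
            (Finset.range M) (fun i _ => Finset.filter_subset _ _)
            (fun i _ j _ h => colCut_disjoint _ (by omega)) (fun i _ => hcut _)).trans_eq ?_
          rw [Finset.card_range]
        · refine le_trans ?_ hM.le
          refine (Pr_forall_meets_le hu' (c := m ^ (2 * (2 * n)))
            (fun i : ℕ => colCut W (x.1 - 1 - i))
            (Finset.range M) (fun i _ => Finset.filter_subset _ _)
            (fun i _ j _ h => colCut_disjoint _ (by omega)) (fun i _ => hcut _)).trans_eq ?_
          rw [Finset.card_range]
    _ = ε := by ring

/-- The hexagonal lattice as a graph: `(true, a, b)` and `(false, a, b)` stand for `hup a b` and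
`hdown a b`. -/
def hexG (e : TriE) : (Bool × ℤ × ℤ) × (Bool × ℤ × ℤ) :=
  ((true, e.1, e.2.1), if e.2.2 = 0 then (false, e.1, e.2.1)
    else if e.2.2 = 1 then (false, e.1, e.2.1 + 1) else (false, e.1 - 1, e.2.1 + 1))

def hexInc (v : Bool × ℤ × ℤ) : Finset TriE :=
  if v.1 then {(v.2.1, v.2.2, 0), (v.2.1, v.2.2, 1), (v.2.1, v.2.2, 2)}
  else {(v.2.1, v.2.2, 0), (v.2.1, v.2.2 - 1, 1), (v.2.1 + 1, v.2.2 - 1, 2)}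

theorem isInc_hex : IsInc hexG hexInc := by
  rintro ⟨u, x, y⟩ ⟨a, b, i⟩
  cases u <;> fin_cases i <;> simp [hexG, hexInc] <;> omega

/-- The edges of the stars centred at the up vertices in `U`. -/
def starE (U : Finset (ℤ × ℤ)) : Finset TriE :=
  (U ×ˢ (Finset.univ : Finset (Fin 3))).map (Equiv.prodAssoc ℤ ℤ (Fin 3)).toEmbedding

theorem mem_starE {U : Finset (ℤ × ℤ)} {e : TriE} : e ∈ starE U ↔ (e.1, e.2.1) ∈ U := by
  obtain ⟨a, b, i⟩ := e
  simp [starE]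

theorem sum_starE {M : Type*} [AddCommMonoid M] (U : Finset (ℤ × ℤ)) (f : TriE → M) :
    ∑ e ∈ starE U, f e = ∑ u ∈ U, (f (u.1, u.2, 0) + f (u.1, u.2, 1) + f (u.1, u.2, 2)) := by
  rw [starE, Finset.sum_map, Finset.sum_product]
  refine Finset.sum_congr rfl fun u _ => ?_
  rw [Fin.sum_univ_three]
  rfl

/-- The edge of the triangular lattice opposite to the leaf of the edge `e` of a star. -/
def opposite (e : TriE) : TriE :=
  if e.2.2 = 0 then (e.1 - 1, e.2.1 + 1, 0) else if e.2.2 = 1 then (e.1 - 1, e.2.1, 1) else e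

theorem opposite_injective : Function.Injective opposite := by
  rintro ⟨a, b, i⟩ ⟨a', b', i'⟩ h
  fin_cases i <;> fin_cases i' <;> simp [opposite] at h ⊢ <;> omega

theorem star_triangle_hex {p : ℝ} {x y : ℤ → ℝ} (hk : ∀ b, kappaT (1 - p) (x b) (y b) = 0)
    (U : Finset (ℤ × ℤ)) (f : Setoid (Bool × ℤ × ℤ) → ℝ) (hf : ∀ u : ℤ × ℤ, Insens {(true, u)} f) :
    Ex (triHI p (fun b => 1 - x b) fun b => 1 - y b) (starE U) (fun t => f (clusters hexG t)) =
      Ex (fun e => triHI (1 - p) x y (opposite e)) (starE U)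
        fun t => f (clusters (fun e => ((false, (triG (opposite e)).1),
          (false, (triG (opposite e)).2))) t) := by
  have h1 := avg_eq_Ex hexG (triHI p (fun b => 1 - x b) fun b => 1 - y b) (starE U) f ⊥
  have h2 := avg_eq_Ex (fun e => ((false, (triG (opposite e)).1), (false, (triG (opposite e)).2)))
    (fun e => triHI (1 - p) x y (opposite e)) (starE U) f ⊥
  have h3 : (fun e => triHI (1 - p) x y (opposite e)) = triHI (1 - p) x y := by
    funext ⟨a, b, i⟩
    fin_cases i <;> simp [triHI, opposite]
  have e2 : (2 : Fin 3) ≠ 0 ∧ (2 : Fin 3) ≠ 1 := by decide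
  simp only [bot_sup_eq] at h1 h2
  rw [← h1, ← h2, sum_starE, sum_starE]
  simp only [congrFun h3]
  have := avg_replace (R := 0) (f := f) U (fun u => ((true, u) : Bool × ℤ × ℤ))
    (fun u => {((true, u), (false, u), 1 - (1 - p)), ((true, u), (false, (u.1 - 1, u.2 + 1)), 1 - y u.2),
      ((true, u), (false, (u.1, u.2 + 1)), 1 - x u.2)})
    (fun u => {((false, (u.1 - 1, u.2 + 1)), (false, (u.1, u.2 + 1)), 1 - p),
      ((false, u), (false, (u.1, u.2 + 1)), y u.2), ((false, u), (false, (u.1 - 1, u.2 + 1)), x u.2)})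
    (fun u _ R hR hf => avg_star (by simp) (by simp) (by simp) hR hf ?_) ?_ ?_ ?_
    (fun u _ => hf u)
  · rw [add_zero, add_zero] at this
    refine (congrArg (fun m => avg m f ⊥) ?_).trans (this.trans (congrArg (fun m => avg m f ⊥) ?_))
    · refine Finset.sum_congr rfl fun u _ => ?_
      simp only [hexG, triHI, Multiset.insert_eq_cons, ← Multiset.singleton_add, sub_sub_cancel]
      simp only [if_true, e2.1, e2.2, one_ne_zero, if_false]
      rw [add_assoc]
      congr 1
      exact add_comm _ _
    · refine Finset.sum_congr rfl fun u _ => ?_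
      simp only [opposite, triG, triHI, Multiset.insert_eq_cons, ← Multiset.singleton_add]
      simp only [if_true, e2.1, e2.2, one_ne_zero, if_false, sub_add_cancel]
      rw [add_assoc]
      congr 1
      exact add_comm _ _
  · rw [← hk u.2]
    simp only [kappaT]
    ring
  · intro u _ v _ huv e he
    simp only [Multiset.insert_eq_cons, Multiset.mem_cons, Multiset.mem_singleton] at he
    rcases he with rfl | rfl | rfl <;> simp [huv]
  · intro u _ v _ e he
    simp only [Multiset.insert_eq_cons, Multiset.mem_cons, Multiset.mem_singleton] at he
    rcases he with rfl | rfl | rfl <;> simp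
  · intro u _ e he
    simp at he

/-- The up vertices adjacent to the down vertices in `L`. -/
def starCentres (L : Finset (ℤ × ℤ)) : Finset (ℤ × ℤ) :=
  L.biUnion fun v => {v, (v.1, v.2 - 1), (v.1 + 1, v.2 - 1)}

theorem card_starCentres (L : Finset (ℤ × ℤ)) : (starCentres L).card ≤ L.card * 3 :=
  Finset.card_biUnion_le_card_mul _ _ _ fun _ _ => Finset.card_le_three

/-- The down vertices in `L` and their neighbours. -/
def hexNbhd (L : Finset (ℤ × ℤ)) : Finset (Bool × ℤ × ℤ) :=
  (starCentres L).image (fun u => (true, u)) ∪ L.image fun v => (false, v)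

theorem mem_hexNbhd_true {L : Finset (ℤ × ℤ)} {u : ℤ × ℤ} :
    (true, u) ∈ hexNbhd L ↔ u ∈ starCentres L := by
  simp [hexNbhd]

theorem mem_hexNbhd_false {L : Finset (ℤ × ℤ)} {u : ℤ × ℤ} :
    (false, u) ∈ hexNbhd L ↔ u ∈ L := by
  simp [hexNbhd]

theorem card_hexNbhd (L : Finset (ℤ × ℤ)) : (hexNbhd L).card ≤ 4 * L.card := by
  refine (Finset.card_union_le _ _).trans ?_
  have h1 := (Finset.card_image_le (s := starCentres L) (f := fun u => (true, u))).trans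
    (card_starCentres L)
  have h2 := Finset.card_image_le (s := L) (f := fun u => (false, u))
  omega

theorem biUnion_hexInc (L : Finset (ℤ × ℤ)) :
    (hexNbhd L).biUnion hexInc = starE (starCentres L) := by
  ext e
  rw [Finset.mem_biUnion, mem_starE]
  constructor
  · rintro ⟨⟨b, v⟩, hv, he⟩
    rcases (isInc_hex _ _).1 he with h | h
    · rw [← h] at hv
      exact mem_hexNbhd_true.1 hv
    · obtain ⟨x, y, i⟩ := e
      have hb : b = false := by
        have := congrArg Prod.fst h
        fin_cases i <;> exact this.symm
      subst hb
      refine Finset.mem_biUnion.2 ⟨v, mem_hexNbhd_false.1 hv, ?_⟩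
      have h := congrArg Prod.snd h
      fin_cases i <;> simp [hexG] at h <;> subst h <;> simp
  · exact fun h => ⟨(true, e.1, e.2.1), mem_hexNbhd_true.2 h, (isInc_hex _ _).2 (Or.inl rfl)⟩

theorem hex_exit_down_le {p : ℝ} {x y : ℤ → ℝ} (hp : p ∈ Icc (0 : ℝ) 1)
    (hx : ∀ b, x b ∈ Icc (0 : ℝ) 1) (hy : ∀ b, y b ∈ Icc (0 : ℝ) 1)
    (hk : ∀ b, kappaT (1 - p) (x b) (y b) = 0) (L : Finset (ℤ × ℤ)) {v : ℤ × ℤ} (hv : v ∈ L) :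
    Pr (triHI p (fun b => 1 - x b) fun b => 1 - y b) ((hexNbhd L).biUnion hexInc)
      (Exits hexG (hexNbhd L) (false, v)) ≤
      Pr (triHI (1 - p) x y) (L.biUnion triInc) (Exits triG L v) := by
  have hone : ∀ {a : ℝ}, a ∈ Icc (0 : ℝ) 1 → 1 - a ∈ Icc (0 : ℝ) 1 := fun h =>
    ⟨by linarith [h.2], by linarith [h.1]⟩
  have hu := triHI_unit hp (fun b => hone (hx b)) fun b => hone (hy b)
  have hu' := triHI_unit (hone hp) hx hy
  rw [biUnion_hexInc]
  set s := starE (starCentres L) with hs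
  set A : Setoid (Bool × ℤ × ℤ) → Prop := fun σ => ∃ w, w ∉ L ∧ σ (false, v) (false, w) with hA
  set G' : TriE → (Bool × ℤ × ℤ) × (Bool × ℤ × ℤ) :=
    fun e => ((false, (triG (opposite e)).1), (false, (triG (opposite e)).2)) with hG'
  have hAI : ∀ u : ℤ × ℤ, Insens {(true, u)} fun σ => ind (A σ) := by
    intro u σ τ hst
    refine congrArg ind (propext (exists_congr fun w => and_congr_right fun _ => hst _ _ ?_ ?_)) <;>
      simp
  calc _ ≤ Pr (triHI p (fun b => 1 - x b) fun b => 1 - y b) s (fun t => A (clusters hexG t)) := by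
        refine Pr_mono hu ?_
        rintro t ht ⟨⟨b, w⟩, hw, hconn⟩
        cases b
        · exact ⟨w, fun h => hw (by exact_mod_cast mem_hexNbhd_false.2 h), hconn⟩
        · exfalso
          rcases Relation.ReflTransGen.cases_tail hconn with h | ⟨z, -, e, he, hG⟩
          · simp at h
          · have h1 : (true, w) = (hexG e).1 := by
              rcases hG with h | h
              · have := congrArg (fun z => z.2.1) h
                obtain ⟨a, b, i⟩ := e
                fin_cases i <;> simp [hexG] at this
              · rw [h]
            have h2 := mem_starE.1 (Finset.mem_coe.1 (ht he))
            apply hw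
            rw [h1]
            exact_mod_cast mem_hexNbhd_true.2 h2
    _ = Pr (fun e => triHI (1 - p) x y (opposite e)) s fun t => A (clusters G' t) :=
        star_triangle_hex hk _ (fun σ => ind (A σ)) hAI
    _ = Pr (fun e => triHI (1 - p) x y (opposite e)) s fun t => A (clusters G' (t ∩ s)) :=
        Ex_congr (fun _ _ => rfl) fun t ht => by dsimp only; rw [Set.inter_eq_left.2 ht]
    _ = Pr (triHI (1 - p) x y) (s.image opposite ∪ L.biUnion triInc)
          fun t => A (clusters G' (opposite ⁻¹' t ∩ s)) :=
        (Pr_preimage opposite _ opposite_injective.injOn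
          (fun e he => Finset.mem_union_left _ (Finset.mem_image_of_mem _ he)) (fun _ _ => rfl)
          (A := fun t => A (clusters G' (t ∩ s)))
          fun t => by simp only [Set.inter_assoc, Set.inter_self]).symm
    _ ≤ Pr (triHI (1 - p) x y) (s.image opposite ∪ L.biUnion triInc) (Exits triG L v) := by
        refine Pr_mono hu' ?_
        rintro t - ⟨w, hw, hconn⟩
        refine ⟨w, hw, ?_⟩
        have := Relation.ReflTransGen.lift' (p := Adj triG t) Prod.snd ?_ _ _ hconn
        · exact this
        · rintro a b ⟨e, he, h⟩
          have he' : opposite e ∈ t := he.1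
          rcases h with h | h
          · obtain ⟨rfl, rfl⟩ := Prod.mk.inj h
            exact (adj_of_mem (G := triG) he').conn
          · obtain ⟨rfl, rfl⟩ := Prod.mk.inj h
            exact (adj_of_mem (G := triG) he').conn.symm
    _ = _ := Pr_of_subset Finset.subset_union_right (exits_depOn_of_mem isInc_tri L v hv)

theorem hex_exit_small {p : ℝ} (hp : p ∈ Ioo (0 : ℝ) 1)
    (hθ : ∀ ε > 0, ∃ R : ℕ,
      Pr (sqInt (1 - p) (1 - (1 - p))) ((box R).biUnion sqInc) (Exits sqG (box R) (0, 0)) ≤ ε)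
    {ε : ℝ} (hε : 0 < ε) : ∃ K : ℕ, ∀ q q' : ℤ → ℝ, (∀ n, q n ∈ Icc (0 : ℝ) 1) →
      (∀ n, q' n ∈ Icc (0 : ℝ) 1) → (∀ n, kappaH p (q n) (q' n) ≤ 0) → ∀ x : Bool × ℤ × ℤ,
      ∃ L : Finset (Bool × ℤ × ℤ), x ∈ L ∧ L.card ≤ K ∧
        Pr (triHI p q q') (L.biUnion hexInc) (Exits hexG L x) ≤ ε := by
  obtain ⟨hp0, hp1⟩ := hp
  obtain ⟨K, hK⟩ := tri_exit_small (p := 1 - p) ⟨by linarith, by linarith⟩ hθ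
    (show 0 < ε / 3 by linarith)
  refine ⟨4 * K + 4 * K + 4 * K + 1, fun q q' hq hq' hκ => ?_⟩
  set x : ℤ → ℝ := fun b => min (1 - q b) p with hx
  have hx0 : ∀ b, 0 ≤ x b := fun b => le_min (by linarith [(hq b).2]) hp0.le
  have hxp : ∀ b, x b ≤ p := fun b => min_le_right _ _
  have hden : ∀ b, 0 < 1 - (1 - p) * x b := by
    intro b
    nlinarith [hx0 b, hxp b]
  set y : ℤ → ℝ := fun b => (p - x b) / (1 - (1 - p) * x b) with hy
  have hyd : ∀ b, y b * (1 - (1 - p) * x b) = p - x b := fun b => div_mul_cancel₀ _ (hden b).ne'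
  have hy0 : ∀ b, 0 ≤ y b := fun b => div_nonneg (by linarith [hxp b]) (hden b).le
  have hy1 : ∀ b, y b ≤ 1 := by
    intro b
    rw [hy, div_le_one (hden b)]
    nlinarith [hx0 b, hxp b]
  have hyq : ∀ b, y b ≤ 1 - q' b := by
    intro b
    rw [hy, div_le_iff₀ (hden b)]
    rcases min_choice (1 - q b) p with h | h
    · have h1 := hκ b
      simp only [hx, h]
      simp only [kappaH, kappaT] at h1
      nlinarith
    · simp only [hx, h, sub_self]
      exact mul_nonneg (by linarith [(hq' b).2]) (by nlinarith)
  have hk : ∀ b, kappaT (1 - p) (x b) (y b) = 0 := by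
    intro b
    simp only [kappaT]
    linarith [hyd b]
  have hxI : ∀ b, x b ∈ Icc (0 : ℝ) 1 := fun b => ⟨hx0 b, (hxp b).trans hp1.le⟩
  have hyI : ∀ b, y b ∈ Icc (0 : ℝ) 1 := fun b => ⟨hy0 b, hy1 b⟩
  have hu := triHI_unit ⟨hp0.le, hp1.le⟩ hq hq'
  have hu' : Unit01 (triHI p (fun b => 1 - x b) fun b => 1 - y b) :=
    triHI_unit ⟨hp0.le, hp1.le⟩ (fun b => ⟨by linarith [(hxI b).2], by linarith [(hxI b).1]⟩)
      fun b => ⟨by linarith [(hyI b).2], by linarith [(hyI b).1]⟩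
  have down : ∀ v : ℤ × ℤ, ∃ L : Finset (Bool × ℤ × ℤ), (false, v) ∈ L ∧ L.card ≤ 4 * K ∧
      Pr (triHI p q q') (L.biUnion hexInc) (Exits hexG L (false, v)) ≤ ε / 3 := by
    intro v
    obtain ⟨L, hvL, hLK, hL⟩ := hK x y hxI hyI (fun b => (hk b).le) v
    refine ⟨hexNbhd L, mem_hexNbhd_false.2 hvL, (card_hexNbhd L).trans (by omega), ?_⟩
    refine le_trans ?_ hL
    refine le_trans ?_ (hex_exit_down_le ⟨hp0.le, hp1.le⟩ hxI hyI hk L hvL)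
    refine Ex_mono_left hu hu' ?_ (ind_monotone (exits_monotone _ _))
    rintro ⟨a, b, i⟩ -
    have h1 : x b ≤ 1 - q b := min_le_left _ _
    fin_cases i <;> simp [triHI]
    · linarith
    · linarith [hyq b]
  rintro ⟨d, v⟩
  cases d
  · obtain ⟨L, h1, h2, h3⟩ := down v
    exact ⟨L, h1, h2.trans (by omega), h3.trans (by linarith)⟩
  · choose L hL1 hL2 hL3 using down
    set l : Fin 3 → ℤ × ℤ := fun i => (hexG (v.1, v.2, i)).2.2 with hl
    set N := insert (true, v) (Finset.univ.biUnion fun i => L (l i)) with hN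
    have hsub : ∀ i, L (l i) ⊆ N := fun i => (Finset.subset_biUnion_of_mem (fun i => L (l i))
      (Finset.mem_univ i)).trans (Finset.subset_insert _ _)
    refine ⟨N, Finset.mem_insert_self _ _, ?_, ?_⟩
    · refine (Finset.card_insert_le _ _).trans (Nat.succ_le_succ (Finset.card_biUnion_le.trans ?_))
      rw [Fin.sum_univ_three]
      have := hL2 (l 0)
      have := hL2 (l 1)
      have := hL2 (l 2)
      omega
    · calc _ ≤ Pr (triHI p q q') (N.biUnion hexInc)
            (fun t => ∃ i ∈ (Finset.univ : Finset (Fin 3)), Exits hexG (L (l i)) (false, l i) t) := by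
            refine Pr_mono hu ?_
            rintro t - ⟨y, hy, hconn⟩
            rcases Relation.ReflTransGen.cases_head hconn with h | ⟨z, ⟨⟨a, b, i⟩, he, hG⟩, hz⟩
            · exact absurd (Finset.mem_coe.2 (Finset.mem_insert_self _ _)) (h ▸ hy)
            · refine ⟨i, Finset.mem_univ _, y, fun h => hy (Finset.mem_coe.2 (hsub i h)), ?_⟩
              have h2 : z = (false, l i) := by
                rcases hG with h | h
                · have h3 : v = (a, b) := by
                    have := congrArg (fun z => z.1.2) h
                    exact this.symm
                  have h4 : z = (hexG (a, b, i)).2 := by rw [h]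
                  rw [h4, hl, h3]
                  fin_cases i <;> rfl
                · have := congrArg (fun z => z.2.1) h
                  fin_cases i <;> simp [hexG] at this
              rwa [h2] at hz
        _ ≤ ∑ i : Fin 3, Pr (triHI p q q') (N.biUnion hexInc) (Exits hexG (L (l i)) (false, l i)) :=
            Pr_exists_le hu _ _
        _ = ∑ i : Fin 3, Pr (triHI p q q') ((L (l i)).biUnion hexInc)
              (Exits hexG (L (l i)) (false, l i)) :=
            Finset.sum_congr rfl fun i _ => Pr_of_subset
              (Finset.biUnion_subset_biUnion_of_subset_left _ (hsub i))
              (exits_depOn_of_mem isInc_hex _ _ (hL1 _))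
        _ ≤ ∑ i : Fin 3, ε / 3 := Finset.sum_le_sum fun i _ => hL3 _
        _ = ε := by simp; ring

section Trifurcation

variable {V E ι : Type*} {G : E → V × V} {t : Set E}

/-- Connection by open edges avoiding `S`. -/
def Off (G : E → V × V) (t : Set E) (S : Set V) : V → V → Prop := Conn G (t ∩ ins G Sᶜ)

/-- The vertex `y` can be reached from `S` by a path that does not return to `S`. -/
def Branch (G : E → V × V) (t : Set E) (S : Set V) (y : V) : Prop :=
  ∃ s ∈ S, ∃ u, u ∉ S ∧ Adj G t s u ∧ Off G t S u y

/-- Three vertices of `Y` reached from `S` by branches that are disconnected off `S`. -/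
def Trifurcates (G : E → V × V) (t : Set E) (S : Set V) (Y : Set V) : Prop :=
  ∃ y : Fin 3 → V, (∀ k, y k ∈ Y ∧ Branch G t S (y k)) ∧ ∀ k l, k ≠ l → ¬Off G t S (y k) (y l)

theorem Off.transfer {S S' : Set V} {a b : V} (h : Off G t S a b)
    (hS : ∀ v, Off G t S a v → v ∉ S') : Off G t S' a b := by
  have := Conn.inter_of_closed (S := {v | Off G t S a v}) h (Conn.refl a)
    fun c d hc hcd => Conn.trans hc hcd.conn
  refine this.mono fun e he => ⟨he.1.1, ?_⟩
  exact ⟨hS _ he.2.1, hS _ he.2.2⟩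

theorem Branch.off {S S' : Set V} {y : V} (hd : Disjoint S S') (h : Branch G t S y)
    (hy : ∀ v, Off G t S y v → v ∉ S') : ∃ s ∈ S, Off G t S' s y := by
  obtain ⟨s, hs, u, _, hsu, huy⟩ := h
  refine ⟨s, hs, ?_⟩
  have h1 : Off G t S' y u := Off.transfer huy.symm hy
  have h2 : Adj G (t ∩ ins G S'ᶜ) s u :=
    hsu.inter_ins (Set.disjoint_left.1 hd hs) (hy u huy.symm)
  exact h2.conn.trans h1.symm

theorem exists_index_not {V : Type*} {y : Fin 3 → V} {R : V → V → Prop}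
    (hR : ∀ a b c, R a b → R b c → R a c) (hs : ∀ a b, R a b → R b a)
    (hy : ∀ k l, k ≠ l → ¬R (y k) (y l)) (a b : V) : ∃ k, ¬R (y k) a ∧ ¬R (y k) b := by
  by_contra! h
  have key : ∀ k l c, k ≠ l → R (y k) c → R (y l) c → False := fun k l c hkl h1 h2 =>
    hy k l hkl (hR _ _ _ h1 (hs _ _ h2))
  have h0 := h 0
  have h1 := h 1
  have h2 := h 2
  have k01 := fun c => key 0 1 c (by decide)
  have k02 := fun c => key 0 2 c (by decide)
  have k12 := fun c => key 1 2 c (by decide)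
  have := k01 a; have := k01 b; have := k02 a; have := k02 b; have := k12 a; have := k12 b
  tauto

/-- Disjoint connected sets that all trifurcate into `Y` are at most as many as the points
of `Y`. -/
theorem card_trifurcations_le [DecidableEq ι] [DecidableEq V] (S : ι → Set V)
    (hc : ∀ j, ∀ u ∈ S j, ∀ v ∈ S j, Conn G (t ∩ ins G (S j)) u v)
    (hne : ∀ j, (S j).Nonempty) :
    ∀ (J : Finset ι) (Y : Finset V), (∀ i ∈ J, ∀ j ∈ J, i ≠ j → Disjoint (S i) (S j)) →
      (∀ j ∈ J, Trifurcates G t (S j) Y) → J.card ≤ Y.card := by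
  classical
  intro J
  induction' hn : J.card with n ih generalizing J
  · intros; exact Nat.zero_le _
  intro Y hd hT
  have hoff : ∀ i ∈ J, ∀ j ∈ J, i ≠ j → ∀ u ∈ S j, ∀ v ∈ S j, Off G t (S i) u v := by
    intro i hi j hj hij u hu v hv
    refine (hc j u hu v hv).mono (inter_subset_inter_right _ (ins_mono fun w hw hw' => ?_))
    exact Set.disjoint_left.1 (hd i hi j hj hij) hw' hw
  have htr : ∀ A : Set V, ∀ a b c, Off G t A a b → Off G t A b c → Off G t A a c :=
    fun A a b c h h' => Conn.trans h h'
  have hsy : ∀ A : Set V, ∀ a b, Off G t A a b → Off G t A b a := fun A a b h => Conn.symm h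
  set N : ι × V → ℕ := fun z =>
    (J.filter fun i => i ≠ z.1 ∧ ∃ s ∈ S i, Off G t (S z.1) s z.2).card with hN
  set P : Finset (ι × V) := (J ×ˢ Y).filter fun z => Branch G t (S z.1) z.2 with hP
  have hPne : P.Nonempty := by
    obtain ⟨j, hj⟩ := Finset.card_pos.1 (by omega : 0 < J.card)
    obtain ⟨y, hy, -⟩ := hT j hj
    exact ⟨(j, y 0), by
      rw [hP, Finset.mem_filter, Finset.mem_product]; exact ⟨⟨hj, (hy 0).1⟩, (hy 0).2⟩⟩
  obtain ⟨⟨j, y⟩, hmem, hmin⟩ := Finset.exists_min_image P N hPne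
  rw [hP, Finset.mem_filter, Finset.mem_product] at hmem
  obtain ⟨⟨hj, hyY⟩, hbr⟩ := hmem
  dsimp only at hj hyY hbr
  have hzero : ∀ i ∈ J, i ≠ j → ∀ s ∈ S i, ¬Off G t (S j) s y := by
    intro i hi hij s hs hsy'
    obtain ⟨w, hw, hww⟩ := hT i hi
    obtain ⟨sj, hsj⟩ := hne j
    obtain ⟨k, hk, -⟩ := exists_index_not (htr (S i)) (hsy (S i)) hww sj sj
    have hmiss : ∀ v, Off G t (S i) (w k) v → v ∉ S j := fun v hv hvj =>
      hk (htr _ _ _ _ hv (hoff i hi j hj hij v hvj sj hsj))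
    have hkP : (i, w k) ∈ P := by
      rw [hP, Finset.mem_filter, Finset.mem_product]; exact ⟨⟨hi, (hw k).1⟩, (hw k).2⟩
    refine absurd (hmin _ hkP) (not_le.2 (Finset.card_lt_card ?_))
    have hwy : Off G t (S j) (w k) y := by
      obtain ⟨s', hs', h⟩ := (hw k).2.off (hd i hi j hj hij) hmiss
      exact htr _ _ _ _ (hsy _ _ _ h)
        (htr _ _ _ _ (hoff j hj i hi hij.symm s' hs' s hs) hsy')
    refine (Finset.ssubset_iff_of_subset fun l hl => ?_).2 ⟨i, ?_, ?_⟩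
    · rw [Finset.mem_filter] at hl ⊢
      obtain ⟨hlJ, hli, sl, hsl, hlo⟩ := hl
      refine ⟨hlJ, ?_, sl, hsl, ?_⟩
      · rintro rfl
        exact hmiss sl (hsy _ _ _ hlo) hsl
      · exact htr _ _ _ _ (hsy _ _ _ ((hsy _ _ _ hlo).transfer hmiss)) hwy
    · exact Finset.mem_filter.2 ⟨hi, hij, s, hs, hsy'⟩
    · exact fun h => (Finset.mem_filter.1 h).2.1 rfl
  have hcard := ih (J.erase j) (by rw [Finset.card_erase_of_mem hj]; omega) (Y.erase y)
    (fun i hi l hl => hd i (Finset.mem_of_mem_erase hi) l (Finset.mem_of_mem_erase hl)) ?_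
  · rw [Finset.card_erase_of_mem hyY] at hcard
    have := Finset.card_pos.2 ⟨y, hyY⟩
    omega
  intro i hi
  obtain ⟨hij, hiJ⟩ := Finset.mem_erase.1 hi
  obtain ⟨w, hw, hww⟩ := hT i hiJ
  by_cases hyw : ∃ k, w k = y
  · obtain ⟨k, hk⟩ := hyw
    obtain ⟨z, hz, hzz⟩ := hT j hj
    obtain ⟨si, hsi⟩ := hne i
    obtain ⟨l, hly, hls⟩ := exists_index_not (htr (S j)) (hsy (S j)) hzz y si
    have hdj := hd j hj i hiJ hij.symm
    obtain ⟨s, hs, hsz⟩ := (hz l).2.off hdj fun v hv hvi =>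
      hls (htr _ _ _ _ hv (hoff j hj i hiJ hij.symm v hvi si hsi))
    obtain ⟨s', hs', hsy'⟩ := hbr.off hdj fun v hv hvi => hzero i hiJ hij v hvi (hsy _ _ _ hv)
    have hyz : Off G t (S i) y (z l) := htr _ _ _ _ (hsy _ _ _ hsy')
      (htr _ _ _ _ (hoff i hiJ j hj hij s' hs' s hs) hsz)
    have hrep : ∀ m, Off G t (S i) (w m) (Function.update w k (z l) m) := by
      intro m
      by_cases hm : m = k
      · subst hm; rw [Function.update_self, hk]; exact hyz
      · rw [Function.update_of_ne hm]; exact Conn.refl _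
    refine ⟨Function.update w k (z l), fun m => ⟨?_, ?_⟩, fun m m' hmm h => ?_⟩
    · by_cases hm : m = k
      · subst hm
        rw [Function.update_self, Finset.mem_coe, Finset.mem_erase]
        refine ⟨?_, (hz l).1⟩
        rintro rfl
        exact hly (Conn.refl _)
      · rw [Function.update_of_ne hm, Finset.mem_coe, Finset.mem_erase]
        refine ⟨fun h => hww m k hm ?_, (hw m).1⟩
        rw [h, hk]
        exact Conn.refl _
    · obtain ⟨a, ha, u, hu, hau, huy⟩ := (hw m).2
      exact ⟨a, ha, u, hu, hau, htr _ _ _ _ huy (hrep m)⟩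
    · exact hww m m' hmm (htr _ _ _ _ (hrep m) (htr _ _ _ _ h (hsy _ _ _ (hrep m'))))
  · refine ⟨w, fun k => ⟨?_, (hw k).2⟩, hww⟩
    rw [Finset.mem_coe, Finset.mem_erase]
    exact ⟨fun h => hyw ⟨k, h⟩, (hw k).1⟩

end Trifurcation

section

section Automorphism

variable {V E F : Type*} {G : E → V × V}

theorem Conn.map {V' : Type*} {G' : F → V' × V'} {j : E → F} {φ : V → V'}
    (h : ∀ e, G' (j e) = (φ (G e).1, φ (G e).2) ∨ G' (j e) = (φ (G e).2, φ (G e).1))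
    {t : Set F} {u v : V} (hc : Conn G (j ⁻¹' t) u v) : Conn G' t (φ u) (φ v) := by
  refine Relation.ReflTransGen.lift (p := Adj G' t) φ (fun a b hab => ?_) _ _ hc
  obtain ⟨e, he, hG | hG⟩ := hab <;> have := h e <;> rw [hG] at this
  exacts [⟨j e, he, this⟩, ⟨j e, he, this.symm⟩]

end Automorphism

/-- Translation of the edges of the square lattice. -/
def shiftE (x : ℤ × ℤ) (e : SqE) : SqE := (e.1 + x.1, e.2.1 + x.2, e.2.2)

/-- Reflection of the edges of the square lattice in the horizontal axis. -/
def reflE (e : SqE) : SqE := (e.1, if e.2.2 then -e.2.1 else -e.2.1 - 1, e.2.2)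

/-- The edge crossed by a dual edge. -/
def undual (f : SqE) : SqE := if f.2.2 then (f.1 + 1, f.2.1, false) else (f.1, f.2.1 + 1, true)

/-- The open dual edges; the dual vertex `(a, b)` lies at `(a + 1/2, b + 1/2)`. -/
def dualCfg (t : Set SqE) : Set SqE := {f | undual f ∉ t}

theorem conn_shift {x : ℤ × ℤ} {t : Set SqE} {u v : ℤ × ℤ} :
    Conn sqG (shiftE x ⁻¹' t) u v ↔ Conn sqG t (u + x) (v + x) := by
  have h1 : ∀ (x : ℤ × ℤ) (e : SqE), sqG (shiftE x e) = ((sqG e).1 + x, (sqG e).2 + x) := by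
    rintro ⟨x, y⟩ ⟨a, b, i⟩
    cases i <;> simp [sqG, shiftE] <;> ring
  refine ⟨fun h => Conn.map (φ := (· + x)) (fun e => Or.inl (h1 x e)) h, fun h => ?_⟩
  have h2 : shiftE (-x) ⁻¹' (shiftE x ⁻¹' t) = t := by
    ext ⟨a, b, i⟩
    simp [shiftE]
  rw [← h2] at h
  simpa using Conn.map (φ := (· + -x)) (fun e => Or.inl (h1 (-x) e)) h

theorem conn_refl {t : Set SqE} {u v : ℤ × ℤ} (h : Conn sqG (reflE ⁻¹' t) u v) :
    Conn sqG t (u.1, -u.2) (v.1, -v.2) := by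
  refine Conn.map (φ := fun v : ℤ × ℤ => (v.1, -v.2)) ?_ h
  rintro ⟨a, b, i⟩
  cases i <;> simp [sqG, reflE]
  ring

theorem undual_injective : Function.Injective undual := by
  rintro ⟨a, b, i⟩ ⟨c, d, k⟩ h
  cases i <;> cases k <;> simp_all [undual]

theorem shiftE_injective (x : ℤ × ℤ) : Function.Injective (shiftE x) := by
  rintro ⟨a, b, i⟩ ⟨c, d, k⟩ h
  simp_all [shiftE]

theorem reflE_injective : Function.Injective reflE := by
  rintro ⟨a, b, i⟩ ⟨c, d, k⟩ h
  cases i <;> cases k <;> simp_all [reflE]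

section Law

variable {p : ℝ} {s W : Finset SqE} {A : Set SqE → Prop}

theorem Pr_shift (ph pv : ℝ) (x : ℤ × ℤ) (h : ∀ e ∈ s, shiftE x e ∈ W) (hA : DepOn A s) :
    Pr (sqInt ph pv) W (fun t => A (shiftE x ⁻¹' t)) = Pr (sqInt ph pv) s A :=
  Pr_preimage _ _ (shiftE_injective x).injOn h (fun _ _ => rfl) hA

theorem Pr_refl (ph pv : ℝ) (h : ∀ e ∈ s, reflE e ∈ W) (hA : DepOn A s) :
    Pr (sqInt ph pv) W (fun t => A (reflE ⁻¹' t)) = Pr (sqInt ph pv) s A :=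
  Pr_preimage _ _ reflE_injective.injOn h (fun _ _ => rfl) hA

theorem Pr_dual (p : ℝ) (h : ∀ e ∈ s, undual e ∈ W) (hA : DepOn A s) :
    Pr (sqInt p (1 - p)) W (fun t => A (dualCfg t)) = Pr (sqInt p (1 - p)) s A := by
  have hB : DepOn (fun t => A tᶜ) (s : Set SqE) := fun t => by
    refine hA.inter_eq ?_
    ext e
    simp only [mem_inter_iff, mem_compl_iff]
    tauto
  have h1 := Pr_preimage (p := fun e => 1 - sqInt p (1 - p) e) undual (sqInt p (1 - p))
    undual_injective.injOn h (fun e _ => by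
      obtain ⟨a, b, i⟩ := e
      cases i <;> simp [undual, sqInt]) hB
  refine h1.trans ?_
  rw [Pr, Ex_compl]
  refine Ex_congr (fun _ _ => rfl) fun t ht => congrArg ind ?_
  refine hA.inter_eq ?_
  ext e
  simp only [mem_inter_iff, mem_compl_iff, mem_sdiff]
  tauto

end Law

open Classical in
/-- The parity of an indicator. -/
noncomputable def chi (P : Prop) : ZMod 2 := if P then 1 else 0

/-- `F` records the parity of the number of horizontal steps above a dual vertex, for a path of
edges of `τ` from `u` to `v`. -/
structure IsParity (τ : Set SqE) (B : ℤ) (u v : ℤ × ℤ) (F : ℤ → ℤ → ZMod 2) : Prop where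
  hor : ∀ a b, (a, b, true) ∉ τ → F a (b - 1) = F a b
  ver : ∀ a b, (a, b, false) ∉ τ →
    F a b + F (a - 1) b = chi (a = u.1 ∧ b < u.2) + chi (a = v.1 ∧ b < v.2)
  top : ∀ a b, B < b → F a b = 0
  side : ∀ a b, a < -B ∨ B < a → F a b = 0
  bot : ∀ a b, b < -B → F a b = chi (u.1 ≤ a) + chi (v.1 ≤ a)

variable {τ : Set SqE} {B : ℤ} {u v w : ℤ × ℤ} {F F' : ℤ → ℤ → ZMod 2}

theorem IsParity.symm (h : IsParity τ B u v F) : IsParity τ B v u F :=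
  ⟨h.hor, fun a b hab => (h.ver a b hab).trans (add_comm _ _), h.top, h.side,
    fun a b hab => (h.bot a b hab).trans (add_comm _ _)⟩

theorem IsParity.trans (h : IsParity τ B u v F) (h' : IsParity τ B v w F') :
    IsParity τ B u w fun a b => F a b + F' a b where
  hor a b hab := by rw [h.hor a b hab, h'.hor a b hab]
  ver a b hab := by
    have h1 := h.ver a b hab
    have h2 := h'.ver a b hab
    have h3 := CharTwo.add_self_eq_zero (chi (a = v.1 ∧ b < v.2))
    linear_combination h1 + h2 + h3
  top a b hab := by rw [h.top a b hab, h'.top a b hab, add_zero]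
  side a b hab := by rw [h.side a b hab, h'.side a b hab, add_zero]
  bot a b hab := by
    have h1 := h.bot a b hab
    have h2 := h'.bot a b hab
    have h3 := CharTwo.add_self_eq_zero (chi (v.1 ≤ a))
    linear_combination h1 + h2 + h3

theorem isParity_edge {e : SqE} (he : e ∈ τ)
    (hB : -B ≤ e.1 ∧ e.1 ≤ B ∧ -B ≤ e.2.1 ∧ e.2.1 ≤ B) :
    ∃ F, IsParity τ B (sqG e).1 (sqG e).2 F := by
  obtain ⟨x, y, i⟩ := e
  obtain ⟨h1, h2, h3, h4⟩ := hB
  dsimp only at h1 h2 h3 h4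
  cases i
  · refine ⟨fun _ _ => 0, fun _ _ _ => rfl, fun a b hab => ?_, fun _ _ _ => rfl,
      fun _ _ _ => rfl, fun a b _ => ?_⟩
    · have : chi (a = x ∧ b < y) = chi (a = x ∧ b < y + 1) := by
        congr 1
        refine propext ⟨fun h => ⟨h.1, by omega⟩, fun h => ⟨h.1, ?_⟩⟩
        have : b ≠ y := by
          rintro rfl
          rw [h.1] at hab
          exact hab he
        omega
      simp only [sqG, Bool.false_eq_true, if_false, this]
      rw [CharTwo.add_self_eq_zero, CharTwo.add_self_eq_zero]
    · simp only [sqG, Bool.false_eq_true, if_false]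
      rw [CharTwo.add_self_eq_zero]
  · refine ⟨fun a b => chi (a = x ∧ b < y), fun a b hab => ?_, fun a b hab => ?_,
      fun a b hab => ?_, fun a b hab => ?_, fun a b hab => ?_⟩
    · congr 1
      refine propext ⟨fun h => ⟨h.1, ?_⟩, fun h => ⟨h.1, by omega⟩⟩
      have : b ≠ y := by
        rintro rfl
        rw [h.1] at hab
        exact hab he
      omega
    · have : chi (a - 1 = x ∧ b < y) = chi (a = x + 1 ∧ b < y) := by
        congr 1
        exact propext ⟨fun h => ⟨by omega, h.2⟩, fun h => ⟨by omega, h.2⟩⟩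
      simp only [sqG, if_true, this]
    · exact if_neg (by omega)
    · exact if_neg (by omega)
    · simp only [sqG, if_true, chi]
      split_ifs <;> first | omega | rfl

theorem exists_isParity (hB : ∀ e ∈ τ, -B ≤ e.1 ∧ e.1 ≤ B ∧ -B ≤ e.2.1 ∧ e.2.1 ≤ B)
    (h : Conn sqG τ u v) : ∃ F, IsParity τ B u v F := by
  induction h with
  | refl =>
    refine ⟨fun _ _ => 0, fun _ _ _ => rfl, fun a b hab => ?_, fun _ _ _ => rfl,
      fun _ _ _ => rfl, fun a b _ => ?_⟩
    · rw [CharTwo.add_self_eq_zero, CharTwo.add_self_eq_zero]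
    · rw [CharTwo.add_self_eq_zero]
  | tail _ hbc ih =>
    obtain ⟨F, hF⟩ := ih
    obtain ⟨e, he, hG⟩ := hbc
    obtain ⟨F', hF'⟩ := isParity_edge he (hB e he)
    rcases hG with hG | hG <;> rw [hG] at hF'
    exacts [⟨_, hF.trans hF'⟩, ⟨_, hF.trans hF'.symm⟩]

/-- Dual paths from both sides of a segment to infinity separate its two ends. -/
theorem not_conn_of_dual {t : Set SqE} {ρ : ℕ} {i₀ i₂ k₁ k₂ x x' : ℤ} (hτt : τ ⊆ t)
    (hB : ∀ e ∈ τ, -B ≤ e.1 ∧ e.1 ≤ B ∧ -B ≤ e.2.1 ∧ e.2.1 ≤ B) (hBρ : B < ρ)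
    (hi₀ : -B ≤ i₀) (hi₂ : i₂ ≤ B) (hseg : ∀ i, i₀ ≤ i → i < i₂ → (i, 0, true) ∈ t)
    (h1 : i₀ < k₁) (h2 : k₂ ≤ i₂) (hx : k₁ ≤ x ∧ x < k₂) (hx' : k₁ ≤ x' ∧ x' < k₂)
    (hhor : (x', 0, true) ∉ τ) (hver : ∀ a, k₁ ≤ a → a < k₂ → (a, 0, false) ∉ τ)
    (hup : Exits sqG (box ρ) (x, 0) (dualCfg t)) (hdn : Exits sqG (box ρ) (x', -1) (dualCfg t)) :
    ¬Conn sqG τ (i₀, 0) (i₂, 0) := by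
  intro hc
  obtain ⟨F, hF⟩ := exists_isParity hB hc
  set H : ℤ × ℤ → ZMod 2 := fun z => F z.1 z.2 + chi (i₀ ≤ z.1 ∧ z.1 < i₂ ∧ z.2 < 0) with hH
  have hconst : ∀ z z', Conn sqG (dualCfg t) z z' → H z = H z' := by
    intro z z' h
    induction h with
    | refl => rfl
    | @tail b c _ hbc ih =>
      refine ih.trans ?_
      have key : ∀ e ∈ dualCfg t, H (sqG e).1 = H (sqG e).2 := by
        rintro ⟨a, b, i⟩ he
        cases i
        · have he' : (a, b + 1, true) ∉ t := he
          have h3 := hF.hor a (b + 1) fun h => he' (hτt h)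
          rw [add_sub_cancel_right] at h3
          simp only [hH, sqG, Bool.false_eq_true, if_false, h3]
          congr 2
          refine propext ⟨fun h => ⟨h.1, h.2.1, ?_⟩, fun h => ⟨h.1, h.2.1, by omega⟩⟩
          by_contra hb
          have : b + 1 = 0 := by omega
          rw [this] at he'
          exact he' (hseg a h.1 h.2.1)
        · have he' : (a + 1, b, false) ∉ t := he
          have h3 := hF.ver (a + 1) b fun h => he' (hτt h)
          rw [add_sub_cancel_right] at h3
          simp only [hH, sqG, if_true]
          have h4 : chi (i₀ ≤ a ∧ a < i₂ ∧ b < 0) + chi (i₀ ≤ a + 1 ∧ a + 1 < i₂ ∧ b < 0) =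
              chi (a + 1 = i₀ ∧ b < 0) + chi (a + 1 = i₂ ∧ b < 0) := by
            have : i₀ < i₂ := by omega
            simp only [chi]
            split_ifs <;> first | omega | decide
          have h5 := CharTwo.add_self_eq_zero (F (a + 1) b)
          have h6 := CharTwo.add_self_eq_zero (chi (a + 1 = i₀ ∧ b < 0))
          have h7 := CharTwo.add_self_eq_zero (chi (a + 1 = i₂ ∧ b < 0))
          have h8 := CharTwo.add_self_eq_zero (chi (i₀ ≤ a + 1 ∧ a + 1 < i₂ ∧ b < 0))
          dsimp only at h3
          linear_combination h3 + h4 - h5 + h6 + h7 - h8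
      obtain ⟨e, he, hG | hG⟩ := hbc <;> have := key e he <;> rw [hG] at this
      exacts [this, this.symm]
  have hout : ∀ z, z ∉ box ρ → H z = 0 := by
    rintro ⟨a, b⟩ hz
    rw [mem_box] at hz
    simp only [hH]
    by_cases hs : a < -B ∨ B < a
    · rw [hF.side a b hs, chi, if_neg (by omega), add_zero]
    by_cases hb : B < b
    · rw [hF.top a b hb, chi, if_neg (by omega), add_zero]
    · have hb' : b < -B := by omega
      have : b < 0 := by omega
      have : i₀ < i₂ := by omega
      rw [hF.bot a b hb']
      simp only [chi]
      split_ifs <;> first | omega | decide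
  obtain ⟨z, hz, hcz⟩ := hup
  obtain ⟨z', hz', hcz'⟩ := hdn
  have hxH : H (x, 0) = 0 := (hconst _ _ hcz).trans (hout z hz)
  have hxH' : H (x', -1) = 0 := (hconst _ _ hcz').trans (hout z' hz')
  have hrow : ∀ (n : ℕ) (a : ℤ), k₁ ≤ a → a + n < k₂ → F (a + n) 0 = F a 0 := by
    intro n a ha
    induction n with
    | zero => intro; simp
    | succ n ih =>
      intro hn
      push_cast at hn ⊢
      have h3 := hF.ver (a + (n + 1)) 0 (hver _ (by omega) (by omega))
      have h4 : a + ((n : ℤ) + 1) - 1 = a + n := by ring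
      rw [h4, ih (by omega)] at h3
      simp only [lt_self_iff_false, and_false, chi, if_false, add_zero] at h3
      have h5 := CharTwo.add_self_eq_zero (F a 0)
      linear_combination h3 - h5
  have hxx : F x 0 = F x' 0 := by
    rcases le_total x x' with h | h
    · obtain ⟨n, hn⟩ := Int.eq_ofNat_of_zero_le (sub_nonneg.2 h)
      have : x' = x + n := by omega
      rw [this, hrow n x hx.1 (by omega)]
    · obtain ⟨n, hn⟩ := Int.eq_ofNat_of_zero_le (sub_nonneg.2 h)
      have : x = x' + n := by omega
      rw [this, hrow n x' hx'.1 (by omega)]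
  have h9 := hF.hor x' 0 hhor
  simp only [hH, chi] at hxH hxH'
  rw [if_neg (by omega), add_zero] at hxH
  rw [if_pos (by omega)] at hxH'
  have h10 : F x' (-1) = F x' (0 - 1) := by norm_num
  rw [h10, h9, ← hxx, hxH] at hxH'
  exact absurd hxH' (by decide)

end

theorem exits_depOn {V E : Type} [DecidableEq V] [DecidableEq E] {G : E → V × V}
    {inc : V → Finset E} (hinc : IsInc G inc) (L : Finset V) (x : V) :
    DepOn (Exits G L x) (L.biUnion inc : Finset E) := by
  by_cases hx : x ∈ L
  · exact exits_depOn_of_mem hinc L x hx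
  · exact fun t => propext ⟨fun _ => ⟨x, hx, Conn.refl _⟩, fun _ => ⟨x, hx, Conn.refl _⟩⟩

/-- The edges that meet the box of radius `R`. -/
noncomputable def boxE (R : ℕ) : Finset SqE := (box R).biUnion sqInc

theorem mem_boxE {R : ℕ} {e : SqE} : e ∈ boxE R ↔ (sqG e).1 ∈ box R ∨ (sqG e).2 ∈ box R := by
  simp only [boxE, Finset.mem_biUnion]
  constructor
  · rintro ⟨v, hv, he⟩
    rcases (isInc_sq v e).1 he with h | h
    exacts [Or.inl (h ▸ hv), Or.inr (h ▸ hv)]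
  · rintro (h | h)
    exacts [⟨_, h, (isInc_sq _ e).2 (Or.inl rfl)⟩, ⟨_, h, (isInc_sq _ e).2 (Or.inr rfl)⟩]

theorem boxE_coord {R : ℕ} {e : SqE} (he : e ∈ boxE R) :
    -(R : ℤ) - 1 ≤ e.1 ∧ e.1 ≤ R ∧ -(R : ℤ) - 1 ≤ e.2.1 ∧ e.2.1 ≤ R := by
  obtain ⟨a, b, i⟩ := e
  rw [mem_boxE] at he
  cases i <;> simp [sqG, mem_box] at he ⊢ <;> omega

theorem mem_boxE_of_coord {R : ℕ} {e : SqE}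
    (he : -(R : ℤ) ≤ e.1 ∧ e.1 ≤ R ∧ -(R : ℤ) ≤ e.2.1 ∧ e.2.1 ≤ R) : e ∈ boxE R := by
  refine mem_boxE.2 (Or.inl ?_)
  obtain ⟨a, b, i⟩ := e
  cases i <;> simpa [sqG, mem_box] using he

theorem exits_box_depOn (R : ℕ) (x : ℤ × ℤ) : DepOn (Exits sqG (box R) x) (boxE R) :=
  exits_depOn isInc_sq _ _

/-- No vertex of the segment of length `n` at the origin is connected to the outside of the
box. -/
def SegTrapped (n R : ℕ) (t : Set SqE) : Prop :=
  ∀ i : ℕ, i < n → ¬Exits sqG (box R) ((i : ℤ), 0) t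

theorem segTrapped_depOn (n R : ℕ) : DepOn (SegTrapped n R) (boxE R) := fun t => by
  simp only [SegTrapped, exits_box_depOn R _ t]

theorem box_mono {R R' : ℕ} (h : R ≤ R') : box R ⊆ box R' := fun v hv => by
  rw [mem_box] at *
  omega

theorem boxE_mono {R R' : ℕ} (h : R ≤ R') : boxE R ⊆ boxE R' :=
  Finset.biUnion_subset_biUnion_of_subset_left _ (box_mono h)

theorem Exits.anti {V E : Type*} {G : E → V × V} {S S' : Set V} {x : V} {t : Set E} (hS : S ⊆ S')
    (h : Exits G S' x t) : Exits G S x t := by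
  obtain ⟨y, hy, hc⟩ := h
  exact ⟨y, fun h => hy (hS h), hc⟩

theorem segTrapped_mono {n R R' : ℕ} (h : R ≤ R') {t : Set SqE} (ht : SegTrapped n R t) :
    SegTrapped n R' t := fun i hi hx => ht i hi (hx.anti (Finset.coe_subset.2 (box_mono h)))

/-- Monotone sequences that are bounded above nearly attain their supremum. -/
theorem exists_forall_le_add {f : ℕ → ℝ} (hf : ∀ R, f R ≤ 1) {η : ℝ} (hη : 0 < η) :
    ∃ ρ, ∀ R, f R ≤ f ρ + η := by
  have hbdd : BddAbove (range f) := ⟨1, by rintro _ ⟨R, rfl⟩; exact hf R⟩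
  obtain ⟨ρ, hρ⟩ := exists_lt_of_lt_ciSup (show (⨆ R, f R) - η < ⨆ R, f R by linarith)
  exact ⟨ρ, fun R => by linarith [le_ciSup hbdd R]⟩

section

variable {p : ℝ}

theorem segTrapped_sq (hp : p ∈ Ioo (0 : ℝ) 1) {n : ℕ} {c η : ℝ} (hη : 0 < η)
    (hc : ∀ R, Pr (sqInt p (1 - p)) (boxE R) (SegTrapped n R) ≤ c) :
    ∃ N, ∀ R, Pr (sqInt p (1 - p)) (boxE R) (SegTrapped N R) ≤ c ^ 2 + 2 * η := by
  have hu := sqInt_unit (p := p) ⟨hp.1.le, hp.2.le⟩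
  set m := sqInt p (1 - p) with hm
  obtain ⟨ρ, hρ⟩ := exists_forall_le_add
    (f := fun R => Pr m (boxE R) (SegTrapped n R)) (fun R => Pr_le_one hu _) hη
  set d : ℕ := 2 * ρ + 3 with hd
  refine ⟨d + n, fun R => ?_⟩
  set R' := R + d + ρ with hR'
  set W := boxE (R' + d) with hW
  have hsub : ∀ {r}, r ≤ R' → boxE r ⊆ W := fun h => boxE_mono (by omega)
  have hshift : ∀ {r}, r ≤ R' → ∀ e ∈ boxE r, shiftE ((d : ℤ), 0) e ∈ W := by
    intro r hr e he
    have h1 := boxE_mono hr he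
    rw [mem_boxE] at h1 ⊢
    obtain ⟨a, b, i⟩ := e
    cases i <;> simp [sqG, mem_box, shiftE] at h1 ⊢ <;> omega
  have hle : Pr m (boxE R) (SegTrapped (d + n) R) ≤ Pr m W fun t =>
      SegTrapped n R' t ∧ SegTrapped n R' (shiftE ((d : ℤ), 0) ⁻¹' t) := by
    rw [← Pr_of_subset (hsub (by omega)) (segTrapped_depOn _ _)]
    refine Pr_mono hu fun t _ ht => ⟨?_, fun i hi hx => ?_⟩
    · exact segTrapped_mono (R := R) (by omega) fun i hi => ht i (by omega)
    · obtain ⟨y, hy, hc⟩ := hx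
      refine ht (d + i) (by omega) ⟨y + ((d : ℤ), 0), fun hy' => hy ?_, ?_⟩
      · rw [Finset.mem_coe, mem_box] at hy' ⊢
        simp only [Prod.fst_add, Prod.snd_add] at hy'
        push_cast [hR']
        omega
      · have := conn_shift.1 hc
        simpa [add_comm] using this
  have hsplit : Pr m W (fun t =>
      SegTrapped n R' t ∧ SegTrapped n R' (shiftE ((d : ℤ), 0) ⁻¹' t)) ≤
      Pr m W (fun t => SegTrapped n ρ t ∧ SegTrapped n ρ (shiftE ((d : ℤ), 0) ⁻¹' t)) +
      ((Pr m W (SegTrapped n R') - Pr m W (SegTrapped n ρ)) +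
        (Pr m W (fun t => SegTrapped n R' (shiftE ((d : ℤ), 0) ⁻¹' t)) -
          Pr m W (fun t => SegTrapped n ρ (shiftE ((d : ℤ), 0) ⁻¹' t)))) := by
    simp only [Pr]
    rw [← Ex_sub, ← Ex_sub, ← Ex_add, ← Ex_add]
    refine Ex_mono hu fun t _ => ?_
    have h1 : SegTrapped n ρ t → SegTrapped n R' t := segTrapped_mono (by omega)
    have h2 : SegTrapped n ρ (shiftE ((d : ℤ), 0) ⁻¹' t) →
      SegTrapped n R' (shiftE ((d : ℤ), 0) ⁻¹' t) := segTrapped_mono (by omega)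
    by_cases a1 : SegTrapped n ρ t <;> by_cases a2 : SegTrapped n R' t <;>
      by_cases a3 : SegTrapped n ρ (shiftE ((d : ℤ), 0) ⁻¹' t) <;>
      by_cases a4 : SegTrapped n R' (shiftE ((d : ℤ), 0) ⁻¹' t) <;>
      first
        | exact absurd (h1 a1) a2
        | exact absurd (h2 a3) a4
        | simp [ind, a1, a2, a3, a4]
  have hdep : ∀ r, DepOn (SegTrapped n r) (boxE r) := segTrapped_depOn n
  have hb : ∀ r, r ≤ R' → Pr m W (fun t => SegTrapped n r (shiftE ((d : ℤ), 0) ⁻¹' t)) =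
      Pr m (boxE r) (SegTrapped n r) := fun r hr => Pr_shift _ _ _ (hshift hr) (hdep r)
  have ha : ∀ r, r ≤ R' → Pr m W (SegTrapped n r) = Pr m (boxE r) (SegTrapped n r) :=
    fun r hr => Pr_of_subset (hsub hr) (hdep r)
  have hprod : Pr m W (fun t => SegTrapped n ρ t ∧ SegTrapped n ρ (shiftE ((d : ℤ), 0) ⁻¹' t)) =
      Pr m (boxE ρ) (SegTrapped n ρ) * Pr m (boxE ρ) (SegTrapped n ρ) := by
    have himg : DepOn (fun t => SegTrapped n ρ (shiftE ((d : ℤ), 0) ⁻¹' t))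
        ((boxE ρ).image (shiftE ((d : ℤ), 0)) : Finset SqE) := fun t => by
      refine (hdep ρ).inter_eq ?_
      ext e
      simp only [mem_inter_iff, mem_preimage, Finset.coe_image, mem_image, Finset.mem_coe]
      constructor
      · exact fun h => ⟨h.1.1, h.2⟩
      · exact fun h => ⟨⟨h.1, e, h.2, rfl⟩, h.2⟩
    have hdis : Disjoint (boxE ρ) ((boxE ρ).image (shiftE ((d : ℤ), 0))) := by
      rw [Finset.disjoint_left]
      intro e he he'
      obtain ⟨e', h, rfl⟩ := Finset.mem_image.1 he'
      have h1 := boxE_coord he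
      have h2 := boxE_coord h
      simp only [shiftE] at h1
      omega
    rw [Pr_of_subset (s₁ := boxE ρ ∪ (boxE ρ).image (shiftE ((d : ℤ), 0))),
      Pr_and_of_disjoint hdis (hdep ρ) himg]
    · congr 1
      exact Pr_shift _ _ _ (fun e he => Finset.mem_image_of_mem _ he) (hdep ρ)
    · refine Finset.union_subset (hsub (by omega)) fun e he => ?_
      obtain ⟨e', h, rfl⟩ := Finset.mem_image.1 he
      exact hshift (by omega) e' h
    · exact ((hdep ρ).mono (Finset.coe_subset.2 Finset.subset_union_left)).and
        (himg.mono (Finset.coe_subset.2 Finset.subset_union_right))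
  rw [hprod, ha _ le_rfl, ha ρ (by omega), hb _ le_rfl, hb ρ (by omega)] at hsplit
  have h1 := hρ R'
  have h2 := hc ρ
  have h3 := Pr_nonneg (s := boxE ρ) hu (SegTrapped n ρ)
  nlinarith

/-- If the origin percolates, long segments are unlikely to be trapped. -/
theorem segTrapped_small (hp : p ∈ Ioo (0 : ℝ) 1) {θ : ℝ} (hθ : 0 < θ)
    (h : ∀ R, θ < Pr (sqInt p (1 - p)) (boxE R) (Exits sqG (box R) (0, 0))) {η : ℝ} (hη : 0 < η) :
    ∃ n, ∀ R, Pr (sqInt p (1 - p)) (boxE R) (SegTrapped n R) ≤ η := by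
  have hu := sqInt_unit (p := p) ⟨hp.1.le, hp.2.le⟩
  set C : Set ℝ := {c | ∃ n, ∀ R, Pr (sqInt p (1 - p)) (boxE R) (SegTrapped n R) ≤ c} with hC
  have hC0 : ∀ c ∈ C, 0 ≤ c := fun c ⟨n, hn⟩ => (Pr_nonneg hu _).trans (hn 0)
  have hbdd : BddBelow C := ⟨0, hC0⟩
  have h1 : 1 - θ ∈ C := by
    refine ⟨1, fun R => ?_⟩
    have : Pr (sqInt p (1 - p)) (boxE R) (SegTrapped 1 R) ≤
        Pr (sqInt p (1 - p)) (boxE R) fun t => ¬Exits sqG (box R) (0, 0) t :=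
      Pr_mono hu fun t _ ht => by simpa using ht 0 one_pos
    rw [Pr_not] at this
    linarith [h R]
  have hne : C.Nonempty := ⟨_, h1⟩
  have h0 : sInf C ≤ 0 := by
    by_contra! hpos
    have hlt : sInf C < 1 := (csInf_le hbdd h1).trans_lt (by linarith)
    have hsq : sInf C < Real.sqrt (sInf C) := by
      rw [Real.lt_sqrt hpos.le]
      nlinarith
    obtain ⟨c, ⟨n, hn⟩, hcs⟩ := exists_lt_of_csInf_lt hne hsq
    have hc0 := hC0 c ⟨n, hn⟩
    have hc2 : c ^ 2 < sInf C := by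
      rwa [Real.lt_sqrt hc0] at hcs
    obtain ⟨N, hN⟩ := segTrapped_sq hp (η := (sInf C - c ^ 2) / 4) (by linarith) hn
    have := csInf_le hbdd ⟨N, hN⟩
    linarith
  obtain ⟨c, ⟨n, hn⟩, hc⟩ := exists_lt_of_csInf_lt hne (h0.trans_lt hη)
  exact ⟨n, fun R => (hn R).trans hc.le⟩

end

section

/-- The horizontal segment of length `n` starting at the origin. -/
def segS (n : ℕ) : Set (ℤ × ℤ) := {v | 0 ≤ v.1 ∧ v.1 < n ∧ v.2 = 0}

/-- An arm from the part `[k, l)` of the segment to the outside of the box. -/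
def Arm (n ρ k l : ℕ) (t : Set SqE) : Prop :=
  ∃ i : ℕ, k ≤ i ∧ i < l ∧ ∃ u, u ∉ segS n ∧ Adj sqG t ((i : ℤ), 0) u ∧
    Exits sqG (box ρ) u (t ∩ ins sqG (segS n)ᶜ)

/-- An arm that starts with an upward step. -/
def ArmUp (n ρ k l : ℕ) (t : Set SqE) : Prop :=
  ∃ i : ℕ, k ≤ i ∧ i < l ∧ ((i : ℤ), (0 : ℤ), false) ∈ t ∧
    Exits sqG (box ρ) ((i : ℤ), 1) (t ∩ ins sqG (segS n)ᶜ)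

/-- A path to the outside of the box from just below the part `[k, l)` of the segment. -/
def PathDown (n ρ k l : ℕ) (t : Set SqE) : Prop :=
  ∃ i : ℕ, k ≤ i ∧ i < l ∧ Exits sqG (box ρ) ((i : ℤ), -1) (t ∩ ins sqG (segS n)ᶜ)

/-- An arm that starts with a downward step. -/
def ArmDown (n ρ k l : ℕ) (t : Set SqE) : Prop :=
  ∃ i : ℕ, k ≤ i ∧ i < l ∧ ((i : ℤ), (-1 : ℤ), false) ∈ t ∧
    Exits sqG (box ρ) ((i : ℤ), -1) (t ∩ ins sqG (segS n)ᶜ)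

variable {n ρ k l : ℕ}

theorem arm_monotone : Monotone (Arm n ρ k l) := by
  rintro t t' h ⟨i, h1, h2, u, hu, ha, hx⟩
  exact ⟨i, h1, h2, u, hu, ha.mono h, hx.mono (inter_subset_inter_left _ h)⟩

theorem armUp_monotone : Monotone (ArmUp n ρ k l) := by
  rintro t t' h ⟨i, h1, h2, ha, hx⟩
  exact ⟨i, h1, h2, h ha, hx.mono (inter_subset_inter_left _ h)⟩

theorem armDown_monotone : Monotone (ArmDown n ρ k l) := by
  rintro t t' h ⟨i, h1, h2, ha, hx⟩
  exact ⟨i, h1, h2, h ha, hx.mono (inter_subset_inter_left _ h)⟩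

theorem exits_off_depOn (u : ℤ × ℤ) :
    DepOn (fun t => Exits sqG (box ρ) u (t ∩ ins sqG (segS n)ᶜ))
      ((boxE ρ : Set SqE) ∩ ins sqG (segS n)ᶜ) := by
  intro t
  refine (exits_box_depOn ρ u).inter_eq ?_
  ext e
  simp only [mem_inter_iff]
  tauto

theorem exits_off_eq (u : ℤ × ℤ) {t t' : Set SqE}
    (h : t ∩ ((boxE ρ : Set SqE) ∩ ins sqG (segS n)ᶜ) =
      t' ∩ ((boxE ρ : Set SqE) ∩ ins sqG (segS n)ᶜ)) :
    Exits sqG (box ρ) u (t ∩ ins sqG (segS n)ᶜ) ↔ Exits sqG (box ρ) u (t' ∩ ins sqG (segS n)ᶜ) :=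
  iff_of_eq ((exits_off_depOn u).inter_eq h)

theorem seg_mem_box (hn : n ≤ ρ) {i : ℕ} (hi : i < n) : ((i : ℤ), (0 : ℤ)) ∈ box ρ := by
  rw [mem_box]
  dsimp only
  omega

/-- The edges on which the primal arms depend. -/
def armE (n ρ : ℕ) : Set SqE := (boxE ρ : Set SqE) ∩ (ins sqG (segS n))ᶜ

theorem off_subset_armE :
    (boxE ρ : Set SqE) ∩ ins sqG (segS n)ᶜ ⊆ armE n ρ :=
  fun _ he => ⟨he.1, fun h => he.2.1 h.1⟩

theorem arm_depOn (hρ : n ≤ ρ) (hl : l ≤ n) : DepOn (Arm n ρ k l) (armE n ρ) := by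
  intro t
  have hx : ∀ u, Exits sqG (box ρ) u (t ∩ armE n ρ ∩ ins sqG (segS n)ᶜ) ↔
      Exits sqG (box ρ) u (t ∩ ins sqG (segS n)ᶜ) := fun u => exits_off_eq u (by
    rw [inter_assoc, inter_eq_right.2 off_subset_armE])
  refine propext ⟨?_, ?_⟩
  · rintro ⟨i, h1, h2, u, hu, ha, h⟩
    exact ⟨i, h1, h2, u, hu, ha.mono inter_subset_left, (hx u).1 h⟩
  · rintro ⟨i, h1, h2, u, hu, ⟨e, he, hG⟩, h⟩
    refine ⟨i, h1, h2, u, hu, ⟨e, ⟨he, ?_, ?_⟩, hG⟩, (hx u).2 h⟩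
    · rw [Finset.mem_coe, mem_boxE]
      have := seg_mem_box hρ (h2.trans_le hl)
      rcases hG with hG | hG <;> rw [hG]
      exacts [Or.inl this, Or.inr this]
    · rintro ⟨g1, g2⟩
      rcases hG with hG | hG <;> rw [hG] at g1 g2
      exacts [hu g2, hu g1]

theorem armUp_depOn (hρ : n ≤ ρ) (hl : l ≤ n) :
    DepOn (ArmUp n ρ k l) ((boxE ρ : Set SqE) ∩
      (ins sqG (segS n)ᶜ ∪ {e | e.2.1 = 0 ∧ e.2.2 = false})) := by
  intro t
  unfold ArmUp
  refine propext (exists_congr fun i => and_congr_right fun h1 => and_congr_right fun h2 =>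
    and_congr ⟨fun h => h.1, fun h => ⟨h, ?_, Or.inr ⟨rfl, rfl⟩⟩⟩ (exits_off_eq _ ?_))
  · rw [Finset.mem_coe, mem_boxE]
    exact Or.inl (seg_mem_box hρ (h2.trans_le hl))
  · ext e
    simp only [mem_inter_iff, mem_union]
    tauto

theorem pathDown_depOn : DepOn (PathDown n ρ k l) ((boxE ρ : Set SqE) ∩ ins sqG (segS n)ᶜ) := by
  intro t
  unfold PathDown
  refine propext (exists_congr fun i => and_congr_right fun h1 => and_congr_right fun h2 =>
    exits_off_eq _ ?_)
  rw [inter_assoc, inter_self]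

theorem armDown_depOn (hρ : n ≤ ρ) (hl : l ≤ n) :
    DepOn (ArmDown n ρ k l) (boxE ρ) := by
  intro t
  unfold ArmDown
  refine propext (exists_congr fun i => and_congr_right fun h1 => and_congr_right fun h2 =>
    and_congr ⟨fun h => h.1, fun h => ⟨h, ?_⟩⟩ (exits_off_eq _ ?_))
  · rw [Finset.mem_coe, mem_boxE]
    refine Or.inr ?_
    simpa [sqG] using seg_mem_box hρ (h2.trans_le hl)
  · rw [inter_assoc, ← inter_assoc (boxE ρ : Set SqE), inter_self]

theorem not_arm_segTrapped (hρ : n ≤ ρ) {t : Set SqE} (h : ¬Arm n ρ 0 n t) : SegTrapped n ρ t := by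
  rintro i hi ⟨y, hy, hc⟩
  have hseg : ∀ {v}, v ∈ segS n → v ∈ (box ρ : Set (ℤ × ℤ)) := fun {v} hv => by
    simp only [segS, mem_ofPred_eq] at hv
    rw [Finset.mem_coe, mem_box]
    omega
  rcases hc.symm.stays_or_leaves (S := (segS n)ᶜ) fun h => hy (hseg h) with h1 | ⟨a, b, h1, h2, h3⟩
  · have h4 := h1.mem_of_ins fun h => hy (hseg h)
    exact h4 ⟨by simp, by simpa using hi, rfl⟩
  · rw [mem_compl_iff, not_not] at h2
    obtain ⟨b1, b2⟩ := b
    obtain ⟨g1, g2, rfl⟩ := h2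
    dsimp only at g1 g2
    obtain ⟨j, rfl⟩ := Int.eq_ofNat_of_zero_le g1
    refine h ⟨j, Nat.zero_le _, by omega, a, ?_, h3.symm, y, hy, h1.symm⟩
    exact h1.mem_of_ins fun h => hy (hseg h)

theorem arm_up_or_down (hk : 0 < k) (hl : l < n) {t : Set SqE} (h : Arm n ρ k l t) :
    ArmUp n ρ k l t ∨ ArmDown n ρ k l t := by
  obtain ⟨i, h1, h2, u, hu, ⟨⟨a, b, c⟩, he, hG⟩, hx⟩ := h
  have hu' : ∀ j : ℤ, 0 ≤ j → j < n → u ≠ (j, 0) := by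
    rintro j hj hj' rfl
    exact hu ⟨hj, hj', rfl⟩
  cases c
  · simp only [sqG, Bool.false_eq_true, if_false] at hG
    rcases hG with hG | hG <;> obtain ⟨g1, g2⟩ := Prod.mk.inj hG
    · obtain ⟨rfl, rfl⟩ := Prod.mk.inj g1
      subst g2
      exact Or.inl ⟨i, h1, h2, he, by simpa using hx⟩
    · obtain ⟨rfl, g3⟩ := Prod.mk.inj g2
      have : b = -1 := by omega
      subst this g1
      exact Or.inr ⟨i, h1, h2, he, hx⟩
  · simp only [sqG, if_true] at hG
    rcases hG with hG | hG <;> obtain ⟨g1, g2⟩ := Prod.mk.inj hG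
    · obtain ⟨rfl, rfl⟩ := Prod.mk.inj g1
      exact absurd g2.symm (hu' _ (by omega) (by omega))
    · obtain ⟨g3, rfl⟩ := Prod.mk.inj g2
      exact absurd g1.symm (hu' _ (by omega) (by omega))

theorem exits_refl {u : ℤ × ℤ} {t : Set SqE}
    (h : Exits sqG (box ρ) u (reflE ⁻¹' t ∩ ins sqG (segS n)ᶜ)) :
    Exits sqG (box ρ) (u.1, -u.2) (t ∩ ins sqG (segS n)ᶜ) := by
  obtain ⟨y, hy, hc⟩ := h
  refine ⟨(y.1, -y.2), fun h => hy ?_, conn_refl (hc.mono ?_)⟩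
  · rw [Finset.mem_coe, mem_box] at h ⊢
    dsimp only at h
    omega
  · rintro ⟨a, b, c⟩ ⟨h1, h2⟩
    refine ⟨h1, ?_⟩
    cases c <;> simp [ins, sqG, reflE, segS] at h2 ⊢ <;> omega

theorem armDown_of_refl {t : Set SqE} (h : ArmUp n ρ k l (reflE ⁻¹' t)) : ArmDown n ρ k l t := by
  obtain ⟨i, h1, h2, h3, h4⟩ := h
  exact ⟨i, h1, h2, by simpa [reflE] using h3, exits_refl h4⟩

theorem armUp_of_refl {t : Set SqE} (h : ArmDown n ρ k l (reflE ⁻¹' t)) : ArmUp n ρ k l t := by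
  obtain ⟨i, h1, h2, h3, h4⟩ := h
  exact ⟨i, h1, h2, by simpa [reflE] using h3, by simpa using exits_refl h4⟩

theorem reflE_mem {e : SqE} (he : e ∈ boxE ρ) : reflE e ∈ boxE (ρ + 2) := by
  have := boxE_coord he
  refine mem_boxE_of_coord ?_
  obtain ⟨a, b, c⟩ := e
  cases c <;> simp [reflE] at this ⊢ <;> omega

theorem undual_mem {e : SqE} (he : e ∈ boxE ρ) : undual e ∈ boxE (ρ + 2) := by
  have := boxE_coord he
  refine mem_boxE_of_coord ?_
  obtain ⟨a, b, c⟩ := e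
  cases c <;> simp [undual] at this ⊢ <;> omega

/-- A supermultiplicative array that is small on `[k, n)` is small on an initial piece, with the
rest still small. -/
theorem exists_small_piece {a : ℕ → ℕ → ℝ} {c ε η : ℝ} (hc : 0 < c) (hε : 0 < ε) (hε1 : ε < 1)
    (ha0 : ∀ k l, 0 ≤ a k l) (ha1 : ∀ k, a k k = 1) (hac : ∀ k, c ≤ a k (k + 1))
    (ham : ∀ k l m, k ≤ l → l ≤ m → a k l * a l m ≤ a k m) {k n : ℕ} (hkn : k ≤ n)
    (h : a k n ≤ η) (hη : η ≤ ε) : ∃ k', k < k' ∧ k' ≤ n ∧ a k k' ≤ ε ∧ a k' n ≤ η / (ε * c) := by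
  classical
  have hex : ∃ j, k ≤ j ∧ a k j ≤ ε := ⟨n, hkn, h.trans hη⟩
  obtain ⟨h1, h2⟩ := Nat.find_spec hex
  set j := Nat.find hex with hj
  have hjk : k < j := by
    refine lt_of_le_of_ne h1 fun h => ?_
    rw [← h, ha1] at h2
    linarith
  have hjn : j ≤ n := Nat.find_min' hex ⟨hkn, h.trans hη⟩
  have h3 : ε < a k (j - 1) := by
    by_contra! h3
    have := Nat.find_min' hex ⟨by omega, h3⟩
    omega
  refine ⟨j, hjk, hjn, h2, ?_⟩
  have h4 := ham k (j - 1) j (by omega) (by omega)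
  have h5 := hac (j - 1)
  rw [Nat.sub_add_cancel (by omega)] at h5
  have h6 : ε * c ≤ a k j := (mul_le_mul h3.le h5 hc.le (by linarith)).trans h4
  have h7 := ham k j n h1 hjn
  rw [le_div_iff₀ (by positivity)]
  nlinarith [ha0 j n]

end

section

variable {n ρ k l : ℕ}

/-- Arms from three parts of the segment, separated by dual arms on both sides of the two parts
in between. -/
def Good (n ρ k₁ k₂ k₃ k₄ : ℕ) (t : Set SqE) : Prop :=
  (Arm n ρ 0 k₁ t ∧ Arm n ρ k₂ k₃ t ∧ Arm n ρ k₄ n t) ∧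
    (ArmUp n ρ k₁ k₂ (dualCfg t) ∧ PathDown n ρ k₁ k₂ (dualCfg t)) ∧
      (ArmUp n ρ k₃ k₄ (dualCfg t) ∧ PathDown n ρ k₃ k₄ (dualCfg t))

/-- The edges of the segment. -/
noncomputable def segE (n : ℕ) : Finset SqE :=
  (Finset.range (n - 1)).image fun i : ℕ => ((i : ℤ), (0 : ℤ), true)

theorem dual_depOn {A : Set SqE → Prop} {s s' : Set SqE} (hA : DepOn A s)
    (h : ∀ e ∈ s, undual e ∈ s') : DepOn (fun t => A (dualCfg t)) s' := fun t => by
  refine hA.inter_eq ?_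
  ext e
  have := h e
  simp only [dualCfg, mem_inter_iff, mem_ofPred_eq]
  tauto

/-- The edges on which the good event depends. -/
def goodE (n ρ : ℕ) : Set SqE := (boxE (ρ + 2) : Set SqE) ∩ (ins sqG (segS n))ᶜ

theorem undual_mem_goodE {e : SqE} (he : e ∈ (boxE ρ : Set SqE) ∩
    (ins sqG (segS n)ᶜ ∪ {e | e.2.1 = 0 ∧ e.2.2 = false})) : undual e ∈ goodE n ρ := by
  refine ⟨undual_mem he.1, ?_⟩
  have h := he.2
  obtain ⟨a, b, c⟩ := e
  cases c <;> simp [ins, sqG, undual, segS] at h ⊢ <;> omega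

theorem good_depOn {k₁ k₂ k₃ k₄ : ℕ} (hρ : n ≤ ρ) (h1 : k₁ ≤ n) (h2 : k₂ ≤ n) (h3 : k₃ ≤ n)
    (h4 : k₄ ≤ n) : DepOn (Good n ρ k₁ k₂ k₃ k₄) (goodE n ρ) := by
  have hsub : armE n ρ ⊆ goodE n ρ :=
    inter_subset_inter_left _ (Finset.coe_subset.2 (boxE_mono (by omega)))
  have hu : ∀ k l, l ≤ n → DepOn (fun t => ArmUp n ρ k l (dualCfg t)) (goodE n ρ) := fun k l hl =>
    dual_depOn (armUp_depOn hρ hl) fun e he => undual_mem_goodE he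
  have hd : ∀ k l, DepOn (fun t => PathDown n ρ k l (dualCfg t)) (goodE n ρ) := fun k l =>
    dual_depOn pathDown_depOn fun e he => undual_mem_goodE ⟨he.1, Or.inl he.2⟩
  exact ((((arm_depOn hρ h1).mono hsub).and (((arm_depOn hρ h3).mono hsub).and
    ((arm_depOn hρ le_rfl).mono hsub)))).and
    (((hu _ _ h2).and (hd _ _)).and ((hu _ _ h4).and (hd _ _)))

theorem Pr_and_ge_of {E : Type*} [DecidableEq E] {p : E → ℝ} {s : Finset E} (hp : Unit01 p)
    {A B : Set E → Prop} {a b : ℝ} (hA : 1 - a ≤ Pr p s A) (hB : 1 - b ≤ Pr p s B) :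
    1 - (a + b) ≤ Pr p s fun t => A t ∧ B t := by
  have h1 := Pr_or_le (s := s) hp (fun t => ¬A t) fun t => ¬B t
  have h2 := Pr_not (p := p) (s := s) fun t => A t ∧ B t
  simp only [not_and_or] at h2
  rw [h2, Pr_not, Pr_not] at h1
  linarith

section

variable {p : ℝ}

theorem pr_not_arm_succ (hp : p ∈ Ioo (0 : ℝ) 1) (n ρ k : ℕ) : (p * (1 - p)) ^ 4 ≤
    Pr (sqInt p (1 - p)) (boxE ρ) fun t => ¬Arm n ρ k (k + 1) t := by
  have hu := sqInt_unit (p := p) ⟨hp.1.le, hp.2.le⟩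
  have h0 := hp.1
  have h1 := hp.2
  set a := sqInc ((k : ℤ), 0) ∩ boxE ρ with ha
  have hcard : a.card ≤ 4 :=
    (Finset.card_le_card Finset.inter_subset_left).trans Finset.card_le_four
  calc (p * (1 - p)) ^ 4 ≤ (p * (1 - p)) ^ a.card :=
        pow_le_pow_of_le_one (by nlinarith) (by nlinarith) hcard
    _ = ∏ _e ∈ a, p * (1 - p) := by rw [Finset.prod_const]
    _ ≤ ∏ e ∈ a, (1 - sqInt p (1 - p) e) := by
        refine Finset.prod_le_prod (fun _ _ => by nlinarith) fun e _ => ?_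
        unfold sqInt
        split_ifs <;> nlinarith
    _ = Pr (sqInt p (1 - p)) (boxE ρ) fun t => Disjoint (↑a) t :=
        (Pr_disjoint a Finset.inter_subset_right).symm
    _ ≤ _ := by
        refine Pr_mono hu fun t ht hdis => ?_
        rintro ⟨i, hi1, hi2, u, _, ⟨e, he, hG⟩, _⟩
        have : i = k := by omega
        subst this
        refine Set.disjoint_left.1 hdis ?_ he
        rw [ha, Finset.coe_inter]
        refine ⟨(isInc_sq _ e).2 ?_, ht he⟩
        rcases hG with hG | hG <;> simp [hG]

theorem pr_dual_arms (hp : p ∈ Ioo (0 : ℝ) 1) (hρ : n ≤ ρ) (hk : 0 < k) (hl : l < n)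
    (h : Pr (sqInt p (1 - p)) (boxE ρ) (fun t => ¬Arm n ρ k l t) ≤ 1 / 100) :
    1 - (1 / 10 + 1 / 10) ≤ Pr (sqInt p (1 - p)) (boxE (ρ + 2)) fun t =>
      ArmUp n ρ k l (dualCfg t) ∧ PathDown n ρ k l (dualCfg t) := by
  have hu := sqInt_unit (p := p) ⟨hp.1.le, hp.2.le⟩
  set m := sqInt p (1 - p)
  set W := boxE (ρ + 2)
  have hsub : boxE ρ ⊆ W := boxE_mono (by omega)
  have hdU : DepOn (ArmUp n ρ k l) (boxE ρ) := (armUp_depOn hρ hl.le).mono inter_subset_left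
  have hdD : DepOn (ArmDown n ρ k l) (boxE ρ) := armDown_depOn hρ hl.le
  have hUD : Pr m W (ArmUp n ρ k l) ≤ Pr m W (ArmDown n ρ k l) := by
    rw [Pr_of_subset hsub hdU, ← Pr_refl p (1 - p) (fun e he => reflE_mem he) hdU]
    exact Pr_mono hu fun t _ ht => armDown_of_refl ht
  have hDU : Pr m W (ArmDown n ρ k l) ≤ Pr m W (ArmUp n ρ k l) := by
    rw [Pr_of_subset hsub hdD, ← Pr_refl p (1 - p) (fun e he => reflE_mem he) hdD]
    exact Pr_mono hu fun t _ ht => armUp_of_refl ht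
  have hprod := Pr_not_and_ge (s := W) hu (armUp_monotone (n := n) (ρ := ρ) (k := k) (l := l))
    (armDown_monotone (n := n) (ρ := ρ) (k := k) (l := l))
  have harm : Pr m W (fun t => ¬ArmUp n ρ k l t ∧ ¬ArmDown n ρ k l t) ≤ 1 / 100 := by
    refine (Pr_mono hu fun t _ ht => ?_).trans (((Pr_of_subset hsub
      ((arm_depOn hρ hl.le).mono inter_subset_left).not).le).trans h)
    exact fun ha => (arm_up_or_down hk hl ha).elim ht.1 ht.2
  rw [Pr_not, Pr_not] at hprod
  have hU : 1 - 1 / 10 ≤ Pr m W (ArmUp n ρ k l) := by nlinarith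
  refine Pr_and_ge_of hu ?_ ?_
  · rw [Pr_dual p (fun e he => undual_mem he) hdU, ← Pr_of_subset hsub hdU]
    exact hU
  · have hdP : DepOn (PathDown n ρ k l) (boxE ρ) := pathDown_depOn.mono inter_subset_left
    rw [Pr_dual p (fun e he => undual_mem he) hdP, ← Pr_of_subset hsub hdP]
    refine (hU.trans hUD).trans (Pr_mono hu fun t _ ht => ?_)
    obtain ⟨i, h1, h2, _, h3⟩ := ht
    exact ⟨i, h1, h2, h3⟩

/-- If the origin percolates, good configurations have probability bounded below. -/
theorem exists_good (hp : p ∈ Ioo (0 : ℝ) 1) {θ : ℝ} (hθ : 0 < θ)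
    (h : ∀ R, θ < Pr (sqInt p (1 - p)) (boxE R) (Exits sqG (box R) (0, 0))) :
    ∃ n : ℕ, 0 < n ∧ ∃ c : ℝ, 0 < c ∧ ∀ ρ, n ≤ ρ → ∃ k₁ k₂ k₃ k₄ : ℕ, 0 < k₁ ∧ k₁ < k₂ ∧ k₂ < k₃ ∧
      k₃ < k₄ ∧ k₄ < n ∧ c ≤ Pr (sqInt p (1 - p)) (boxE (ρ + 2)) fun t =>
        (segE n : Set SqE) ⊆ t ∧ Good n ρ k₁ k₂ k₃ k₄ t := by
  have hu := sqInt_unit (p := p) ⟨hp.1.le, hp.2.le⟩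
  have hp0 := hp.1
  have hp1 := hp.2
  set m := sqInt p (1 - p) with hm
  set c := (p * (1 - p)) ^ 4 with hc
  have hc0 : 0 < c := pow_pos (mul_pos hp0 (by linarith)) 4
  have hc1 : c ≤ 1 := pow_le_one₀ (by nlinarith) (by nlinarith)
  set ε : ℝ := 1 / 100 with hε
  set δ := ε * c with hδ
  have hδ0 : 0 < δ := by positivity
  have hδ1 : δ ≤ 1 := by rw [hδ, hε]; linarith
  obtain ⟨n, hn⟩ := segTrapped_small hp hθ h (η := ε * δ ^ 4) (by positivity)
  have hsmall : ε * δ ^ 4 ≤ ε := mul_le_of_le_one_right (by norm_num) (pow_le_one₀ hδ0.le hδ1)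
  have hnpos : 0 < n := by
    rcases Nat.eq_zero_or_pos n with rfl | h'
    · have h1 := hn 0
      rw [Pr, Ex_congr (g := fun _ => 1) (fun _ _ => rfl) fun t _ =>
        ind_true (show SegTrapped 0 0 t from fun i hi => absurd hi (Nat.not_lt_zero i)), Ex_const] at h1
      have : ε < 1 := by norm_num
      linarith
    · exact h'
  refine ⟨n, hnpos, (∏ e ∈ segE n, m e) * (1 / 2),
    mul_pos (Finset.prod_pos fun e _ => ?_) (by norm_num), fun ρ hρ => ?_⟩
  · rw [hm]
    unfold sqInt
    split_ifs <;> linarith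
  set a : ℕ → ℕ → ℝ := fun k l => Pr m (boxE ρ) fun t => ¬Arm n ρ k l t with ha
  have han : a 0 n ≤ ε * δ ^ 4 := (Pr_mono hu fun t _ ht => not_arm_segTrapped hρ ht).trans (hn ρ)
  have ha0 : ∀ k l, 0 ≤ a k l := fun k l => Pr_nonneg hu _
  have ha1 : ∀ k, a k k = 1 := fun k => by
    rw [ha]
    dsimp only
    rw [Pr, Ex_congr (g := fun _ => 1) (fun _ _ => rfl) fun t _ => ind_true ?_, Ex_const]
    rintro ⟨i, h1, h2, _⟩
    omega
  have ham : ∀ k l r, k ≤ l → l ≤ r → a k l * a l r ≤ a k r := fun k l r _ _ => by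
    refine (Pr_not_and_ge hu arm_monotone arm_monotone).trans (Pr_mono hu fun t _ ht => ?_)
    rintro ⟨i, h1, h2, h3⟩
    rcases lt_or_ge i l with h | h
    exacts [ht.1 ⟨i, h1, h, h3⟩, ht.2 ⟨i, h, h2, h3⟩]
  have step : ∀ (j k : ℕ), k ≤ n → a k n ≤ ε * δ ^ (j + 1) →
      ∃ k', k < k' ∧ k' ≤ n ∧ a k k' ≤ ε ∧ a k' n ≤ ε * δ ^ j := by
    intro j k hk hak
    obtain ⟨k', h1, h2, h3, h4⟩ := exists_small_piece hc0 (by norm_num) (by norm_num) ha0 ha1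
      (pr_not_arm_succ hp n ρ) ham hk hak
      (mul_le_of_le_one_right (by norm_num) (pow_le_one₀ hδ0.le hδ1))
    refine ⟨k', h1, h2, h3, h4.trans_eq ?_⟩
    change ε * δ ^ (j + 1) / δ = _
    rw [pow_succ, ← mul_assoc, mul_div_assoc, div_self hδ0.ne', mul_one]
  obtain ⟨k₁, h1, h1n, e0, f1⟩ := step 3 0 (Nat.zero_le _) han
  obtain ⟨k₂, h2, h2n, e1, f2⟩ := step 2 k₁ h1n f1
  obtain ⟨k₃, h3, h3n, e2, f3⟩ := step 1 k₂ h2n f2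
  obtain ⟨k₄, h4, h4n, e3, e4⟩ := step 0 k₃ h3n (by simpa using f3)
  rw [pow_zero, mul_one] at e4
  have h4n' : k₄ < n := by
    refine lt_of_le_of_ne h4n ?_
    rintro rfl
    rw [ha1] at e4
    norm_num [hε] at e4
  refine ⟨k₁, k₂, k₃, k₄, h1, h2, h3, h4, h4n', ?_⟩
  set W := boxE (ρ + 2) with hW
  have hsub : boxE ρ ⊆ W := boxE_mono (by omega)
  have harm : ∀ k l, l ≤ n → a k l ≤ ε → 1 - ε ≤ Pr m W (Arm n ρ k l) := by
    intro k l hl hkl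
    have hd : DepOn (Arm n ρ k l) (boxE ρ) := (arm_depOn hρ hl).mono inter_subset_left
    rw [Pr_of_subset hsub hd]
    rw [ha] at hkl
    dsimp only at hkl
    rw [Pr_not] at hkl
    linarith
  have hgood : 1 / 2 ≤ Pr m W (Good n ρ k₁ k₂ k₃ k₄) := by
    have := Pr_and_ge_of hu (Pr_and_ge_of hu (harm 0 k₁ h1n e0) (Pr_and_ge_of hu (harm k₂ k₃ h3n e2)
      (harm k₄ n le_rfl e4))) (Pr_and_ge_of hu
      (pr_dual_arms hp hρ h1 (by omega) e1) (pr_dual_arms hp hρ (by omega) (by omega) e3))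
    refine le_trans ?_ this
    norm_num [hε]
  have hdis : Disjoint (segE n) (W \ segE n) := Finset.disjoint_sdiff
  have hsegW : segE n ⊆ W := by
    intro e he
    obtain ⟨i, hi, rfl⟩ := Finset.mem_image.1 he
    rw [Finset.mem_range] at hi
    exact mem_boxE_of_coord (by push_cast; omega)
  have hdG : DepOn (Good n ρ k₁ k₂ k₃ k₄) (W \ segE n : Finset SqE) := by
    refine (good_depOn hρ h1n h2n h3n h4n).mono fun e he => ?_
    rw [Finset.mem_coe, Finset.mem_sdiff]
    refine ⟨he.1, fun h => he.2 ?_⟩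
    obtain ⟨i, hi, rfl⟩ := Finset.mem_image.1 h
    rw [Finset.mem_range] at hi
    simp [ins, sqG, segS]
    omega
  rw [← Finset.union_sdiff_of_subset hsegW, Pr_and_of_disjoint hdis
    (A := fun t => (segE n : Set SqE) ⊆ t) (fun t => by simp) hdG,
    Pr_subset _ subset_rfl]
  refine mul_le_mul_of_nonneg_left ?_ (Finset.prod_nonneg fun e _ => (hu e).1)
  rw [← Pr_of_subset Finset.sdiff_subset hdG]
  exact hgood

end

end

section

variable {n ρ : ℕ} {t : Set SqE} {Λ : Set (ℤ × ℤ)}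

/-- The edges that meet `Λ`. -/
def meets (Λ : Set (ℤ × ℤ)) : Set SqE := {e | (sqG e).1 ∈ Λ ∨ (sqG e).2 ∈ Λ}

/-- The outer boundary of `Λ`. -/
def outer (Λ : Set (ℤ × ℤ)) : Set (ℤ × ℤ) := {y | y ∉ Λ ∧ ∃ u ∈ Λ, Adj sqG univ u y}

theorem Adj.inter_meets {u v : ℤ × ℤ} (h : Adj sqG t u v) (hu : u ∈ Λ) :
    Adj sqG (t ∩ meets Λ) u v := by
  obtain ⟨e, he, h⟩ := h
  refine ⟨e, ⟨he, ?_⟩, h⟩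
  rcases h with h | h <;> simp [meets, h, hu]

theorem arm_to_outer {k l : ℕ} (hS : segS n ⊆ Λ) (hΛ : Λ ⊆ (box ρ : Set (ℤ × ℤ))) (hl : l ≤ n)
    (h : Arm n ρ k l t) : ∃ i : ℕ, k ≤ i ∧ i < l ∧ ∃ u, u ∉ segS n ∧
      Adj sqG (t ∩ meets Λ) ((i : ℤ), 0) u ∧
        ∃ y ∈ outer Λ, Off sqG (t ∩ meets Λ) (segS n) u y := by
  obtain ⟨i, h1, h2, u, hu, ha, z, hz, hc⟩ := h
  have hi : ((i : ℤ), (0 : ℤ)) ∈ Λ := hS ⟨by simp, by simp; omega, rfl⟩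
  refine ⟨i, h1, h2, u, hu, ha.inter_meets hi, ?_⟩
  by_cases huΛ : u ∈ Λ
  · rcases hc.stays_or_leaves huΛ with h | ⟨a, b, h3, h4, h5⟩
    · exact absurd (hΛ (h.mem_of_ins huΛ)) hz
    · have haΛ := h3.mem_of_ins huΛ
      have h6 : t ∩ ins sqG (segS n)ᶜ ∩ meets Λ ⊆ t ∩ meets Λ ∩ ins sqG (segS n)ᶜ :=
        fun e he => ⟨⟨he.1.1, he.2⟩, he.1.2⟩
      refine ⟨b, ⟨h4, a, haΛ, h5.mono (subset_univ _)⟩, ?_⟩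
      refine (h3.mono fun e he => ?_).trans ((h5.inter_meets haΛ).mono h6).conn
      exact ⟨⟨he.1.1, Or.inl he.2.1⟩, he.1.2⟩
  · exact ⟨u, ⟨huΛ, _, hi, ha.mono (subset_univ _)⟩, Conn.refl _⟩

theorem arms_separated {k₁ k₂ i i' : ℕ} {B : ℤ} {u u' y y' : ℤ × ℤ} (hseg : (segE n : Set SqE) ⊆ t)
    (hup : ArmUp n ρ k₁ k₂ (dualCfg t)) (hdn : PathDown n ρ k₁ k₂ (dualCfg t)) (hi : i < k₁)
    (hi' : k₂ ≤ i') (hn : i' < n)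
    (hB : ∀ e ∈ meets Λ, -B ≤ e.1 ∧ e.1 ≤ B ∧ -B ≤ e.2.1 ∧ e.2.1 ≤ B) (hBρ : B < ρ) (hnB : n ≤ B)
    (hu : u ∉ segS n) (hu' : u' ∉ segS n) (ha : Adj sqG (t ∩ meets Λ) ((i : ℤ), 0) u)
    (ha' : Adj sqG (t ∩ meets Λ) ((i' : ℤ), 0) u') (hc : Off sqG (t ∩ meets Λ) (segS n) u y)
    (hc' : Off sqG (t ∩ meets Λ) (segS n) u' y') : ¬Off sqG (t ∩ meets Λ) (segS n) y y' := by
  intro hyy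
  obtain ⟨e, he, hG⟩ := ha
  obtain ⟨e', he', hG'⟩ := ha'
  obtain ⟨x, hx1, hx2, hx3, hx4⟩ := hup
  obtain ⟨x', hx1', hx2', hx4'⟩ := hdn
  set τ := (t ∩ meets Λ ∩ ins sqG (segS n)ᶜ) ∪ {e, e'} with hτ
  have hτm : τ ⊆ t ∩ meets Λ := by
    rintro f (hf | rfl | rfl)
    exacts [hf.1, he, he']
  have hS : ∀ a : ℤ, k₁ ≤ a → a < k₂ → (a, (0 : ℤ)) ∈ segS n := fun a h1 h2 =>
    ⟨by simp; omega, by simp; omega, rfl⟩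
  have hends : ∀ a : ℤ, k₁ ≤ a → a < k₂ → ∀ f ∈ τ, (sqG f).1 ≠ (a, 0) := by
    rintro a h1 h2 f (hf | rfl | rfl) hfa
    · exact hf.2.1 (hfa ▸ hS a h1 h2)
    · rcases hG with hG | hG
      · rw [hG, Prod.mk.injEq] at hfa
        omega
      · rw [hG] at hfa
        exact hu ((show u = (a, 0) from hfa) ▸ hS a h1 h2)
    · rcases hG' with hG | hG
      · rw [hG, Prod.mk.injEq] at hfa
        omega
      · rw [hG] at hfa
        exact hu' ((show u' = (a, 0) from hfa) ▸ hS a h1 h2)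
  refine not_conn_of_dual (i₀ := i) (i₂ := i') (k₁ := k₁) (k₂ := k₂) (x := x) (x' := x')
    (τ := τ) (B := B) (hτm.trans inter_subset_left) (fun f hf => hB f (hτm hf).2) hBρ (by omega)
    (by omega) (fun j h1 h2 => hseg ?_) (by omega) (by omega) (by omega) (by omega) ?_ ?_ ?_ ?_ ?_
  · rw [segE, Finset.mem_coe, Finset.mem_image]
    exact ⟨j.toNat, by rw [Finset.mem_range]; omega, by ext <;> simp; omega⟩
  · exact fun h => hends x' (by omega) (by omega) _ h (by simp [sqG])
  · exact fun a h1 h2 h => hends a h1 h2 _ h (by simp [sqG])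
  · obtain ⟨z, hz, hcz⟩ := hx4
    refine ⟨z, hz, Conn.trans (Adj.conn ⟨_, hx3, Or.inl ?_⟩) (hcz.mono inter_subset_left)⟩
    simp [sqG]
  · exact hx4'.mono inter_subset_left
  · have h1 : Adj sqG τ ((i : ℤ), 0) u := ⟨e, Or.inr (by simp), hG⟩
    have h2 : Adj sqG τ ((i' : ℤ), 0) u' := ⟨e', Or.inr (by simp), hG'⟩
    refine h1.conn.trans (Conn.trans ?_ h2.symm.conn)
    exact ((hc.trans hyy).trans hc'.symm).mono subset_union_left

theorem Good.trifurcates {k₁ k₂ k₃ k₄ : ℕ} {B : ℤ} (h : Good n ρ k₁ k₂ k₃ k₄ t)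
    (hseg : (segE n : Set SqE) ⊆ t) (h12 : k₁ < k₂) (h23 : k₂ < k₃) (h34 : k₃ < k₄) (h4 : k₄ < n)
    (hS : segS n ⊆ Λ) (hΛ : Λ ⊆ (box ρ : Set (ℤ × ℤ)))
    (hB : ∀ e ∈ meets Λ, -B ≤ e.1 ∧ e.1 ≤ B ∧ -B ≤ e.2.1 ∧ e.2.1 ≤ B) (hBρ : B < ρ)
    (hnB : n ≤ B) : Trifurcates sqG (t ∩ meets Λ) (segS n) (outer Λ) := by
  obtain ⟨⟨hA, hA', hA''⟩, ⟨hU, hD⟩, hU', hD'⟩ := h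
  obtain ⟨i, _, hi, u, hu, ha, y, hy, hc⟩ := arm_to_outer hS hΛ (by omega) hA
  obtain ⟨i', hi1', hi', u', hu', ha', y', hy', hc'⟩ := arm_to_outer hS hΛ (by omega) hA'
  obtain ⟨i'', hi1'', hi'', u'', hu'', ha'', y'', hy'', hc''⟩ := arm_to_outer hS hΛ le_rfl hA''
  have s1 := arms_separated hseg hU hD hi hi1' (by omega) hB hBρ hnB hu hu' ha ha' hc hc'
  have s2 := arms_separated hseg hU hD hi (h23.le.trans (by omega : k₃ ≤ i'')) hi'' hB hBρ hnB hu
    hu'' ha ha'' hc hc''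
  have s3 := arms_separated hseg hU' hD' hi' hi1'' hi'' hB hBρ hnB hu' hu'' ha' ha'' hc' hc''
  have mem : ∀ j : ℕ, j < n → ((j : ℤ), (0 : ℤ)) ∈ segS n := fun j hj =>
    ⟨by simp, by simpa using hj, rfl⟩
  refine ⟨![y, y', y''], fun k => ?_, fun k l hkl h => ?_⟩
  · fin_cases k
    · exact ⟨hy, _, mem i (by omega), u, hu, ha, hc⟩
    · exact ⟨hy', _, mem i' (by omega), u', hu', ha', hc'⟩
    · exact ⟨hy'', _, mem i'' (by omega), u'', hu'', ha'', hc''⟩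
  · have h' : Off sqG (t ∩ meets Λ) (segS n) (![y, y', y''] l) (![y, y', y''] k) := Conn.symm h
    fin_cases k <;> fin_cases l <;>
      first
      | exact hkl rfl
      | exact s1 h
      | exact s2 h
      | exact s3 h
      | exact s1 h'
      | exact s2 h'
      | exact s3 h'

end

section

variable {n : ℕ} {t : Set SqE} {x : ℤ × ℤ} {S Y Λ : Set (ℤ × ℤ)}

theorem sqG_shiftE (x : ℤ × ℤ) (e : SqE) :
    sqG (shiftE x e) = ((sqG e).1 + x, (sqG e).2 + x) := by
  obtain ⟨a, b, i⟩ := e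
  cases i <;> simp [sqG, shiftE, Prod.ext_iff] <;> omega

theorem adj_shift {u v : ℤ × ℤ} (h : Adj sqG (shiftE x ⁻¹' t) u v) :
    Adj sqG t (u + x) (v + x) := by
  obtain ⟨e, he, h⟩ := h
  refine ⟨shiftE x e, he, ?_⟩
  rw [sqG_shiftE]
  rcases h with h | h <;> simp [h]

theorem off_shift {u v : ℤ × ℤ} :
    Off sqG (shiftE x ⁻¹' t) S u v ↔ Off sqG t {w | w - x ∈ S} (u + x) (v + x) := by
  unfold Off
  rw [← conn_shift]
  have : shiftE x ⁻¹' t ∩ ins sqG Sᶜ = shiftE x ⁻¹' (t ∩ ins sqG {w | w - x ∈ S}ᶜ) := by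
    ext e
    simp [ins, sqG_shiftE]
  rw [this]

theorem Trifurcates.shift (h : Trifurcates sqG (shiftE x ⁻¹' t) S Y) :
    Trifurcates sqG t {w | w - x ∈ S} {w | w - x ∈ Y} := by
  obtain ⟨y, hy, hyy⟩ := h
  refine ⟨fun k => y k + x, fun k => ?_, fun k l hkl h => hyy k l hkl (off_shift.2 h)⟩
  obtain ⟨h1, s, hs, u, hu, ha, hc⟩ := hy k
  exact ⟨by simpa using h1, s + x, by simpa using hs, u + x, by simpa using hu, adj_shift ha,
    off_shift.1 hc⟩

theorem meets_shift : meets {v | v + x ∈ Λ} = shiftE x ⁻¹' meets Λ := by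
  ext e
  simp [meets, sqG_shiftE]

theorem outer_shift {v : ℤ × ℤ} (h : v - x ∈ outer {v | v + x ∈ Λ}) : v ∈ outer Λ := by
  obtain ⟨h1, u, hu, ha⟩ := h
  refine ⟨by simpa using h1, u + x, hu, ?_⟩
  have := adj_shift (t := univ) (x := x) (u := u) (v := v - x) (by simpa using ha)
  simpa using this

theorem outer_box_subset (R : ℕ) : outer (box R : Set (ℤ × ℤ)) ⊆ (box (R + 1) \ box R :
    Finset (ℤ × ℤ)) := by
  rintro v ⟨h1, u, hu, ⟨⟨a, b, i⟩, -, hG⟩⟩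
  rw [Finset.mem_coe, Finset.mem_sdiff]
  refine ⟨?_, h1⟩
  rw [Finset.mem_coe] at hu
  cases i <;> simp only [sqG, Prod.ext_iff] at hG <;> rw [mem_box] at * <;> push_cast <;> simp at hG
    <;> omega

theorem card_box (R : ℕ) : (box R).card = (2 * R + 1) ^ 2 := by
  rw [box, Finset.card_product, Int.card_Icc, sq]
  congr 1 <;> omega

theorem card_box_sdiff (R : ℕ) : (box (R + 1) \ box R).card = 8 * R + 8 := by
  rw [Finset.card_sdiff_of_subset (box_mono (R.le_add_right 1)), card_box, card_box]
  have : (2 * (R + 1) + 1) ^ 2 = (2 * R + 1) ^ 2 + (8 * R + 8) := by ring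
  omega

theorem conn_segS (h : (segE n : Set SqE) ⊆ t) {u v : ℤ × ℤ} (hu : u ∈ segS n) (hv : v ∈ segS n) :
    Conn sqG (t ∩ ins sqG (segS n)) u v := by
  have key : ∀ i : ℕ, i < n → Conn sqG (t ∩ ins sqG (segS n)) (0, 0) ((i : ℤ), 0) := by
    intro i
    induction i with
    | zero => exact fun _ => Conn.refl _
    | succ i ih =>
      intro hi
      refine (ih (by omega)).trans (Adj.conn ⟨((i : ℤ), 0, true), ⟨h ?_, ?_⟩, Or.inl ?_⟩)
      · rw [segE, Finset.mem_coe, Finset.mem_image]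
        exact ⟨i, by rw [Finset.mem_range]; omega, rfl⟩
      · simp [ins, sqG, segS]
        omega
      · simp [sqG]
  have key' : ∀ w ∈ segS n, Conn sqG (t ∩ ins sqG (segS n)) (0, 0) w := by
    rintro ⟨a, b⟩ ⟨h1, h2, h3⟩
    have := key a.toNat (by dsimp only at h1 h2; omega)
    dsimp only at h1 h3
    subst h3
    rwa [Int.toNat_of_nonneg h1] at this
  exact (key' u hu).symm.trans (key' v hv)

theorem conn_segS_shift (h : (segE n : Set SqE) ⊆ shiftE x ⁻¹' t) {u v : ℤ × ℤ}
    (hu : u - x ∈ segS n) (hv : v - x ∈ segS n) :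
    Conn sqG (t ∩ ins sqG {w | w - x ∈ segS n}) u v := by
  have := conn_segS h hu hv
  have e : shiftE x ⁻¹' t ∩ ins sqG (segS n) =
      shiftE x ⁻¹' (t ∩ ins sqG {w | w - x ∈ segS n}) := by
    ext e
    simp [ins, sqG_shiftE]
  rw [e, conn_shift] at this
  simpa using this

/-- The lower left vertices of the segments that tile the box. -/
def corner (n : ℕ) (j : ℕ × ℕ) : ℤ × ℤ := ((n : ℤ) * j.1, (j.2 : ℤ))

theorem corner_disjoint {i j : ℕ × ℕ} (hij : i ≠ j) :
    Disjoint {w | w - corner n i ∈ segS n} {w | w - corner n j ∈ segS n} := by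
  refine Set.disjoint_left.2 ?_
  rintro ⟨a, b⟩ ⟨h1, h2, h3⟩ ⟨h4, h5, h6⟩
  simp only [corner, Prod.fst_sub, Prod.snd_sub] at h1 h2 h3 h4 h5 h6
  refine hij (Prod.ext ?_ (by omega))
  by_contra hne
  rcases lt_or_gt_of_ne hne with h | h
  · have : (n : ℤ) * (i.1 + 1) ≤ n * j.1 := mul_le_mul_of_nonneg_left (by omega) (by omega)
    linarith
  · have : (n : ℤ) * (j.1 + 1) ≤ n * i.1 := mul_le_mul_of_nonneg_left (by omega) (by omega)
    linarith

theorem corner_mem_box {M : ℕ} (hn : 0 < n) {j : ℕ × ℕ} (hj : j ∈ Finset.range M ×ˢ Finset.range M)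
    {v : ℤ × ℤ} (hv : v ∈ segS n) : v + corner n j ∈ box (n * M) := by
  obtain ⟨h1, h2, h3⟩ := hv
  rw [Finset.mem_product, Finset.mem_range, Finset.mem_range] at hj
  rw [mem_box]
  simp only [corner, Prod.fst_add, Prod.snd_add]
  have h4 : (n : ℤ) * (j.1 + 1) ≤ n * M := mul_le_mul_of_nonneg_left (by omega) (by omega)
  have h5 : (0 : ℤ) ≤ n * j.1 := by positivity
  have h6 : (1 : ℤ) * M ≤ n * M := mul_le_mul_of_nonneg_right (by omega) (by omega)
  push_cast
  refine ⟨?_, ?_, ?_, ?_⟩ <;> nlinarith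

theorem card_good_le {M : ℕ} (hn : 0 < n) {k₁ k₂ k₃ k₄ : ℕ} (h12 : k₁ < k₂) (h23 : k₂ < k₃)
    (h34 : k₃ < k₄) (h4 : k₄ < n) (J : Finset (ℕ × ℕ))
    (hJ : J ⊆ Finset.range M ×ˢ Finset.range M)
    (h : ∀ j ∈ J, (segE n : Set SqE) ⊆ shiftE (corner n j) ⁻¹' t ∧
      Good n (3 * (n * M) + 10) k₁ k₂ k₃ k₄ (shiftE (corner n j) ⁻¹' t)) :
    J.card ≤ 8 * (n * M) + 8 := by
  classical
  rw [← card_box_sdiff, ← Finset.card_attach]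
  set R := n * M with hR
  set Λ : Set (ℤ × ℤ) := (box R : Set (ℤ × ℤ)) with hΛ
  refine card_trifurcations_le (G := sqG) (t := t ∩ meets Λ)
    (fun j : {j // j ∈ J} => {w | w - corner n j.1 ∈ segS n}) ?_ ?_ _ _ ?_ ?_
  · rintro ⟨j, hj⟩ u hu v hv
    refine (conn_segS_shift (h j hj).1 hu hv).mono fun e he => ⟨⟨he.1, Or.inl ?_⟩, he.2⟩
    have := corner_mem_box hn (hJ hj) he.2.1
    rwa [sub_add_cancel] at this
  · rintro ⟨j, hj⟩
    exact ⟨corner n j, by simp [segS]; omega⟩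
  · exact fun i _ j _ hij => corner_disjoint fun h => hij (Subtype.ext h)
  · rintro ⟨j, hj⟩ _
    have hj' := hJ hj
    rw [Finset.mem_product, Finset.mem_range, Finset.mem_range] at hj'
    have hM : n ≤ R := Nat.le_mul_of_pos_right n (by omega)
    have c1 : (0 : ℤ) ≤ n * j.1 := by positivity
    have c2 : (n : ℤ) * j.1 ≤ R := by
      rw [hR]
      push_cast
      exact mul_le_mul_of_nonneg_left (by omega) (by omega)
    have c3 : (j.2 : ℤ) ≤ R := by
      have : M ≤ n * M := Nat.le_mul_of_pos_left M hn
      omega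
    have key := (h j hj).2.trifurcates (h j hj).1 h12 h23 h34 h4
      (Λ := {v | v + corner n j ∈ Λ}) (B := 2 * R + 2) (fun v hv => corner_mem_box hn (hJ hj) hv)
      ?_ ?_ ?_ ?_
    · rw [meets_shift, ← preimage_inter] at key
      obtain ⟨y, hy, hyy⟩ := key.shift
      exact ⟨y, fun k => ⟨outer_box_subset R (outer_shift (hy k).1), (hy k).2⟩, hyy⟩
    · rintro ⟨a, b⟩ hv
      rw [mem_ofPred_eq, hΛ, Finset.mem_coe, mem_box] at hv
      simp only [corner, Prod.mk_add_mk] at hv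
      rw [Finset.mem_coe, mem_box]
      dsimp only
      push_cast
      omega
    · rintro ⟨a, b, i⟩ he
      simp only [meets, mem_ofPred_eq, hΛ, Finset.mem_coe, mem_box, corner] at he
      cases i <;> simp [sqG] at he ⊢ <;> omega
    · push_cast
      omega
    · omega

/-- The origin does not percolate on the square lattice at the self-dual point. -/
theorem sq_theta_small {p : ℝ} (hp : p ∈ Ioo (0 : ℝ) 1) {ε : ℝ} (hε : 0 < ε) :
    ∃ R : ℕ, Pr (sqInt p (1 - p)) ((box R).biUnion sqInc) (Exits sqG (box R) (0, 0)) ≤ ε := by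
  classical
  by_contra! hcon
  have hu := sqInt_unit (p := p) ⟨hp.1.le, hp.2.le⟩
  obtain ⟨n, hn, c, hc, h⟩ := exists_good hp hε hcon
  obtain ⟨M, hM⟩ := exists_nat_gt ((8 * n + 8) / c)
  have hMc : 8 * n + 8 < c * M := by
    rw [div_lt_iff₀ hc] at hM
    linarith
  have hM1 : 1 ≤ M := by
    rcases Nat.eq_zero_or_pos M with rfl | h'
    · simp at hMc
      linarith [(Nat.cast_nonneg n : (0 : ℝ) ≤ n)]
    · exact h'
  have hnR : n ≤ n * M := Nat.le_mul_of_pos_right n hM1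
  obtain ⟨k₁, k₂, k₃, k₄, _, h12, h23, h34, h4, hPr⟩ := h (3 * (n * M) + 10) (by omega)
  set A : Set SqE → Prop := fun t => (segE n : Set SqE) ⊆ t ∧
    Good n (3 * (n * M) + 10) k₁ k₂ k₃ k₄ t with hA
  set W := boxE (4 * (n * M) + 20) with hW
  set J := Finset.range M ×ˢ Finset.range M with hJ
  have hdep : DepOn A (boxE (3 * (n * M) + 10 + 2) : Set SqE) := by
    refine DepOn.and (fun t => ?_) ((good_depOn (by omega) (by omega) (by omega) (by omega)
      (by omega)).mono inter_subset_left)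
    refine propext ⟨fun h => h.trans inter_subset_left, fun h => subset_inter h ?_⟩
    intro e he
    obtain ⟨i, hi, rfl⟩ := Finset.mem_image.1 he
    rw [Finset.mem_range] at hi
    exact mem_boxE_of_coord (by push_cast; omega)
  have h1 : ∀ j ∈ J, c ≤ Pr (sqInt p (1 - p)) W fun t => A (shiftE (corner n j) ⁻¹' t) := by
    intro j hj
    have hj' := hj
    rw [hJ, Finset.mem_product, Finset.mem_range, Finset.mem_range] at hj'
    rw [Pr_shift p (1 - p) _ (fun e he => ?_) hdep]
    · exact hPr
    · have c1 : (0 : ℤ) ≤ n * j.1 := by positivity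
      have c2 : (n : ℤ) * j.1 ≤ n * M := mul_le_mul_of_nonneg_left (by omega) (by omega)
      have c3 : (j.2 : ℤ) ≤ n * M := by
        have : M ≤ n * M := Nat.le_mul_of_pos_left M hn
        have : (M : ℤ) ≤ n * M := by exact_mod_cast this
        omega
      have := boxE_coord he
      push_cast at this
      refine mem_boxE_of_coord ?_
      simp only [shiftE, corner]
      push_cast
      omega
  have h2 : ∑ j ∈ J, (Pr (sqInt p (1 - p)) W fun t => A (shiftE (corner n j) ⁻¹' t)) ≤
      8 * (n * M) + 8 := by
    unfold Pr
    rw [← Ex_sum]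
    refine (Ex_mono hu fun t _ => ?_).trans (Ex_const (s := W) _).le
    have : ∑ j ∈ J, ind (A (shiftE (corner n j) ⁻¹' t)) =
        ((J.filter fun j => A (shiftE (corner n j) ⁻¹' t)).card : ℝ) := by
      rw [Finset.card_filter]
      push_cast
      exact Finset.sum_congr rfl fun j _ => by unfold ind; congr
    rw [this]
    exact_mod_cast card_good_le hn h12 h23 h34 h4 _ (Finset.filter_subset _ J)
      fun j hj => (Finset.mem_filter.1 hj).2
  have h3 := (Finset.card_nsmul_le_sum J _ c h1).trans h2
  rw [hJ, Finset.card_product, Finset.card_range, nsmul_eq_mul] at h3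
  push_cast at h3
  have hM1' : (1 : ℝ) ≤ M := by exact_mod_cast hM1
  nlinarith

end

section Subcritical

variable {p δ : ℝ} {q q' : ℤ → ℝ}

theorem kappaT_add_le {a b c a' b' c' y : ℝ} (ha : 0 ≤ a) (hb : 0 ≤ b) (hc : 0 ≤ c) (ha' : a ≤ a')
    (hb' : b ≤ b') (hc' : c ≤ c') (hay : a' ≤ a + y) (hby : b' ≤ b + y) (hcy : c' ≤ c + y) :
    kappaT a' b' c' ≤ kappaT a b c + 3 * y := by
  have ha0 : 0 ≤ a' := ha.trans ha'
  have hb0 : 0 ≤ b' := hb.trans hb'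
  have : a * b * c ≤ a' * b' * c' := by gcongr
  unfold kappaT
  linarith

theorem kappaH_add_le {a b c a' b' c' y : ℝ} (ha : a' ≤ 1) (hb : b' ≤ 1) (hc : c' ≤ 1)
    (ha' : a ≤ a') (hb' : b ≤ b') (hc' : c ≤ c') (hay : a' ≤ a + y) (hby : b' ≤ b + y)
    (hcy : c' ≤ c + y) : kappaH a' b' c' ≤ kappaH a b c + 3 * y := by
  have h : kappaT (1 - a) (1 - b) (1 - c) ≤ kappaT (1 - a') (1 - b') (1 - c') + 3 * y :=
    kappaT_add_le (by linarith) (by linarith) (by linarith) (by linarith) (by linarith)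
      (by linarith) (by linarith) (by linarith) (by linarith)
  unfold kappaH
  linarith

theorem sprinkle_triHI (y : ℝ) : sprinkle (triHI p q q') y =
    triHI (1 - (1 - p) * (1 - y)) (fun n => 1 - (1 - q n) * (1 - y))
      fun n => 1 - (1 - q' n) * (1 - y) := by
  funext e
  unfold sprinkle triHI
  split_ifs <;> rfl

theorem sprinkle_bounds {a y : ℝ} (ha : a ∈ Icc (0 : ℝ) 1) (hy : 0 ≤ y) (hy1 : y ≤ 1) :
    1 - (1 - a) * (1 - y) ∈ Icc (0 : ℝ) 1 ∧ a ≤ 1 - (1 - a) * (1 - y) ∧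
      1 - (1 - a) * (1 - y) ≤ a + y := by
  obtain ⟨h0, h1⟩ := ha
  refine ⟨⟨?_, ?_⟩, ?_, ?_⟩ <;> nlinarith

theorem tri_exp_tail (hp : p ∈ Ioo (0 : ℝ) 1) (hq : ∀ n, q n ∈ Icc (0 : ℝ) 1)
    (hq' : ∀ n, q' n ∈ Icc (0 : ℝ) 1) (hδ : 0 < δ) (hκ : ∀ n, kappaT p (q n) (q' n) ≤ -δ) :
    ∃ C : ℝ, 0 < C ∧ ∃ d : ℝ, 0 < d ∧ ∀ (x : ℤ × ℤ) (D : Finset (ℤ × ℤ)) (k : ℕ),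
      Pr (triHI p q q') (insF triG triInc D) (fun t => k ≤ (clF triG D {x} t).card) ≤
        C * Real.exp (-d * k) := by
  have hp' : p ∈ Icc (0 : ℝ) 1 := ⟨hp.1.le, hp.2.le⟩
  set y := min (δ / 3) (1 / 2) with hy
  have hy0 : 0 < y := lt_min (by linarith) (by norm_num)
  have hy1 : y ≤ 1 / 2 := min_le_right _ _
  have hyδ : 3 * y ≤ δ := by linarith [min_le_left (δ / 3) (1 / 2 : ℝ)]
  have hb := fun {a : ℝ} (ha : a ∈ Icc (0 : ℝ) 1) => sprinkle_bounds ha hy0.le (by linarith)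
  refine exists_exp_tail isInc_tri (triHI_unit hp' hq hq') (fun v => Finset.card_le_six) hy0
    (by linarith) fun c hc => ?_
  have hps : 1 - (1 - p) * (1 - y) ∈ Ioo (0 : ℝ) 1 := by
    obtain ⟨h0, h1⟩ := hp
    constructor <;> nlinarith
  obtain ⟨K, hK⟩ := tri_exit_small hps (fun ε hε => sq_theta_small hps hε) hc
  refine ⟨K, fun x => ?_⟩
  rw [sprinkle_triHI]
  refine hK _ _ (fun n => (hb (hq n)).1) (fun n => (hb (hq' n)).1) (fun n => ?_) x
  have := kappaT_add_le hp'.1 (hq n).1 (hq' n).1 (hb hp').2.1 (hb (hq n)).2.1 (hb (hq' n)).2.1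
    (hb hp').2.2 (hb (hq n)).2.2 (hb (hq' n)).2.2
  linarith [hκ n]

theorem hex_exp_tail (hp : p ∈ Ioo (0 : ℝ) 1) (hq : ∀ n, q n ∈ Icc (0 : ℝ) 1)
    (hq' : ∀ n, q' n ∈ Icc (0 : ℝ) 1) (hδ : 0 < δ) (hκ : ∀ n, kappaH p (q n) (q' n) ≤ -δ) :
    ∃ C : ℝ, 0 < C ∧ ∃ d : ℝ, 0 < d ∧ ∀ (x : Bool × ℤ × ℤ) (D : Finset (Bool × ℤ × ℤ)) (k : ℕ),
      Pr (triHI p q q') (insF hexG hexInc D) (fun t => k ≤ (clF hexG D {x} t).card) ≤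
        C * Real.exp (-d * k) := by
  have hp' : p ∈ Icc (0 : ℝ) 1 := ⟨hp.1.le, hp.2.le⟩
  set y := min (δ / 3) (1 / 2) with hy
  have hy0 : 0 < y := lt_min (by linarith) (by norm_num)
  have hy1 : y ≤ 1 / 2 := min_le_right _ _
  have hyδ : 3 * y ≤ δ := by linarith [min_le_left (δ / 3) (1 / 2 : ℝ)]
  have hb := fun {a : ℝ} (ha : a ∈ Icc (0 : ℝ) 1) => sprinkle_bounds ha hy0.le (by linarith)
  refine exists_exp_tail isInc_hex (triHI_unit hp' hq hq') (Δ := 3) (fun v => ?_) hy0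
    (by linarith) fun c hc => ?_
  · unfold hexInc
    split_ifs <;> exact Finset.card_le_three
  have hps : 1 - (1 - p) * (1 - y) ∈ Ioo (0 : ℝ) 1 := by
    obtain ⟨h0, h1⟩ := hp
    constructor <;> nlinarith
  obtain ⟨K, hK⟩ := hex_exit_small hps
    (fun ε hε => sq_theta_small ⟨by linarith [hps.2], by linarith [hps.1]⟩ hε) hc
  refine ⟨K, fun x => ?_⟩
  rw [sprinkle_triHI]
  refine hK _ _ (fun n => (hb (hq n)).1) (fun n => (hb (hq' n)).1) (fun n => ?_) x
  have := kappaH_add_le (hb hp').1.2 (hb (hq n)).1.2 (hb (hq' n)).1.2 (hb hp').2.1 (hb (hq n)).2.1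
    (hb (hq' n)).2.1 (hb hp').2.2 (hb (hq n)).2.2 (hb (hq' n)).2.2
  linarith [hκ n]

end Subcritical

section Cut

variable {V V' E : Type*}

/-- The edges with exactly one endpoint in `C`. -/
def cut (G : E → V × V) (C : Set V) : Set E := {e | ¬((G e).1 ∈ C ↔ (G e).2 ∈ C)}

theorem chi_cut (G : E → V × V) (C : Set V) (e : E) :
    chi (e ∈ cut G C) = chi ((G e).1 ∈ C) + chi ((G e).2 ∈ C) := by
  have h : e ∈ cut G C ↔ ¬((G e).1 ∈ C ↔ (G e).2 ∈ C) := Iff.rfl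
  by_cases h1 : (G e).1 ∈ C <;> by_cases h2 : (G e).2 ∈ C <;> simp [chi, h, h1, h2]
  decide

theorem cut_finite {G : E → V × V} {inc : V → Finset E} (hinc : IsInc G inc) {C : Set V}
    (hC : C.Finite) : (cut G C).Finite := by
  refine (hC.biUnion (t := fun v => (inc v : Set E)) fun v _ => (inc v).finite_toSet).subset ?_
  intro e he
  have h : ¬((G e).1 ∈ C ↔ (G e).2 ∈ C) := he
  by_cases h1 : (G e).1 ∈ C
  · exact mem_biUnion h1 (Finset.mem_coe.2 ((hinc _ _).2 (Or.inl rfl)))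
  · have h2 : (G e).2 ∈ C := by tauto
    exact mem_biUnion h2 (Finset.mem_coe.2 ((hinc _ _).2 (Or.inr rfl)))

/-- If every even subset of the cut `Z` that contains all right edges contains a left edge, then
a right edge is joined to a left edge inside the cut. -/
theorem exists_cut_path [DecidableEq E] {G' : E → V' × V'} {inc' : V' → Finset E}
    (hinc : IsInc G' inc') {Z right left : Set E}
    (hpar : ∀ v, ∑ e ∈ inc' v, chi (e ∈ Z) = 0)
    (hline : ∀ Y ⊆ Z, (∀ v, ∑ e ∈ inc' v, chi (e ∈ Y) = 0) →
      (∀ e ∈ right, e ∈ Z → e ∈ Y) → ∃ e ∈ left, e ∈ Y) :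
    ∃ e ∈ right, e ∈ Z ∧ ∃ e' ∈ left, e' ∈ Z ∧ Conn G' Z (G' e).1 (G' e').1 := by
  let Y : Set E := {e' | e' ∈ Z ∧ ∃ e ∈ right, e ∈ Z ∧ Conn G' Z (G' e).1 (G' e').1}
  have hY : ∀ e', e' ∈ Y ↔ e' ∈ Z ∧ ∃ e ∈ right, e ∈ Z ∧ Conn G' Z (G' e).1 (G' e').1 :=
    fun _ => Iff.rfl
  have heven : ∀ v, ∑ e ∈ inc' v, chi (e ∈ Y) = 0 := by
    intro v
    have key : ∀ e ∈ inc' v, e ∈ Z → Conn G' Z (G' e).1 v := by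
      intro e he hZ
      obtain h | h := (hinc v e).1 he
      · rw [h]; exact Conn.refl _
      · rw [← h]; exact (adj_of_mem hZ).conn
    by_cases h : ∃ e ∈ inc' v, e ∈ Y
    · obtain ⟨e, he, hZ, f, hr, hf, hc⟩ := h
      rw [← hpar v]
      refine Finset.sum_congr rfl fun e' he' => congrArg chi (propext ⟨fun h => h.1, fun h => ?_⟩)
      exact ⟨h, f, hr, hf, (hc.trans (key e he hZ)).trans (key e' he' h).symm⟩
    · refine Finset.sum_eq_zero fun e he => ?_
      have : e ∉ Y := fun h' => h ⟨e, he, h'⟩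
      simp [chi, this]
  obtain ⟨e', hl, h⟩ := hline Y (fun e he => he.1) heven
    fun e hr he => ⟨he, e, hr, he, Conn.refl _⟩
  obtain ⟨hZ, e, hr, he, hc⟩ := (hY e').1 h
  exact ⟨e, hr, he, e', hl, hZ, hc⟩

end Cut

section Rows

/-- The parity of a row of edges. -/
noncomputable def rowPar (Y : Set TriE) (i : Fin 3) (b : ℤ) : ZMod 2 := ∑ᶠ a : ℤ, chi ((a, b, i) ∈ Y)

variable {Y : Set TriE}

theorem chi_finite {Y : Set TriE} (hY : Y.Finite) (i : Fin 3) (b k : ℤ) :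
    (fun a : ℤ => chi ((a + k, b, i) ∈ Y)).HasFiniteSupport := by
  refine (hY.preimage (f := fun a : ℤ => ((a + k, b, i) : TriE)) ?_).subset ?_
  · intro a _ a' _ h
    have := congrArg Prod.fst h
    simpa using this
  · intro a ha
    by_contra h
    have h' : ((a + k, b, i) : TriE) ∉ Y := h
    simp [chi, h'] at ha

theorem finsum_chi (Y : Set TriE) (i : Fin 3) (b k : ℤ) :
    ∑ᶠ a : ℤ, chi ((a + k, b, i) ∈ Y) = rowPar Y i b :=
  finsum_comp_equiv (Equiv.addRight k) (f := fun a : ℤ => chi ((a, b, i) ∈ Y))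

theorem finsum_shift (f : ℤ → ZMod 2) (k : ℤ) : ∑ᶠ a : ℤ, f (a + k) = ∑ᶠ a, f a :=
  finsum_comp_equiv (Equiv.addRight k)

theorem exists_rowPar_zero (hY : Y.Finite) : ∃ b₀ : ℤ, ∀ b, b₀ ≤ b → ∀ i, rowPar Y i b = 0 := by
  obtain ⟨M, hM⟩ := (hY.image fun e : TriE => e.2.1).bddAbove
  refine ⟨M + 1, fun b hb i => ?_⟩
  unfold rowPar
  rw [← finsum_zero (α := ℤ)]
  refine finsum_congr fun a => ?_
  have h : ((a, b, i) : TriE) ∉ Y := fun h => by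
    have := hM (mem_image_of_mem _ h)
    simp only at this
    omega
  simp [chi, h]

theorem eq_zero_of_const {N : ℤ → ZMod 2} (h : ∀ b, N b = N (b + 1)) {b₀ : ℤ}
    (h0 : ∀ b, b₀ ≤ b → N b = 0) (b : ℤ) : N b = 0 := by
  have : ∀ n : ℕ, N b = N (b + n) := by
    intro n
    induction n with
    | zero => simp
    | succ n ih => rw [ih, h]; push_cast; rw [add_assoc]
  rw [this (b₀ - b).toNat]
  exact h0 _ (by omega)

end Rows

section Finsum

variable {f g : ℤ → ZMod 2}

theorem hasFiniteSupport_add (hf : f.HasFiniteSupport) (hg : g.HasFiniteSupport) :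
    (fun a => f a + g a).HasFiniteSupport := hf.add hg

end Finsum

section Parity

theorem cut_tri_even (C : Set (ℤ × ℤ)) (v : Bool × ℤ × ℤ) :
    ∑ e ∈ hexInc v, chi (e ∈ cut triG C) = 0 := by
  obtain ⟨i, a, b⟩ := v
  have key : ∀ x y z : ZMod 2, x + y + (y + z + (x + z)) = 0 := by decide
  cases i
  · have : hexInc (false, a, b) = {(a, b, 0), (a, b - 1, 1), (a + 1, b - 1, 2)} := rfl
    rw [this, Finset.sum_insert (by simp), Finset.sum_insert (by simp), Finset.sum_singleton]
    simp only [chi_cut, triG, Fin.reduceEq, reduceIte, sub_add_cancel]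
    linear_combination key (chi ((a, b) ∈ C)) (chi ((a + 1, b) ∈ C)) (chi ((a + 1, b - 1) ∈ C))
  · have : hexInc (true, a, b) = {(a, b, 0), (a, b, 1), (a, b, 2)} := rfl
    rw [this, Finset.sum_insert (by simp), Finset.sum_insert (by simp), Finset.sum_singleton]
    simp only [chi_cut, triG, Fin.reduceEq, reduceIte]
    linear_combination key (chi ((a, b) ∈ C)) (chi ((a + 1, b) ∈ C)) (chi ((a, b + 1) ∈ C))

theorem sum_triInc (f : TriE → ZMod 2) (a b : ℤ) : ∑ e ∈ triInc (a, b), f e =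
    f (a, b, 0) + (f (a - 1, b, 0) + (f (a - 1, b, 1) + (f (a, b - 1, 1) +
      (f (a, b, 2) + f (a, b - 1, 2))))) := by
  have : triInc (a, b) = {(a, b, 0), (a - 1, b, 0), (a - 1, b, 1), (a, b - 1, 1), (a, b, 2),
    (a, b - 1, 2)} := rfl
  rw [this, Finset.sum_insert (by simp; omega), Finset.sum_insert (by simp),
    Finset.sum_insert (by simp), Finset.sum_insert (by simp),
    Finset.sum_insert (by simp; omega), Finset.sum_singleton]

theorem cut_hex_even (C : Set (Bool × ℤ × ℤ)) (v : ℤ × ℤ) :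
    ∑ e ∈ triInc v, chi (e ∈ cut hexG C) = 0 := by
  obtain ⟨a, b⟩ := v
  rw [sum_triInc]
  simp only [chi_cut, hexG, Fin.reduceEq, reduceIte, sub_add_cancel]
  generalize chi ((true, a, b) ∈ C) = x1
  generalize chi ((false, a, b) ∈ C) = x2
  generalize chi ((true, a - 1, b) ∈ C) = x3
  generalize chi ((false, a - 1, b) ∈ C) = x4
  generalize chi ((false, a - 1, b + 1) ∈ C) = x5
  generalize chi ((true, a, b - 1) ∈ C) = x6
  revert x1 x2 x3 x4 x5 x6
  decide

end Parity

section Lines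

variable {Y : Set TriE}

theorem rowPar_tri_zero (hY : Y.Finite) (hpar : ∀ v, ∑ e ∈ hexInc v, chi (e ∈ Y) = 0) (b : ℤ) :
    rowPar Y 0 b = 0 := by
  have hup : ∀ b, rowPar Y 0 b + (rowPar Y 1 b + rowPar Y 2 b) = 0 := by
    intro b
    rw [← finsum_chi Y 0 b 0, ← finsum_chi Y 1 b 0, ← finsum_chi Y 2 b 0,
      ← finsum_add_distrib (chi_finite hY 1 b 0) (chi_finite hY 2 b 0),
      ← finsum_add_distrib (chi_finite hY 0 b 0)
        (hasFiniteSupport_add (chi_finite hY 1 b 0) (chi_finite hY 2 b 0))]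
    refine (finsum_congr fun a => ?_).trans finsum_zero
    have h := hpar (true, a, b)
    have : hexInc (true, a, b) = {(a, b, 0), (a, b, 1), (a, b, 2)} := rfl
    rw [this, Finset.sum_insert (by simp), Finset.sum_insert (by simp), Finset.sum_singleton] at h
    simpa using h
  have hdown : ∀ b, rowPar Y 0 (b + 1) + (rowPar Y 1 b + rowPar Y 2 b) = 0 := by
    intro b
    rw [← finsum_chi Y 0 (b + 1) 0, ← finsum_chi Y 1 b 0, ← finsum_chi Y 2 b 1,
      ← finsum_add_distrib (chi_finite hY 1 b 0) (chi_finite hY 2 b 1),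
      ← finsum_add_distrib (chi_finite hY 0 (b + 1) 0)
        (hasFiniteSupport_add (chi_finite hY 1 b 0) (chi_finite hY 2 b 1))]
    refine (finsum_congr fun a => ?_).trans finsum_zero
    have h := hpar (false, a, b + 1)
    have : hexInc (false, a, b + 1) = {(a, b + 1, 0), (a, b + 1 - 1, 1), (a + 1, b + 1 - 1, 2)} := rfl
    rw [this, Finset.sum_insert (by simp), Finset.sum_insert (by simp), Finset.sum_singleton] at h
    simpa using h
  obtain ⟨b₀, h0⟩ := exists_rowPar_zero hY
  refine eq_zero_of_const (N := rowPar Y 0) (fun b => ?_) (fun b hb => h0 b hb 0) b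
  linear_combination hup b - hdown b

theorem rowPar_hex_zero (hY : Y.Finite) (hpar : ∀ v, ∑ e ∈ triInc v, chi (e ∈ Y) = 0) (b : ℤ) :
    rowPar Y 1 b + rowPar Y 2 b = 0 := by
  have h6 : ∀ b, rowPar Y 0 b + (rowPar Y 0 b + (rowPar Y 1 b + (rowPar Y 1 (b - 1) +
      (rowPar Y 2 b + rowPar Y 2 (b - 1))))) = 0 := by
    intro b
    nth_rw 1 [← finsum_chi Y 0 b 0]
    rw [← finsum_chi Y 0 b (-1), ← finsum_chi Y 1 b (-1), ← finsum_chi Y 1 (b - 1) 0,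
      ← finsum_chi Y 2 b 0, ← finsum_chi Y 2 (b - 1) 0]
    have f1 := chi_finite hY 0 b 0
    have f2 := chi_finite hY 0 b (-1)
    have f3 := chi_finite hY 1 b (-1)
    have f4 := chi_finite hY 1 (b - 1) 0
    have f5 := chi_finite hY 2 b 0
    have f6 := chi_finite hY 2 (b - 1) 0
    have g5 := hasFiniteSupport_add f5 f6
    have g4 := hasFiniteSupport_add f4 g5
    have g3 := hasFiniteSupport_add f3 g4
    rw [← finsum_add_distrib f5 f6, ← finsum_add_distrib f4 g5, ← finsum_add_distrib f3 g4,
      ← finsum_add_distrib f2 g3, ← finsum_add_distrib f1 (hasFiniteSupport_add f2 g3)]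
    refine (finsum_congr fun a => ?_).trans finsum_zero
    have h := hpar (a, b)
    rw [sum_triInc] at h
    simpa [← sub_eq_add_neg] using h
  obtain ⟨b₀, h0⟩ := exists_rowPar_zero hY
  refine eq_zero_of_const (N := fun b => rowPar Y 1 b + rowPar Y 2 b) (b₀ := b₀) (fun b => ?_)
    (fun b hb => by simp [h0 b hb]) b
  have h := h6 (b + 1)
  rw [add_sub_cancel_right] at h
  have h2 : (2 : ZMod 2) = 0 := rfl
  linear_combination h - (rowPar Y 0 (b + 1) + rowPar Y 1 (b + 1) + rowPar Y 2 (b + 1)) * h2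

end Lines

section Halves

variable {x₀ b : ℤ}

theorem halfline_finite {V : Type*} {C : Set V} (hC : C.Finite) {φ : ℤ → V} (hφ : Function.Injective φ)
    (x₀ : ℤ) : (fun a : ℤ => if x₀ ≤ a then chi (φ a ∈ C) else 0).HasFiniteSupport := by
  refine (hC.preimage hφ.injOn).subset fun a ha => ?_
  by_contra h
  have h' : φ a ∉ C := h
  simp [chi, h'] at ha

theorem exists_left_tri {C : Set (ℤ × ℤ)} (hC : C.Finite) (h₀ : (x₀, b) ∈ C) :
    ∃ e : TriE, (x₀ ≤ e.1 ∧ e.2.1 = b ∧ e.2.2 = 0) ∧ e ∈ cut triG C ∧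
      ∃ e' : TriE, (e'.1 < x₀ ∧ e'.2.1 = b ∧ e'.2.2 = 0) ∧ e' ∈ cut triG C ∧
        Conn hexG (cut triG C) (hexG e).1 (hexG e').1 := by
  refine exists_cut_path isInc_hex
    (right := {e : TriE | x₀ ≤ e.1 ∧ e.2.1 = b ∧ e.2.2 = 0})
    (left := {e : TriE | e.1 < x₀ ∧ e.2.1 = b ∧ e.2.2 = 0}) (cut_tri_even C) ?_
  intro Y hYC hpar hright
  by_contra hleft
  have hY : Y.Finite := (cut_finite isInc_tri hC).subset hYC
  have h0 := rowPar_tri_zero hY hpar b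
  let g : ℤ → ZMod 2 := fun a => if x₀ ≤ a then chi ((a, b) ∈ C) else 0
  have hg : g.HasFiniteSupport := halfline_finite hC (φ := fun a => (a, b))
    (fun a a' h => congrArg Prod.fst h) x₀
  have hg' : (fun a => g (a + 1)).HasFiniteSupport := by
    refine (Set.Finite.preimage (f := fun a : ℤ => a + 1) (fun _ _ _ _ h => by simpa using h) hg)
  have h1 : (fun a : ℤ => if a = x₀ - 1 then (1 : ZMod 2) else 0).HasFiniteSupport :=
    (finite_singleton (x₀ - 1)).subset fun a ha => by
      by_contra h
      simp only [mem_singleton_iff] at h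
      simp [h] at ha
  have hc : ∑ᶠ a : ℤ, chi ((a, b, 0) ∈ Y) =
      ∑ᶠ a : ℤ, (g a + (g (a + 1) + if a = x₀ - 1 then (1 : ZMod 2) else 0)) := by
    refine finsum_congr fun a => ?_
    simp only [g]
    by_cases ha : x₀ ≤ a
    · have : ((a, b, 0) : TriE) ∈ Y ↔ ((a, b, 0) : TriE) ∈ cut triG C :=
        ⟨fun h => hYC h, fun h => hright _ ⟨ha, rfl, rfl⟩ h⟩
      rw [if_pos ha, if_pos (by omega), if_neg (by omega), this, chi_cut]
      simp [triG]
    · have hn : ((a, b, 0) : TriE) ∉ Y := fun h => hleft ⟨_, ⟨not_le.1 ha, rfl, rfl⟩, h⟩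
      rw [if_neg ha]
      by_cases hx : a = x₀ - 1
      · subst hx
        simp [chi, hn, h₀]
        decide
      · rw [if_neg (by omega), if_neg hx]
        simp [chi, hn]
  rw [finsum_add_distrib hg (hasFiniteSupport_add hg' h1), finsum_add_distrib hg' h1, finsum_shift g 1,
    finsum_eq_single _ (x₀ - 1) (fun a ha => if_neg ha), if_pos rfl, ← add_assoc,
    CharTwo.add_self_eq_zero, zero_add] at hc
  exact one_ne_zero (hc.symm.trans h0)

theorem exists_left_hex {C : Set (Bool × ℤ × ℤ)} (hC : C.Finite) (h₀ : (true, x₀, b) ∈ C) :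
    ∃ e : TriE, (e.2.1 = b ∧ (e.2.2 = 1 ∧ x₀ ≤ e.1 ∨ e.2.2 = 2 ∧ x₀ + 1 ≤ e.1)) ∧ e ∈ cut hexG C ∧
      ∃ e' : TriE, (e'.2.1 = b ∧ (e'.2.2 = 1 ∧ e'.1 < x₀ ∨ e'.2.2 = 2 ∧ e'.1 ≤ x₀)) ∧
        e' ∈ cut hexG C ∧ Conn triG (cut hexG C) (triG e).1 (triG e').1 := by
  refine exists_cut_path isInc_tri
    (right := {e : TriE | e.2.1 = b ∧ (e.2.2 = 1 ∧ x₀ ≤ e.1 ∨ e.2.2 = 2 ∧ x₀ + 1 ≤ e.1)})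
    (left := {e : TriE | e.2.1 = b ∧ (e.2.2 = 1 ∧ e.1 < x₀ ∨ e.2.2 = 2 ∧ e.1 ≤ x₀)})
    (cut_hex_even C) ?_
  intro Y hYC hpar hright
  by_contra hleft
  have hY : Y.Finite := (cut_finite isInc_hex hC).subset hYC
  have h0 := rowPar_hex_zero hY hpar b
  let g : ℤ → ZMod 2 := fun a => if x₀ ≤ a then chi ((true, a, b) ∈ C) else 0
  let h : ℤ → ZMod 2 := fun a => if x₀ ≤ a then chi ((false, a, b + 1) ∈ C) else 0
  have hg : g.HasFiniteSupport := halfline_finite hC (φ := fun a => (true, a, b))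
    (fun a a' h => by simpa using h) x₀
  have hh : h.HasFiniteSupport := halfline_finite hC (φ := fun a => (false, a, b + 1))
    (fun a a' h => by simpa using h) x₀
  have hh' : (fun a => h (a + -1)).HasFiniteSupport := by
    refine (Set.Finite.preimage (f := fun a : ℤ => a + -1) (fun _ _ _ _ h => by simpa using h) hh)
  have h1 : (fun a : ℤ => if a = x₀ then (1 : ZMod 2) else 0).HasFiniteSupport :=
    (finite_singleton x₀).subset fun a ha => by
      by_contra h
      simp only [mem_singleton_iff] at h
      simp [h] at ha
  have hc1 : ∑ᶠ a : ℤ, chi ((a, b, 1) ∈ Y) = ∑ᶠ a : ℤ, (g a + h a) := by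
    refine finsum_congr fun a => ?_
    simp only [g, h]
    by_cases ha : x₀ ≤ a
    · have : ((a, b, 1) : TriE) ∈ Y ↔ ((a, b, 1) : TriE) ∈ cut hexG C :=
        ⟨fun h => hYC h, fun h => hright _ ⟨rfl, Or.inl ⟨rfl, ha⟩⟩ h⟩
      rw [if_pos ha, if_pos ha, this, chi_cut]
      simp [hexG]
    · have hn : ((a, b, 1) : TriE) ∉ Y := fun h => hleft ⟨_, ⟨rfl, Or.inl ⟨rfl, not_le.1 ha⟩⟩, h⟩
      rw [if_neg ha, if_neg ha]
      simp [chi, hn]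
  have hc2 : ∑ᶠ a : ℤ, chi ((a, b, 2) ∈ Y) =
      ∑ᶠ a : ℤ, (g a + (h (a + -1) + if a = x₀ then (1 : ZMod 2) else 0)) := by
    refine finsum_congr fun a => ?_
    simp only [g, h]
    by_cases ha : x₀ + 1 ≤ a
    · have : ((a, b, 2) : TriE) ∈ Y ↔ ((a, b, 2) : TriE) ∈ cut hexG C :=
        ⟨fun h => hYC h, fun h => hright _ ⟨rfl, Or.inr ⟨rfl, ha⟩⟩ h⟩
      rw [if_pos (by omega), if_pos (by omega), if_neg (by omega), this, chi_cut]
      simp [hexG, sub_eq_add_neg]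
    · have hn : ((a, b, 2) : TriE) ∉ Y := fun h =>
        hleft ⟨_, ⟨rfl, Or.inr ⟨rfl, Int.lt_add_one_iff.1 (not_le.1 ha)⟩⟩, h⟩
      rw [if_neg (c := x₀ ≤ a + -1) (by omega)]
      by_cases hx : a = x₀
      · subst hx
        simp [chi, hn, h₀]
        decide
      · rw [if_neg (by omega), if_neg hx]
        simp [chi, hn]
  rw [finsum_add_distrib hg hh] at hc1
  rw [finsum_add_distrib hg (hasFiniteSupport_add hh' h1), finsum_add_distrib hh' h1, finsum_shift h (-1),
    finsum_eq_single _ x₀ (fun a ha => if_neg ha), if_pos rfl] at hc2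
  have h2 : (2 : ZMod 2) = 0 := rfl
  have : (1 : ZMod 2) = 0 := by
    unfold rowPar at h0
    linear_combination h0 - hc1 - hc2 - (∑ᶠ a, g a + ∑ᶠ a, h a) * h2
  exact one_ne_zero this

end Halves

section Peierls

variable {V V' E : Type} [DecidableEq V] [DecidableEq V'] [DecidableEq E]
variable {G : E → V × V} {G' : E → V' × V'} {inc : V → Finset E} {inc' : V' → Finset E}
variable {p : E → ℝ} {η : ℝ} {x x₀ : V} {R : ℕ → Finset E} {y : ℕ → V'} {col : V' → ℤ} {c₀ : ℤ}

/-- A half-line of edges `R 0, R 1, …` starting at `x₀`, whose dual edges have ends `y 0, y 1, …`,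
such that the boundary of each finite set containing `x₀` has a dual path from the half-line to
its complement. -/
structure Fence (G : E → V × V) (G' : E → V' × V') (p : E → ℝ) (η : ℝ) (x x₀ : V)
    (R : ℕ → Finset E) (y : ℕ → V') (col : V' → ℤ) (c₀ : ℤ) : Prop where
  col_step : ∀ e, |col (G' e).1 - col (G' e).2| ≤ 1
  col_y : ∀ i, col (y i) = c₀ + i
  y_end : ∀ i, ∀ e ∈ R i, (G' e).1 = y i ∨ (G' e).2 = y i
  card_le : ∀ i, (R i).card ≤ 2
  prob : ∀ i, ∀ e ∈ R i, η ≤ p e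
  start : Conn G (R 0) x x₀
  crossing : ∀ C : Set V, C.Finite → x₀ ∈ C → ∃ i, ∃ e ∈ R i, e ∈ cut G C ∧
    ∃ w, col w ≤ c₀ ∧ Conn G' (cut G C) (y i) w

theorem Conn.exists_col {t : Set E} {u w : V'} (hcol : ∀ e, |col (G' e).1 - col (G' e).2| ≤ 1)
    (h : Conn G' t u w) {c : ℤ} (hc : c ≤ col u) (hw : col w ≤ c) :
    ∃ z, Conn G' t u z ∧ col z = c := by
  induction h with
  | refl => exact ⟨u, Conn.refl _, le_antisymm hw hc⟩
  | @tail b v hb hbv ih =>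
    by_cases hbc : col b ≤ c
    · exact ih hbc
    · refine ⟨v, hb.tail hbv, ?_⟩
      obtain ⟨e, _, he⟩ := hbv
      have := abs_le.1 (hcol e)
      rcases he with he | he <;> rw [he] at this <;> simp only at this <;> omega

theorem Fence.exists_large_dual (hF : Fence G G' p η x x₀ R y col c₀) (hinc : IsInc G inc)
    {L : Finset V} {D : Finset V'} (hD : ∀ e ∈ L.biUnion inc, (G' e).1 ∈ D ∧ (G' e).2 ∈ D)
    {t s : Set E} (hs : ((L.biUnion inc : Finset E) : Set E) \ t ⊆ s) {m : ℕ} (hm : 1 ≤ m)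
    (ht : ∀ i < m, (R i : Set E) ⊆ t) (hL : ¬Exits G L x t) :
    ∃ i, m ≤ i ∧ y i ∈ D ∧ i ≤ (clF G' D {y i} s).card := by
  have hxx : Conn G t x x₀ := hF.start.mono (ht 0 (by omega))
  let C : Set V := {v | Conn G t x v}
  have hCL : C ⊆ L := fun v hv => by
    by_contra h
    exact hL ⟨v, h, hv⟩
  have hcut : ∀ e ∈ cut G C, e ∈ L.biUnion inc ∧ e ∉ t := by
    intro e he
    have h : ¬((G e).1 ∈ C ↔ (G e).2 ∈ C) := he
    constructor
    · rw [Finset.mem_biUnion]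
      by_cases h1 : (G e).1 ∈ C
      · exact ⟨_, hCL h1, (hinc _ _).2 (Or.inl rfl)⟩
      · exact ⟨_, hCL (by tauto : (G e).2 ∈ C), (hinc _ _).2 (Or.inr rfl)⟩
    · intro het
      exact h ⟨fun h1 => Conn.trans h1 (adj_of_mem het).conn,
        fun h1 => Conn.trans h1 (adj_of_mem het).symm.conn⟩
  obtain ⟨i, e, hei, hec, w, hw, hyw⟩ := hF.crossing C (L.finite_toSet.subset hCL) hxx
  have hyD : y i ∈ D := by
    obtain ⟨h1, h2⟩ := hD e (hcut e hec).1
    obtain h | h := hF.y_end i e hei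
    · exact h ▸ h1
    · exact h ▸ h2
  refine ⟨i, ?_, hyD, ?_⟩
  · by_contra h
    exact (hcut e hec).2 (ht i (not_le.1 h) (Finset.mem_coe.2 hei))
  · have hsub : Finset.Icc (c₀ + 1) (c₀ + i) ⊆ (clF G' D {y i} s).image col := by
      intro c hc
      rw [Finset.mem_Icc] at hc
      obtain ⟨z, hz, hzc⟩ := hyw.exists_col hF.col_step (c := c) (by rw [hF.col_y]; exact hc.2)
        (by omega)
      have hz' : Conn G' (s ∩ ins G' D) (y i) z :=
        hz.mono fun f hf => ⟨hs ⟨(hcut f hf).1, (hcut f hf).2⟩, hD f (hcut f hf).1⟩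
      exact Finset.mem_image.2 ⟨z, mem_clF.2 ⟨Finset.mem_coe.1 (hz'.mem_of_ins hyD), y i,
        Finset.mem_singleton_self _, hyD, hz'⟩, hzc⟩
    calc i = (Finset.Icc (c₀ + 1) (c₀ + i)).card := by rw [Int.card_Icc]; omega
      _ ≤ _ := (Finset.card_le_card hsub).trans Finset.card_image_le

theorem exists_small_tail {C d : ℝ} (hd : 0 < d) : ∃ m : ℕ, 1 ≤ m ∧
    ∀ I : Finset ℕ, (∀ i ∈ I, m ≤ i) → ∑ i ∈ I, C * Real.exp (-d * i) ≤ 1 / 2 := by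
  have hsum : Summable fun i : ℕ => C * Real.exp (-d * i) := by
    refine Summable.mul_left C ?_
    have := Real.summable_exp_nat_mul_iff (a := -d)
    simpa [mul_comm] using this.2 (by linarith)
  obtain ⟨s, hs⟩ := summable_iff_vanishing_norm.1 hsum (1 / 2) (by norm_num)
  refine ⟨s.sup id + 1, by omega, fun I hI => (le_abs_self _).trans (hs I ?_).le⟩
  rw [Finset.disjoint_left]
  intro i hi his
  have : i ≤ s.sup id := Finset.le_sup (f := id) his
  have := hI i hi
  omega

/-- Peierls' argument: exponential decay of the dual clusters gives a lower bound for the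
exit probabilities. -/
theorem exists_exit_ge (hinc : IsInc G inc) (hinc' : IsInc G' inc') (hp : Unit01 p)
    (hη : 0 < η) (hη1 : η ≤ 1) {C d : ℝ} (hd : 0 < d)
    (htail : ∀ (y : V') (D : Finset V') (k : ℕ), Pr (fun e => 1 - p e) (insF G' inc' D)
      (fun t => k ≤ (clF G' D {y} t).card) ≤ C * Real.exp (-d * k)) :
    ∃ θ : ℝ, 0 < θ ∧ ∀ (x x₀ : V) (R : ℕ → Finset E) (y : ℕ → V') (col : V' → ℤ) (c₀ : ℤ),
      Fence G G' p η x x₀ R y col c₀ → ∀ L : Finset V,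
        θ ≤ Pr p (L.biUnion inc) (Exits G L x) := by
  obtain ⟨m, hm, hsmall⟩ := exists_small_tail (C := C) hd
  refine ⟨η ^ (m * 2) * (1 / 2), by positivity, fun x x₀ R y col c₀ hF L => ?_⟩
  have hp' : Unit01 fun e => 1 - p e := fun e => ⟨by linarith [(hp e).2], by linarith [(hp e).1]⟩
  set W := L.biUnion inc with hW
  let D : Finset V' := W.image (fun e => (G' e).1) ∪ W.image (fun e => (G' e).2)
  have hD : ∀ e ∈ W, (G' e).1 ∈ D ∧ (G' e).2 ∈ D := fun e he =>
    ⟨Finset.mem_union_left _ (Finset.mem_image_of_mem _ he),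
      Finset.mem_union_right _ (Finset.mem_image_of_mem (fun e => (G' e).2) he)⟩
  let I : Finset ℕ := (D.image fun v => (col v - c₀).toNat).filter (m ≤ ·)
  let B : Finset E := (Finset.range m).biUnion R
  let bad : ℕ → Set E → Prop := fun i t => i ≤ (clF G' D {y i} (↑(W \ B) \ t)).card
  have hbad_dep : ∀ i, DepOn (bad i) (W \ B : Finset E) := by
    intro i t
    simp only [bad]
    rw [inter_comm, Set.sdiff_self_inter]
  have hbad_le : ∀ i, Pr p (W \ B) (bad i) ≤ C * Real.exp (-d * i) := by
    intro i
    have hmono : Monotone fun t => i ≤ (clF G' D {y i} t).card := fun t t' h hi =>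
      le_trans hi (Finset.card_le_card (clF_mono h))
    have hdep : DepOn (fun t => i ≤ (clF G' D {y i} t).card) (insF G' inc' D) := by
      intro t
      simp only [coe_insF hinc', clF_dep D {y i} t]
    calc Pr p (W \ B) (bad i)
        = Pr (fun e => 1 - p e) (W \ B) fun t => i ≤ (clF G' D {y i} t).card :=
          (Ex_compl fun t => ind (i ≤ (clF G' D {y i} t).card)).symm
      _ ≤ Pr (fun e => 1 - p e) (W \ B ∪ insF G' inc' D) fun t => i ≤ (clF G' D {y i} t).card :=
          Ex_mono_set hp' Finset.subset_union_left (ind_monotone hmono)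
      _ = Pr (fun e => 1 - p e) (insF G' inc' D) fun t => i ≤ (clF G' D {y i} t).card :=
          Pr_of_subset Finset.subset_union_right hdep
      _ ≤ _ := htail _ _ _
  have hsum : Pr p (W \ B) (fun t => ∃ i ∈ I, bad i t) ≤ 1 / 2 :=
    (Pr_exists_le hp I bad).trans ((Finset.sum_le_sum fun i _ => hbad_le i).trans
      (hsmall I fun i hi => (Finset.mem_filter.1 hi).2))
  have hB : η ^ (m * 2) ≤ ∏ e ∈ B, p e := by
    have hcard : B.card ≤ m * 2 := by
      refine (Finset.card_biUnion_le_card_mul _ _ 2 fun i _ => hF.card_le i).trans ?_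
      rw [Finset.card_range]
    calc η ^ (m * 2) ≤ η ^ B.card := pow_le_pow_of_le_one hη.le hη1 hcard
      _ = ∏ _e ∈ B, η := (Finset.prod_const η).symm
      _ ≤ ∏ e ∈ B, p e := Finset.prod_le_prod (fun _ _ => hη.le) fun e he => by
          obtain ⟨i, _, hi⟩ := Finset.mem_biUnion.1 he
          exact hF.prob i e hi
  calc η ^ (m * 2) * (1 / 2)
      ≤ (∏ e ∈ B, p e) * Pr p (W \ B) fun t => ¬∃ i ∈ I, bad i t := by
        rw [Pr_not]
        have : 0 ≤ η ^ (m * 2) := by positivity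
        exact mul_le_mul hB (by linarith) (by norm_num) (this.trans hB)
    _ = Pr p (B ∪ W \ B) fun t => ↑B ⊆ t ∧ ¬∃ i ∈ I, bad i t := by
        rw [Pr_and_of_disjoint Finset.disjoint_sdiff, Pr_subset B subset_rfl]
        · intro t
          simp
        · refine DepOn.not fun t => ?_
          simp only [eq_iff_iff]
          exact exists_congr fun i => and_congr_right fun _ => (hbad_dep i t).to_iff
    _ ≤ Pr p (B ∪ W \ B) (Exits G L x) := by
        refine Pr_mono hp fun t _ ⟨hBt, hgood⟩ => ?_
        by_contra hL
        have hBi : ∀ i < m, (R i : Set E) ⊆ t := fun i hi => Subset.trans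
          (by exact_mod_cast Finset.subset_biUnion_of_mem R (Finset.mem_range.2 hi)) hBt
        obtain ⟨i, hi, hiD, hcard⟩ := hF.exists_large_dual hinc (s := ↑(W \ B) \ t) hD
          (fun e he => ⟨by
            rw [Finset.mem_coe, Finset.mem_sdiff]
            exact ⟨he.1, fun h => he.2 (hBt h)⟩, he.2⟩) hm hBi hL
        refine hgood ⟨i, Finset.mem_filter.2 ⟨Finset.mem_image.2 ⟨y i, hiD, ?_⟩, hi⟩, hcard⟩
        rw [hF.col_y]
        omega
    _ = Pr p W (Exits G L x) := by
        refine Pr_of_subset (fun e he => ?_) (exits_depOn hinc L x)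
        by_cases h : e ∈ B <;> simp [h, he]

end Peierls

section Fences

variable {p δ : ℝ} {q q' : ℤ → ℝ}

theorem fence_tri (p : ℝ) (q q' : ℤ → ℝ) (a b : ℤ) :
    Fence triG hexG (triHI p q q') p (a, b) (a, b) (fun i => {(a + i, b, 0)})
      (fun i => (true, a + i, b)) (fun v => v.2.1) a where
  col_step e := by
    obtain ⟨c, d, i⟩ := e
    fin_cases i <;> simp [hexG]
  col_y i := rfl
  y_end i e he := by
    rw [Finset.mem_singleton.1 he]
    exact Or.inl rfl
  card_le i := by simp
  prob i e he := by
    rw [Finset.mem_singleton.1 he]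
    simp [triHI]
  start := Conn.refl _
  crossing C hC h₀ := by
    obtain ⟨⟨c, d, i⟩, ⟨h1, h2, h3⟩, he, ⟨c', d', i'⟩, ⟨h1', -, -⟩, -, h⟩ := exists_left_tri hC h₀
    simp only at h1 h2 h3 h1'
    subst h2 h3
    have hc : a + ((c - a).toNat : ℤ) = c := by omega
    refine ⟨(c - a).toNat, _, Finset.mem_singleton_self _, ?_, (true, c', d'), h1'.le, ?_⟩
    · rw [hc]; exact he
    · rw [hc]; exact h

theorem fence_hex (a b : ℤ) (hq : ∀ n, δ ≤ q n) (hq' : ∀ n, δ ≤ q' n) {x : Bool × ℤ × ℤ}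
    (hx : x = (true, a, b) ∨ x = (false, a, b + 1)) :
    Fence hexG triG (triHI p q q') δ x (true, a, b) (fun i => {(a + i, b, 1), (a + i, b, 2)})
      (fun i => (a + i, b + 1)) (fun v => v.1) a where
  col_step e := by
    obtain ⟨c, d, i⟩ := e
    fin_cases i <;> simp [triG]
  col_y i := rfl
  y_end i e he := by
    rw [Finset.mem_insert, Finset.mem_singleton] at he
    rcases he with rfl | rfl <;> simp [triG]
  card_le i := Finset.card_le_two
  prob i e he := by
    rw [Finset.mem_insert, Finset.mem_singleton] at he
    rcases he with rfl | rfl <;> simp [triHI, hq, hq']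
  start := by
    rcases hx with rfl | rfl
    · exact Conn.refl _
    · exact Adj.conn ⟨(a, b, 1), by simp, Or.inr (by simp [hexG])⟩
  crossing C hC h₀ := by
    obtain ⟨⟨c, d, i⟩, ⟨h1, h2⟩, he, ⟨c', d', i'⟩, ⟨-, h2'⟩, -, h⟩ := exists_left_hex hC h₀
    simp only at h1 h2 h2'
    subst h1
    have hc : a + ((c - a).toNat : ℤ) = c := by omega
    refine ⟨(c - a).toNat, (c, d, i), ?_, he, (triG (c', d', i')).1, ?_, ?_⟩
    · rw [Finset.mem_insert, Finset.mem_singleton, hc]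
      rcases h2 with ⟨rfl, -⟩ | ⟨rfl, -⟩ <;> simp
    · rcases h2' with ⟨rfl, hle⟩ | ⟨rfl, hle⟩
      · simp [triG]; omega
      · simpa [triG] using hle
    · rw [hc]
      refine Conn.trans ?_ h
      have := (adj_of_mem (G := triG) he).symm.conn
      rcases h2 with ⟨rfl, -⟩ | ⟨rfl, -⟩ <;> simpa [triG] using this

theorem one_sub_triHI : (fun e => 1 - triHI p q q' e) =
    triHI (1 - p) (fun n => 1 - q n) fun n => 1 - q' n := by
  funext e
  unfold triHI
  split_ifs <;> rfl

theorem one_sub_mem_Icc {a : ℝ} (ha : a ∈ Icc (0 : ℝ) 1) : 1 - a ∈ Icc (0 : ℝ) 1 :=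
  ⟨by linarith [ha.2], by linarith [ha.1]⟩

theorem tri_exits_ge (hp : p ∈ Ioo (0 : ℝ) 1) (hq : ∀ n, q n ∈ Icc (0 : ℝ) 1)
    (hq' : ∀ n, q' n ∈ Icc (0 : ℝ) 1) (hδ : 0 < δ) (hκ : ∀ n, δ ≤ kappaT p (q n) (q' n)) :
    ∃ θ : ℝ, 0 < θ ∧ ∀ (x : ℤ × ℤ) (L : Finset (ℤ × ℤ)),
      θ ≤ Pr (triHI p q q') (L.biUnion triInc) (Exits triG L x) := by
  obtain ⟨C, -, d, hd, h⟩ := hex_exp_tail (p := 1 - p) (q := fun n => 1 - q n)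
    (q' := fun n => 1 - q' n) (δ := δ) ⟨by linarith [hp.2], by linarith [hp.1]⟩
    (fun n => one_sub_mem_Icc (hq n)) (fun n => one_sub_mem_Icc (hq' n)) hδ (fun n => by
      simp only [kappaH, sub_sub_cancel]
      linarith [hκ n])
  rw [← one_sub_triHI] at h
  obtain ⟨θ, hθ, h⟩ := exists_exit_ge isInc_tri isInc_hex
    (triHI_unit ⟨hp.1.le, hp.2.le⟩ hq hq') hp.1 hp.2.le hd h
  exact ⟨θ, hθ, fun ⟨a, b⟩ L => h _ _ _ _ _ _ (fence_tri p q q' a b) L⟩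

theorem le_of_le_kappaH {a b c : ℝ} (ha : a ∈ Icc (0 : ℝ) 1) (hb : b ∈ Icc (0 : ℝ) 1)
    (hc : c ∈ Icc (0 : ℝ) 1) (h : δ ≤ kappaH a b c) : δ ≤ b ∧ δ ≤ c := by
  obtain ⟨ha0, ha1⟩ := one_sub_mem_Icc ha
  obtain ⟨hb0, hb1⟩ := one_sub_mem_Icc hb
  obtain ⟨hc0, hc1⟩ := one_sub_mem_Icc hc
  unfold kappaH kappaT at h
  have h1 : (1 - a) * (1 - b) * (1 - c) ≤ 1 - a := by
    rw [mul_assoc]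
    exact mul_le_of_le_one_right ha0 (mul_le_one₀ hb1 hc0 hc1)
  constructor <;> linarith

theorem hex_exits_ge (hp : p ∈ Ioo (0 : ℝ) 1) (hq : ∀ n, q n ∈ Icc (0 : ℝ) 1)
    (hq' : ∀ n, q' n ∈ Icc (0 : ℝ) 1) (hδ : 0 < δ) (hκ : ∀ n, δ ≤ kappaH p (q n) (q' n)) :
    ∃ θ : ℝ, 0 < θ ∧ ∀ (x : Bool × ℤ × ℤ) (L : Finset (Bool × ℤ × ℤ)),
      θ ≤ Pr (triHI p q q') (L.biUnion hexInc) (Exits hexG L x) := by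
  obtain ⟨C, -, d, hd, h⟩ := tri_exp_tail (p := 1 - p) (q := fun n => 1 - q n)
    (q' := fun n => 1 - q' n) (δ := δ) ⟨by linarith [hp.2], by linarith [hp.1]⟩
    (fun n => one_sub_mem_Icc (hq n)) (fun n => one_sub_mem_Icc (hq' n)) hδ (fun n => by
      have := hκ n
      unfold kappaH at this
      linarith)
  rw [← one_sub_triHI] at h
  have hle := fun n => le_of_le_kappaH ⟨hp.1.le, hp.2.le⟩ (hq n) (hq' n) (hκ n)
  obtain ⟨θ, hθ, h⟩ := exists_exit_ge isInc_hex isInc_tri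
    (triHI_unit ⟨hp.1.le, hp.2.le⟩ hq hq') hδ ((hle 0).1.trans (hq 0).2) hd h
  refine ⟨θ, hθ, fun ⟨u, a, b⟩ L => ?_⟩
  cases u
  · refine h _ _ _ _ _ _ (fence_hex a (b - 1) (fun n => (hle n).1) (fun n => (hle n).2) ?_) L
    simp
  · exact h _ _ _ _ _ _ (fence_hex a b (fun n => (hle n).1) (fun n => (hle n).2) (Or.inl rfl)) L

end Fences

section Infinite

variable {V E : Type} [DecidableEq V] [DecidableEq E] {G : E → V × V} {inc : V → Finset E}
variable {p : E → ℝ}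

/-- A uniform lower bound for the exit probabilities bounds the percolation probability. -/
theorem measure_infinite_ge [Countable V] (hinc : IsInc G inc) (hp : Unit01 p)
    {P : Measure (Config E)} (hP : IsBernoulliProduct p P) (x : V) {θ : ℝ} (h0 : 0 ≤ θ)
    (h : ∀ L : Finset V, θ ≤ Pr p (L.biUnion inc) (Exits G L x)) :
    ENNReal.ofReal θ ≤ P {ω | {y | Conn G (openSet ω) x y}.Infinite} := by
  have := hP.1
  have hθ : θ ≤ 1 := (h ∅).trans (Pr_le_one hp _)
  let A : Finset V → Set (Config E) := fun L => {ω | ¬Exits G L x (openSet ω)}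
  have hA : Monotone A := fun L L' hL ω hω ⟨y, hy, hc⟩ => hω ⟨y, fun h => hy (hL h), hc⟩
  have hAle : P (⋃ L, A L) ≤ ENNReal.ofReal (1 - θ) := by
    rw [(directed_of_isDirected_le hA).measure_iUnion]
    refine iSup_le fun L => ?_
    simp only [A]
    rw [hP.measure_dep hp (L.biUnion inc) (exits_depOn hinc L x).not, Pr_not]
    exact ENNReal.ofReal_le_ofReal (by linarith [h L])
  have hcov : univ ⊆ {ω : Config E | {y | Conn G (openSet ω) x y}.Infinite} ∪ ⋃ L, A L := by
    intro ω _
    by_cases hω : {y | Conn G (openSet ω) x y}.Finite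
    · refine Or.inr (mem_iUnion.2 ⟨hω.toFinset, fun ⟨y, hy, hc⟩ => hy ?_⟩)
      simpa using hc
    · exact Or.inl hω
  have h1 : ENNReal.ofReal θ + ENNReal.ofReal (1 - θ) ≤
      P {ω | {y | Conn G (openSet ω) x y}.Infinite} + ENNReal.ofReal (1 - θ) := by
    calc ENNReal.ofReal θ + ENNReal.ofReal (1 - θ) ≤ 1 := by
          rw [← ENNReal.ofReal_add h0 (by linarith)]
          simp
      _ = P univ := measure_univ.symm
      _ ≤ _ := (measure_mono hcov).trans (measure_union_le _ _)
      _ ≤ _ := add_le_add_right hAle _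
  exact (ENNReal.add_le_add_iff_right ENNReal.ofReal_ne_top).1 h1

theorem exists_infinite_step (hinc : IsInc G inc) {t : Set E} {S : Set V} {v : V} (hv : v ∉ S)
    (h : {y | Conn G (t ∩ ins G Sᶜ) v y}.Infinite) :
    ∃ w, Adj G t v w ∧ w ∉ insert v S ∧ {y | Conn G (t ∩ ins G (insert v S)ᶜ) w y}.Infinite := by
  by_contra! hfin
  have hsplit : ∀ y, Conn G (t ∩ ins G Sᶜ) v y → y = v ∨ ∃ w, Adj G t v w ∧ w ∉ insert v S ∧
      Conn G (t ∩ ins G (insert v S)ᶜ) w y := by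
    intro y hy
    induction hy with
    | refl => exact Or.inl rfl
    | @tail b y hb hby ih =>
      by_cases hyv : y = v
      · exact Or.inl hyv
      · have hmem := hby.mem_of_ins
        have hyS : y ∉ insert v S := fun h => h.elim hyv hmem.2
        refine Or.inr ?_
        rcases ih with rfl | ⟨w, hw, hwS, hc⟩
        · exact ⟨y, hby.mono inter_subset_left, hyS, Conn.refl _⟩
        · exact ⟨w, hw, hwS, hc.tail ((hby.mono inter_subset_left).inter_ins
            (hc.mem_of_ins hwS) hyS)⟩
  have hN : {w | Adj G t v w}.Finite := by
    refine (((inc v).image (fun e => (G e).1) ∪ (inc v).image (fun e => (G e).2)).finite_toSet).subset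
      fun w ⟨e, _, he⟩ => ?_
    rw [Finset.mem_coe, Finset.mem_union, Finset.mem_image, Finset.mem_image]
    rcases he with he | he
    · exact Or.inr ⟨e, (hinc _ _).2 (by simp [he]), by simp [he]⟩
    · exact Or.inl ⟨e, (hinc _ _).2 (by simp [he]), by simp [he]⟩
  refine h (((finite_singleton v).union ((hN.inter_of_left {w | w ∉ insert v S}).biUnion
    (t := fun w => {y | Conn G (t ∩ ins G (insert v S)ᶜ) w y})
    fun w hw => hfin w hw.1 hw.2)).subset fun y hy => ?_)
  rcases hsplit y hy with h | ⟨w, hw, hwS, hc⟩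
  · exact Or.inl h
  · exact Or.inr (mem_biUnion (⟨hw, hwS⟩ : w ∈ {w | Adj G t v w} ∩ {w | w ∉ insert v S}) hc)

/-- In an infinite locally finite cluster there is an infinite self-avoiding path. -/
theorem exists_infinite_path (hinc : IsInc G inc) {t : Set E} {x : V}
    (h : {y | Conn G t x y}.Infinite) :
    ∃ γ : ℕ → V, γ 0 = x ∧ Function.Injective γ ∧ ∀ n, Adj G t (γ n) (γ (n + 1)) := by
  let St := {s : Set V × V // s.2 ∉ s.1 ∧ {y | Conn G (t ∩ ins G s.1ᶜ) s.2 y}.Infinite}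
  have hstep : ∀ s : St, ∃ s' : St, Adj G t s.1.2 s'.1.2 ∧ s'.1.1 = insert s.1.2 s.1.1 := by
    rintro ⟨⟨S, v⟩, hv, hi⟩
    obtain ⟨w, h1, h2, h3⟩ := exists_infinite_step hinc hv hi
    exact ⟨⟨(insert v S, w), h2, h3⟩, h1, rfl⟩
  choose f hadj hins using hstep
  have h0 : {y | Conn G (t ∩ ins G (∅ : Set V)ᶜ) x y}.Infinite := by
    simpa [ins] using h
  let s : ℕ → St := fun n => f^[n] ⟨(∅, x), notMem_empty x, h0⟩
  have hs : ∀ n, s (n + 1) = f (s n) := fun n => Function.iterate_succ_apply' f n _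
  have hmem : ∀ m k, (s m).1.2 ∈ (s (m + k + 1)).1.1 := by
    intro m k
    induction k with
    | zero => rw [add_zero, hs, hins]; exact mem_insert _ _
    | succ k ih => rw [hs, hins]; exact mem_insert_of_mem _ ih
  have hne : ∀ m n, m < n → (s m).1.2 ≠ (s n).1.2 := by
    intro m n hmn he
    obtain ⟨k, rfl⟩ := Nat.exists_eq_add_of_lt hmn
    exact (s (m + k + 1)).2.1 (he ▸ hmem m k)
  refine ⟨fun n => (s n).1.2, rfl, fun m n hmn => ?_, fun n => ?_⟩
  · rcases lt_trichotomy m n with h | h | h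
    · exact absurd hmn (hne m n h)
    · exact h
    · exact absurd hmn.symm (hne n m h)
  · simp only [hs]
    exact hadj _

end Infinite

section Embedding

variable {V E : Type} [DecidableEq V] [DecidableEq E] {G : E → V × V} {inc : V → Finset E}
variable {L : LatticeOn E} {φ : V → Pt} {p : E → ℝ}

/-- `L` is an embedding in the plane of the combinatorial graph `G`, by the vertex map `φ`. -/
structure IsEmbeddingOf (L : LatticeOn E) (G : E → V × V) (φ : V → Pt) : Prop where
  injective : Function.Injective φ
  ends (e : E) : L.ends e = (φ (G e).1, φ (G e).2) ∨ L.ends e = (φ (G e).2, φ (G e).1)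

namespace IsEmbeddingOf

theorem openAdj_of_adj (h : IsEmbeddingOf L G φ) {ω : Config E} {x y : V}
    (hxy : Adj G (openSet ω) x y) : openAdj L ω (φ x) (φ y) := by
  obtain ⟨e, he, hxy⟩ := hxy
  refine ⟨e, he, ?_⟩
  rcases h.ends e with h | h <;> rcases hxy with hxy | hxy <;> simp [h, hxy]

theorem exists_adj (h : IsEmbeddingOf L G φ) {ω : Config E} {x : V} {w : Pt}
    (hxw : openAdj L ω (φ x) w) : ∃ y, φ y = w ∧ Adj G (openSet ω) x y := by
  obtain ⟨e, he, hxw⟩ := hxw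
  have hGe : G e = ((G e).1, (G e).2) := rfl
  rcases h.ends e with h' | h' <;> rw [h'] at hxw <;> simp only [Prod.mk.injEq] at hxw <;>
    rcases hxw with ⟨h1, h2⟩ | ⟨h1, h2⟩
  · exact ⟨_, h2, e, he, Or.inl (by rw [← h.injective h1])⟩
  · exact ⟨_, h1, e, he, Or.inr (by rw [← h.injective h2])⟩
  · exact ⟨_, h2, e, he, Or.inr (by rw [← h.injective h1])⟩
  · exact ⟨_, h1, e, he, Or.inl (by rw [← h.injective h2])⟩

theorem cluster_eq (h : IsEmbeddingOf L G φ) (ω : Config E) (x : V) :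
    cluster L ω (φ x) = φ '' {y | Conn G (openSet ω) x y} := by
  ext w
  constructor
  · intro hw
    change Relation.ReflTransGen (openAdj L ω) (φ x) w at hw
    induction hw with
    | refl => exact ⟨x, Conn.refl _, rfl⟩
    | tail _ hbw ih =>
      obtain ⟨y, hy, rfl⟩ := ih
      obtain ⟨z, rfl, hz⟩ := h.exists_adj hbw
      exact ⟨z, Conn.trans hy hz.conn, rfl⟩
  · rintro ⟨y, hy, rfl⟩
    exact Relation.ReflTransGen.lift φ (fun a b hab => h.openAdj_of_adj hab) _ _ hy

theorem exists_of_mem_vertexSet (h : IsEmbeddingOf L G φ) {v : Pt} (hv : v ∈ vertexSet L) :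
    ∃ x, φ x = v := by
  obtain ⟨e, he⟩ := mem_iUnion.1 hv
  rcases h.ends e with h | h <;> rw [h] at he <;> rcases he with rfl | rfl <;> exact ⟨_, rfl⟩

theorem measure_infinite_cluster [Countable V] (h : IsEmbeddingOf L G φ) (hinc : IsInc G inc)
    (hp : Unit01 p) {P : Measure (Config E)} (hP : IsBernoulliProduct p P)
    (hex : ∀ c : ℝ, 0 < c → ∀ x, ∃ S : Finset V, x ∈ S ∧
      Pr p (S.biUnion inc) (Exits G S x) ≤ c) :
    P {ω | ∃ v ∈ vertexSet L, (cluster L ω v).Infinite} = 0 := by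
  refine measure_mono_null (t := ⋃ x : V, {ω | {y | Conn G (openSet ω) x y}.Infinite}) ?_
    (measure_iUnion_null fun x => measure_infinite_eq_zero hinc hp hP x fun c hc => hex c hc x)
  rintro ω ⟨v, hv, hi⟩
  obtain ⟨x, rfl⟩ := h.exists_of_mem_vertexSet hv
  rw [h.cluster_eq] at hi
  exact mem_iUnion.2 ⟨x, hi.of_image φ⟩

theorem measure_encard_cluster_le [Countable V] (h : IsEmbeddingOf L G φ) (hinc : IsInc G inc)
    (hp : Unit01 p) {P : Measure (Config E)} (hP : IsBernoulliProduct p P)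
    (hex : ∃ C : ℝ, 0 < C ∧ ∃ d : ℝ, 0 < d ∧ ∀ (x : V) (D : Finset V) (k : ℕ),
      Pr p (insF G inc D) (fun t => k ≤ (clF G D {x} t).card) ≤ C * Real.exp (-d * k)) :
    ∃ c : ℝ, 0 < c ∧ ∃ d : ℝ, 0 < d ∧ ∀ v ∈ vertexSet L, ∀ k : ℕ,
      P {ω | (k : ℕ∞) ≤ (cluster L ω v).encard} ≤ ENNReal.ofReal (c * Real.exp (-d * k)) := by
  obtain ⟨C, hC, d, hd, hex⟩ := hex
  refine ⟨C, hC, d, hd, fun v hv k => ?_⟩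
  obtain ⟨x, rfl⟩ := h.exists_of_mem_vertexSet hv
  simp only [h.cluster_eq, h.injective.encard_image]
  exact measure_encard_le hinc hp hP x k fun D => hex x D k

theorem measure_connToInfinity_ge [Countable V] (h : IsEmbeddingOf L G φ) (hinc : IsInc G inc)
    (hp : Unit01 p) {P : Measure (Config E)} (hP : IsBernoulliProduct p P)
    (hex : ∃ θ : ℝ, 0 < θ ∧ ∀ (x : V) (S : Finset V),
      θ ≤ Pr p (S.biUnion inc) (Exits G S x)) :
    ∃ θ : ℝ, 0 < θ ∧ ∀ v ∈ vertexSet L, ENNReal.ofReal θ ≤ P {ω | ConnToInfinity L ω v} := by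
  obtain ⟨θ, hθ, hex⟩ := hex
  refine ⟨θ, hθ, fun v hv => ?_⟩
  obtain ⟨x, rfl⟩ := h.exists_of_mem_vertexSet hv
  refine (measure_infinite_ge hinc hp hP x hθ.le (hex x)).trans (measure_mono fun ω hω => ?_)
  obtain ⟨γ, h0, hγ, hadj⟩ := exists_infinite_path hinc hω
  exact ⟨fun n => φ (γ n), congrArg φ h0, h.injective.comp hγ, fun n => h.openAdj_of_adj (hadj n)⟩

end IsEmbeddingOf

theorem triLattice_isEmbeddingOf : IsEmbeddingOf triLattice triG fun v => tv v.1 v.2 where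
  injective := by
    rintro ⟨a, b⟩ ⟨a', b'⟩ h
    simp only [tv, Prod.mk.injEq] at h
    obtain ⟨h1, h2⟩ := h
    have hb : (b : ℝ) = b' := by linarith
    have h3 := mul_left_cancel₀ (by positivity : Real.sqrt 3 ≠ 0) h1
    rw [hb] at h3
    have ha : (a : ℝ) = a' := by linarith
    rw [Int.cast_inj] at ha hb
    rw [ha, hb]
  ends := by
    rintro ⟨a, b, i⟩
    left
    fin_cases i <;> simp [triLattice, triG]

theorem hexLattice_isEmbeddingOf : IsEmbeddingOf hexLattice hexG
    fun v => if v.1 then hup v.2.1 v.2.2 else hdown v.2.1 v.2.2 where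
  injective := by
    rintro ⟨u, a, b⟩ ⟨u', a', b'⟩ h
    have hy : 3 * b + (if u then 1 else -1) = 3 * b' + (if u' then 1 else -1) := by
      have h2 := congrArg Prod.snd h
      have : (3 * b + (if u then 1 else -1) : ℝ) = 3 * b' + (if u' then 1 else -1) := by
        cases u <;> cases u' <;> simp [hup, hdown] at h2 ⊢ <;> linarith
      cases u <;> cases u' <;> simp at this ⊢ <;> exact_mod_cast this
    have hx : Real.sqrt 3 * ((a : ℝ) + ((b : ℝ) + 1) / 2) =
        Real.sqrt 3 * ((a' : ℝ) + ((b' : ℝ) + 1) / 2) := by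
      have h1 := congrArg Prod.fst h
      cases u <;> cases u' <;> exact h1
    have hu : u = u' := by cases u <;> cases u' <;> simp at hy ⊢ <;> omega
    have hb : b = b' := by subst hu; omega
    have h3 := mul_left_cancel₀ (by positivity : Real.sqrt 3 ≠ 0) hx
    rw [hb] at h3
    have ha : (a : ℝ) = a' := by linarith
    rw [Int.cast_inj] at ha
    rw [hu, ha, hb]
  ends := by
    rintro ⟨a, b, i⟩
    fin_cases i
    · right; simp [hexLattice, hexG]
    · left; simp [hexLattice, hexG]
    · left; simp [hexLattice, hexG]

end Embedding

/-- Sub/supercriticality of the highly inhomogeneous measures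
`P^△_{p,q,q'}` and `P^⬡_{p,q,q'}`:
(a) if `κ_△(p,q_n,q'_n) ≤ 0` for all `n`, there is a.s. no infinite open cluster;
(b) if `κ_△(p,q_n,q'_n) ≤ -δ` for all `n` (some `δ > 0`), the cluster volumes have
exponential tails, uniformly in the vertex;
(c) if `κ_△(p,q_n,q'_n) ≥ δ` for all `n` (some `δ > 0`), the measure is uniformly
supercritical.  The same holds on the hexagonal lattice with `κ_⬡` in place of `κ_△`. -/
theorem highly_inhomogeneous_tri_hex_criticality (p : ℝ) (q q' : ℤ → ℝ)
    (hp : p ∈ Set.Ioo (0 : ℝ) 1)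
    (hq : ∀ n, q n ∈ Set.Ico (0 : ℝ) 1) (hq' : ∀ n, q' n ∈ Set.Ico (0 : ℝ) 1) :
    -- triangular lattice, part (a)
    ((∀ n : ℤ, kappaT p (q n) (q' n) ≤ 0) →
      ∀ P : Measure (Config TriE), IsBernoulliProduct (triHI p q q') P →
        P {ω | ∃ v ∈ vertexSet triLattice, (cluster triLattice ω v).Infinite} = 0) ∧
    -- triangular lattice, part (b)
    ((∃ δ : ℝ, 0 < δ ∧ ∀ n : ℤ, kappaT p (q n) (q' n) ≤ -δ) →
      ∀ P : Measure (Config TriE), IsBernoulliProduct (triHI p q q') P →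
        ∃ c : ℝ, 0 < c ∧ ∃ d : ℝ, 0 < d ∧
          ∀ v ∈ vertexSet triLattice, ∀ k : ℕ,
            P {ω | (k : ℕ∞) ≤ (cluster triLattice ω v).encard} ≤
              ENNReal.ofReal (c * Real.exp (-d * k))) ∧
    -- triangular lattice, part (c): uniform supercriticality
    ((∃ δ : ℝ, 0 < δ ∧ ∀ n : ℤ, δ ≤ kappaT p (q n) (q' n)) →
      ∀ P : Measure (Config TriE), IsBernoulliProduct (triHI p q q') P →
        ∃ θ : ℝ, 0 < θ ∧ ∀ v ∈ vertexSet triLattice,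
          ENNReal.ofReal θ ≤ P {ω | ConnToInfinity triLattice ω v}) ∧
    -- hexagonal lattice, part (a)
    ((∀ n : ℤ, kappaH p (q n) (q' n) ≤ 0) →
      ∀ P : Measure (Config TriE), IsBernoulliProduct (triHI p q q') P →
        P {ω | ∃ v ∈ vertexSet hexLattice, (cluster hexLattice ω v).Infinite} = 0) ∧
    -- hexagonal lattice, part (b)
    ((∃ δ : ℝ, 0 < δ ∧ ∀ n : ℤ, kappaH p (q n) (q' n) ≤ -δ) →
      ∀ P : Measure (Config TriE), IsBernoulliProduct (triHI p q q') P →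
        ∃ c : ℝ, 0 < c ∧ ∃ d : ℝ, 0 < d ∧
          ∀ v ∈ vertexSet hexLattice, ∀ k : ℕ,
            P {ω | (k : ℕ∞) ≤ (cluster hexLattice ω v).encard} ≤
              ENNReal.ofReal (c * Real.exp (-d * k))) ∧
    -- hexagonal lattice, part (c): uniform supercriticality
    ((∃ δ : ℝ, 0 < δ ∧ ∀ n : ℤ, δ ≤ kappaH p (q n) (q' n)) →
      ∀ P : Measure (Config TriE), IsBernoulliProduct (triHI p q q') P →
        ∃ θ : ℝ, 0 < θ ∧ ∀ v ∈ vertexSet hexLattice,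
          ENNReal.ofReal θ ≤ P {ω | ConnToInfinity hexLattice ω v}) := by
  have hqI : ∀ n, q n ∈ Icc (0 : ℝ) 1 := fun n => Ico_subset_Icc_self (hq n)
  have hqI' : ∀ n, q' n ∈ Icc (0 : ℝ) 1 := fun n => Ico_subset_Icc_self (hq' n)
  have hu := triHI_unit (Ioo_subset_Icc_self hp) hqI hqI'
  have hp' : 1 - p ∈ Ioo (0 : ℝ) 1 := ⟨by linarith [hp.2], by linarith [hp.1]⟩
  refine ⟨fun hκ P hP => ?_, fun ⟨δ, hδ, hκ⟩ P hP => ?_, fun ⟨δ, hδ, hκ⟩ P hP => ?_,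
    fun hκ P hP => ?_, fun ⟨δ, hδ, hκ⟩ P hP => ?_, fun ⟨δ, hδ, hκ⟩ P hP => ?_⟩
  · refine triLattice_isEmbeddingOf.measure_infinite_cluster isInc_tri hu hP fun c hc x => ?_
    obtain ⟨K, hK⟩ := tri_exit_small hp (fun ε hε => sq_theta_small hp hε) hc
    obtain ⟨S, hx, -, hS⟩ := hK q q' hqI hqI' hκ x
    exact ⟨S, hx, hS⟩
  · exact triLattice_isEmbeddingOf.measure_encard_cluster_le isInc_tri hu hP
      (tri_exp_tail hp hqI hqI' hδ hκ)
  · exact triLattice_isEmbeddingOf.measure_connToInfinity_ge isInc_tri hu hP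
      (tri_exits_ge hp hqI hqI' hδ hκ)
  · refine hexLattice_isEmbeddingOf.measure_infinite_cluster isInc_hex hu hP fun c hc x => ?_
    obtain ⟨K, hK⟩ := hex_exit_small hp (fun ε hε => sq_theta_small hp' hε) hc
    obtain ⟨S, hx, -, hS⟩ := hK q q' hqI hqI' hκ x
    exact ⟨S, hx, hS⟩
  · exact hexLattice_isEmbeddingOf.measure_encard_cluster_le isInc_hex hu hP
      (hex_exp_tail hp hqI hqI' hδ hκ)
  · exact hexLattice_isEmbeddingOf.measure_connToInfinity_ge isInc_hex hu hP
      (hex_exits_ge hp hqI hqI' hδ hκ)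

end Perc
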